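/- Let u₁, u₂ be two distinct bounded classical solutions of the scalar reaction-diffusion equation uₜ = uₓₓ + g(t,u,uₓ) on the circle. Then there exist T > 0 and a natural number N such that for every t ≥ T all zeros of the function x ↦ u₁(t,x) − u₂(t,x) on [0,2π) are simple and z(u₁(t,·) − u₂(t,·)) = N; in particular the zero number z(u₁(t,·) − u₂(t,·)) can drop only finitely many times. -/

import Mathlib

open Real Set Filter

noncomputable def zeroNum (u : ℝ → ℝ) : ℕ∞ :=
  {x ∈ Set.Ico (0 : ℝ) (2 * Real.pi) | u x = 0}.encard

def Admissible (h : ℝ → ℝ → ℝ → ℝ) : Prop :=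
  ∀ K : Set (ℝ × ℝ), IsCompact K →
    (∃ M : ℝ, ∀ t : ℝ, ∀ q ∈ K, |h t q.1 q.2| ≤ M) ∧
    UniformContinuousOn (fun p : ℝ × ℝ × ℝ => h p.1 p.2.1 p.2.2) (Set.univ ×ˢ K)

open scoped Topology

structure Sol (w wt wx wxx : ℝ → ℝ → ℝ) : Prop where
  c0 : ∀ t > 0, ∀ x, ContinuousAt (fun p : ℝ × ℝ => w p.1 p.2) (t, x)
  ct : ∀ t > 0, ∀ x, ContinuousAt (fun p : ℝ × ℝ => wt p.1 p.2) (t, x)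
  cx : ∀ t > 0, ∀ x, ContinuousAt (fun p : ℝ × ℝ => wx p.1 p.2) (t, x)
  cxx : ∀ t > 0, ∀ x, ContinuousAt (fun p : ℝ × ℝ => wxx p.1 p.2) (t, x)
  dt : ∀ t > (0:ℝ), ∀ x : ℝ, HasDerivAt (fun s => w s x) (wt t x) t
  dx : ∀ t > (0:ℝ), ∀ x : ℝ, HasDerivAt (fun y => w t y) (wx t x) x
  dxx : ∀ t > (0:ℝ), ∀ x : ℝ, HasDerivAt (fun y => wx t y) (wxx t x) x
  per : ∀ t > (0:ℝ), ∀ x : ℝ, w t (x + 2 * π) = w t x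
  bd : ∀ η > (0:ℝ), ∃ M > (0:ℝ), ∀ t ≥ η, ∀ x, |wt t x - wxx t x| ≤ M * (|wx t x| + |w t x|)

namespace Sol
variable {w wt wx wxx : ℝ → ℝ → ℝ}

theorem neg (h : Sol w wt wx wxx) :
    Sol (fun t x => - w t x) (fun t x => - wt t x) (fun t x => - wx t x) (fun t x => - wxx t x) where
  c0 t ht x := (h.c0 t ht x).neg
  ct t ht x := (h.ct t ht x).neg
  cx t ht x := (h.cx t ht x).neg
  cxx t ht x := (h.cxx t ht x).neg
  dt t ht x := (h.dt t ht x).neg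
  dx t ht x := (h.dx t ht x).neg
  dxx t ht x := (h.dxx t ht x).neg
  per t ht x := by rw [h.per t ht x]
  bd η hη := by
    obtain ⟨M, hM, H⟩ := h.bd η hη
    refine ⟨M, hM, fun t ht x => ?_⟩
    have := H t ht x
    rw [abs_neg, abs_neg, show - wt t x - - wxx t x = -(wt t x - wxx t x) by ring, abs_neg]
    exact this

theorem refl (h : Sol w wt wx wxx) :
    Sol (fun t x => w t (-x)) (fun t x => wt t (-x)) (fun t x => - wx t (-x))
      (fun t x => wxx t (-x)) where
  c0 t ht x := ContinuousAt.comp' (g := fun p : ℝ × ℝ => w p.1 p.2) (f := fun p : ℝ × ℝ => (p.1, -p.2)) (h.c0 t ht (-x)) (by fun_prop)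
  ct t ht x := ContinuousAt.comp' (g := fun p : ℝ × ℝ => wt p.1 p.2) (f := fun p : ℝ × ℝ => (p.1, -p.2)) (h.ct t ht (-x)) (by fun_prop)
  cx t ht x := ContinuousAt.neg (ContinuousAt.comp' (g := fun p : ℝ × ℝ => wx p.1 p.2) (f := fun p : ℝ × ℝ => (p.1, -p.2)) (h.cx t ht (-x)) (by fun_prop))
  cxx t ht x := ContinuousAt.comp' (g := fun p : ℝ × ℝ => wxx p.1 p.2) (f := fun p : ℝ × ℝ => (p.1, -p.2)) (h.cxx t ht (-x)) (by fun_prop)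
  dt t ht x := h.dt t ht (-x)
  dx t ht x := by
    have := (h.dx t ht (-x)).comp x (hasDerivAt_neg x)
    simpa [Function.comp_def] using this
  dxx t ht x := by
    have := ((h.dxx t ht (-x)).comp x (hasDerivAt_neg x)).fun_neg
    simpa [Function.comp_def] using this
  per t ht x := by
    have := h.per t ht (-(x + 2 * π))
    rw [← this]; congr 1; ring
  bd η hη := by
    obtain ⟨M, hM, H⟩ := h.bd η hη
    refine ⟨M, hM, fun t ht x => ?_⟩
    rw [abs_neg]; exact H t ht (-x)

theorem perx (h : Sol w wt wx wxx) (t : ℝ) (ht : 0 < t) (x : ℝ) : wx t (x + 2 * π) = wx t x := by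
  have h1 := (h.dx t ht (x + 2 * π)).comp_add_const x (2*π)
  have h2 : (fun y => w t (y + 2 * π)) = fun y => w t y := funext fun y => h.per t ht y
  rw [h2] at h1
  exact h1.unique (h.dx t ht x)

theorem perxx (h : Sol w wt wx wxx) (t : ℝ) (ht : 0 < t) (x : ℝ) : wxx t (x + 2 * π) = wxx t x := by
  have h1 := (h.dxx t ht (x + 2 * π)).comp_add_const x (2*π)
  have h2 : (fun y => wx t (y + 2 * π)) = fun y => wx t y := funext fun y => h.perx t ht y
  rw [h2] at h1
  exact h1.unique (h.dxx t ht x)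

theorem pert (h : Sol w wt wx wxx) (t : ℝ) (ht : 0 < t) (x : ℝ) : wt t (x + 2 * π) = wt t x := by
  have h1 := h.dt t ht (x + 2 * π)
  have h2 : (fun s => w s (x + 2 * π)) =ᶠ[𝓝 t] fun s => w s x := by
    filter_upwards [lt_mem_nhds ht] with s hs using h.per s hs x
  exact (h1.congr_of_eventuallyEq h2.symm).unique (h.dt t ht x)

theorem per_int (h : Sol w wt wx wxx) (t : ℝ) (ht : 0 < t) (x : ℝ) (n : ℤ) :
    w t (x + n * (2 * π)) = w t x :=
  (show Function.Periodic (w t) (2*π) from h.per t ht).int_mul n x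

theorem cont_x (h : Sol w wt wx wxx) (t : ℝ) (ht : 0 < t) : Continuous (w t) :=
  continuous_iff_continuousAt.2 fun x => (h.dx t ht x).continuousAt

theorem contx_x (h : Sol w wt wx wxx) (t : ℝ) (ht : 0 < t) : Continuous (wx t) :=
  continuous_iff_continuousAt.2 fun x => (h.dxx t ht x).continuousAt

/-- uniform bounds on time slabs -/
theorem bound_aux {f : ℝ → ℝ → ℝ} (hc : ∀ t > 0, ∀ x, ContinuousAt (fun p : ℝ × ℝ => f p.1 p.2) (t, x))
    (hp : ∀ t > (0:ℝ), ∀ x : ℝ, f t (x + 2 * π) = f t x) (a b : ℝ) (ha : 0 < a) :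
    ∃ C > 0, ∀ t ∈ Icc a b, ∀ x, |f t x| ≤ C := by
  have hK : IsCompact (Icc a b ×ˢ Icc (0:ℝ) (2*π)) := isCompact_Icc.prod isCompact_Icc
  have hco : ContinuousOn (fun p : ℝ × ℝ => f p.1 p.2) (Icc a b ×ˢ Icc (0:ℝ) (2*π)) := by
    rintro ⟨t, x⟩ ⟨h1, -⟩
    exact (hc t (lt_of_lt_of_le ha h1.1) x).continuousWithinAt
  obtain ⟨C, hC⟩ := hK.exists_bound_of_continuousOn hco
  refine ⟨max C 1, by positivity, fun t ht x => ?_⟩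
  have hper : Function.Periodic (f t) (2*π) := hp t (lt_of_lt_of_le ha ht.1)
  obtain ⟨y, hy, hxy⟩ := hper.exists_mem_Ico₀ (by positivity) x
  rw [hxy]
  exact (hC (t, y) ⟨ht, hy.1, hy.2.le⟩).trans (le_max_left _ _)

end Sol

theorem mk_sol (g gu gp : ℝ → ℝ → ℝ → ℝ)
    (hgu : ∀ t u p : ℝ, HasDerivAt (fun v => g t v p) (gu t u p) u)
    (hgp : ∀ t u p : ℝ, HasDerivAt (fun q => g t u q) (gp t u p) p)
    (hbu : ∀ R : ℝ, ∃ M, ∀ t u p, |u| ≤ R → |p| ≤ R → |gu t u p| ≤ M)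
    (hbp : ∀ R : ℝ, ∃ M, ∀ t u p, |u| ≤ R → |p| ≤ R → |gp t u p| ≤ M)
    (u₁ u₂ u₁t u₁x u₁xx u₂t u₂x u₂xx : ℝ → ℝ → ℝ)
    (hu₁_cont : ContinuousOn (fun p : ℝ × ℝ => u₁ p.1 p.2) (Set.Ici 0 ×ˢ Set.univ))
    (hu₂_cont : ContinuousOn (fun p : ℝ × ℝ => u₂ p.1 p.2) (Set.Ici 0 ×ˢ Set.univ))
    (hu₁t_cont : ContinuousOn (fun p : ℝ × ℝ => u₁t p.1 p.2) (Set.Ioi 0 ×ˢ Set.univ))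
    (hu₁x_cont : ContinuousOn (fun p : ℝ × ℝ => u₁x p.1 p.2) (Set.Ioi 0 ×ˢ Set.univ))
    (hu₁xx_cont : ContinuousOn (fun p : ℝ × ℝ => u₁xx p.1 p.2) (Set.Ioi 0 ×ˢ Set.univ))
    (hu₂t_cont : ContinuousOn (fun p : ℝ × ℝ => u₂t p.1 p.2) (Set.Ioi 0 ×ˢ Set.univ))
    (hu₂x_cont : ContinuousOn (fun p : ℝ × ℝ => u₂x p.1 p.2) (Set.Ioi 0 ×ˢ Set.univ))
    (hu₂xx_cont : ContinuousOn (fun p : ℝ × ℝ => u₂xx p.1 p.2) (Set.Ioi 0 ×ˢ Set.univ))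
    (hu₁per : ∀ t ≥ (0:ℝ), ∀ x : ℝ, u₁ t (x + 2 * Real.pi) = u₁ t x)
    (hu₂per : ∀ t ≥ (0:ℝ), ∀ x : ℝ, u₂ t (x + 2 * Real.pi) = u₂ t x)
    (hu₁_dt : ∀ t > (0:ℝ), ∀ x : ℝ, HasDerivAt (fun s => u₁ s x) (u₁t t x) t)
    (hu₁_dx : ∀ t > (0:ℝ), ∀ x : ℝ, HasDerivAt (fun y => u₁ t y) (u₁x t x) x)
    (hu₁_dxx : ∀ t > (0:ℝ), ∀ x : ℝ, HasDerivAt (fun y => u₁x t y) (u₁xx t x) x)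
    (hu₂_dt : ∀ t > (0:ℝ), ∀ x : ℝ, HasDerivAt (fun s => u₂ s x) (u₂t t x) t)
    (hu₂_dx : ∀ t > (0:ℝ), ∀ x : ℝ, HasDerivAt (fun y => u₂ t y) (u₂x t x) x)
    (hu₂_dxx : ∀ t > (0:ℝ), ∀ x : ℝ, HasDerivAt (fun y => u₂x t y) (u₂xx t x) x)
    (heq₁ : ∀ t > (0:ℝ), ∀ x : ℝ, u₁t t x = u₁xx t x + g t (u₁ t x) (u₁x t x))
    (heq₂ : ∀ t > (0:ℝ), ∀ x : ℝ, u₂t t x = u₂xx t x + g t (u₂ t x) (u₂x t x))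
    (hbdd : ∀ η > (0:ℝ), ∃ M : ℝ, ∀ t ≥ η, ∀ x : ℝ,
      |u₁ t x| ≤ M ∧ |u₁x t x| ≤ M ∧ |u₂ t x| ≤ M ∧ |u₂x t x| ≤ M) :
    Sol (fun t x => u₁ t x - u₂ t x) (fun t x => u₁t t x - u₂t t x)
      (fun t x => u₁x t x - u₂x t x) (fun t x => u₁xx t x - u₂xx t x) := by
  have key : ∀ f : ℝ → ℝ → ℝ, ContinuousOn (fun p : ℝ × ℝ => f p.1 p.2) (Set.Ioi 0 ×ˢ Set.univ) →
      ∀ t > 0, ∀ x, ContinuousAt (fun p : ℝ × ℝ => f p.1 p.2) (t, x) := by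
    intro f hf t ht x
    exact hf.continuousAt ((isOpen_Ioi.prod isOpen_univ).mem_nhds ⟨ht, mem_univ _⟩)
  have hsub : (Set.Ioi (0:ℝ) ×ˢ (Set.univ : Set ℝ)) ⊆ Set.Ici 0 ×ˢ Set.univ :=
    prod_mono Ioi_subset_Ici_self subset_rfl
  refine ⟨fun t ht x => (key _ (hu₁_cont.mono hsub) t ht x).sub (key _ (hu₂_cont.mono hsub) t ht x),
    fun t ht x => (key _ hu₁t_cont t ht x).sub (key _ hu₂t_cont t ht x),
    fun t ht x => (key _ hu₁x_cont t ht x).sub (key _ hu₂x_cont t ht x),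
    fun t ht x => (key _ hu₁xx_cont t ht x).sub (key _ hu₂xx_cont t ht x),
    fun t ht x => (hu₁_dt t ht x).sub (hu₂_dt t ht x),
    fun t ht x => (hu₁_dx t ht x).sub (hu₂_dx t ht x),
    fun t ht x => (hu₁_dxx t ht x).sub (hu₂_dxx t ht x),
    fun t ht x => by rw [hu₁per t ht.le, hu₂per t ht.le], ?_⟩
  intro η hη
  obtain ⟨R, hR⟩ := hbdd η hη
  obtain ⟨M1, hM1⟩ := hbu R
  obtain ⟨M2, hM2⟩ := hbp R
  refine ⟨max (max M1 M2) 1, by positivity, fun t ht x => ?_⟩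
  obtain ⟨h1, h2, h3, h4⟩ := hR t ht x
  have e : u₁t t x - u₂t t x - (u₁xx t x - u₂xx t x) =
      (g t (u₁ t x) (u₁x t x) - g t (u₂ t x) (u₁x t x)) + (g t (u₂ t x) (u₁x t x) - g t (u₂ t x) (u₂x t x)) := by
    rw [heq₁ t (by linarith) x, heq₂ t (by linarith) x]; ring
  have a1 : |g t (u₁ t x) (u₁x t x) - g t (u₂ t x) (u₁x t x)| ≤ M1 * |u₁ t x - u₂ t x| := by
    have := Convex.norm_image_sub_le_of_norm_hasDerivWithin_le (f := fun v => g t v (u₁x t x))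
      (f' := fun v => gu t v (u₁x t x)) (s := Icc (-R) R) (C := M1)
      (x := u₂ t x) (y := u₁ t x) (fun v hv => (hgu t v _).hasDerivWithinAt)
      (fun v hv => hM1 t v _ (abs_le.2 hv) h2) (convex_Icc _ _) (abs_le.1 h3) (abs_le.1 h1)
    simpa using this
  have a2 : |g t (u₂ t x) (u₁x t x) - g t (u₂ t x) (u₂x t x)| ≤ M2 * |u₁x t x - u₂x t x| := by
    have := Convex.norm_image_sub_le_of_norm_hasDerivWithin_le (f := fun v => g t (u₂ t x) v)
      (f' := fun v => gp t (u₂ t x) v) (s := Icc (-R) R) (C := M2)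
      (x := u₂x t x) (y := u₁x t x) (fun v hv => (hgp t _ v).hasDerivWithinAt)
      (fun v hv => hM2 t _ v h3 (abs_le.2 hv)) (convex_Icc _ _) (abs_le.1 h4) (abs_le.1 h2)
    simpa using this
  simp only [e]
  have b1 : M1 ≤ max (max M1 M2) 1 := by simp
  have b2 : M2 ≤ max (max M1 M2) 1 := by simp
  have := abs_add_le (g t (u₁ t x) (u₁x t x) - g t (u₂ t x) (u₁x t x)) (g t (u₂ t x) (u₁x t x) - g t (u₂ t x) (u₂x t x))
  have c1 := mul_le_mul_of_nonneg_right b1 (abs_nonneg (u₁ t x - u₂ t x))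
  have c2 := mul_le_mul_of_nonneg_right b2 (abs_nonneg (u₁x t x - u₂x t x))
  linarith

def Reach (w : ℝ → ℝ → ℝ) (t1 p : ℝ) (s x : ℝ) : Prop :=
  s ≤ t1 ∧ ∃ k : ℤ, ∃ γ : ℝ → ℝ, Continuous γ ∧ γ t1 = p + k * (2 * π) ∧ γ s = x ∧
    ∀ r ∈ Icc s t1, 0 < w r (γ r)

theorem Reach.extend {w : ℝ → ℝ → ℝ} {t1 p s x a b ρ s' x' : ℝ}
    (h : Reach w t1 p s x) (hbox : ∀ s x, |s - a| < ρ → |x - b| < ρ → 0 < w s x)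
    (hs : |s - a| < ρ) (hx : |x - b| < ρ) (hs' : |s' - a| < ρ) (hx' : |x' - b| < ρ) (hlt : s' < s) :
    Reach w t1 p s' x' := by
  obtain ⟨hst, k, γ, hγ, h1, h2, h3⟩ := h
  refine ⟨by linarith, k, fun r => γ (max r s) + (s - min r s) * ((x' - x) / (s - s')), by fun_prop, ?_, ?_, ?_⟩
  · simp [max_eq_left hst, min_eq_right hst, h1]
  · have : s - s' ≠ 0 := by linarith
    simp only [max_eq_right hlt.le, min_eq_left hlt.le, h2]
    field_simp; ring
  · intro r hr
    rcases le_total s r with hsr | hsr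
    · simp only [max_eq_left hsr, min_eq_right hsr, sub_self, zero_mul, add_zero]
      exact h3 r ⟨hsr, hr.2⟩
    · simp only [max_eq_right hsr, min_eq_left hsr, h2]
      rw [abs_lt] at *
      apply hbox
      · rw [abs_lt]; constructor <;> linarith [hr.1]
      · have hpos : 0 < s - s' := by linarith
        have e : x + (s - r) * ((x' - x) / (s - s')) - b =
            (1 - (s - r)/(s-s')) * (x - b) + ((s - r)/(s-s')) * (x' - b) := by
          field_simp; ring
        have t0 : 0 ≤ (s - r)/(s-s') := div_nonneg (by linarith) hpos.le
        have t1' : (s - r)/(s-s') ≤ 1 := by rw [div_le_one hpos]; linarith [hr.1]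
        rw [e, abs_lt]
        generalize (s - r)/(s-s') = θ at *
        constructor
        · rcases eq_or_lt_of_le t0 with h0 | h0
          · rw [← h0]; linarith
          · nlinarith
        · rcases eq_or_lt_of_le t0 with h0 | h0
          · rw [← h0]; linarith
          · nlinarith

theorem Reach.translate {w wt wx wxx : ℝ → ℝ → ℝ} (hw : Sol w wt wx wxx) {t1 p s x : ℝ} (hs : 0 < s)
    (h : Reach w t1 p s x) (n : ℤ) : Reach w t1 p s (x + n * (2 * π)) := by
  obtain ⟨hst, k, γ, hγ, h1, h2, h3⟩ := h
  refine ⟨hst, k + n, fun r => γ r + n * (2*π), by fun_prop, ?_, ?_, ?_⟩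
  · simp [h1]; ring
  · simp [h2]
  · intro r hr
    rw [hw.per_int r (by linarith [hr.1])]
    exact h3 r hr

/-- derivative at a one-sided maximum -/
theorem deriv_nonneg_of_left_max {f : ℝ → ℝ} {f' a ε : ℝ} (hf : HasDerivAt f f' a) (hε : 0 < ε)
    (h : ∀ s, a - ε < s → s < a → f s ≤ f a) : 0 ≤ f' := by
  have h1 := (hasDerivAt_iff_tendsto_slope.1 hf).mono_left (nhdsWithin_mono a (show Iio a ⊆ {a}ᶜ from fun x hx => ne_of_lt hx))
  refine ge_of_tendsto h1 ?_
  filter_upwards [self_mem_nhdsWithin, mem_nhdsWithin_of_mem_nhds (lt_mem_nhds (show a - ε < a by linarith))] with s hs hs2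
  rw [slope_def_field]
  have hs : s < a := hs
  have := h s hs2 hs
  exact div_nonneg_of_nonpos (by linarith) (by linarith)

theorem second_deriv_nonpos_of_max {f f1 : ℝ → ℝ} {f2 a ε : ℝ} (hf : ∀ x, HasDerivAt f (f1 x) x)
    (hf1 : HasDerivAt f1 f2 a) (hε : 0 < ε) (h : ∀ x, |x - a| < ε → f x ≤ f a) :
    f1 a = 0 ∧ f2 ≤ 0 := by
  have hev : ∀ᶠ x in 𝓝 a, |x - a| < ε := by
    have := Metric.ball_mem_nhds a hε
    filter_upwards [this] with x hx
    rwa [Metric.mem_ball, Real.dist_eq] at hx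
  have hlm : IsLocalMax f a := by
    filter_upwards [hev] with x hx using h x hx
  have h0 : f1 a = 0 := hlm.hasDerivAt_eq_zero (hf a)
  refine ⟨h0, ?_⟩
  by_contra hcon
  push Not at hcon
  have hd : deriv f = f1 := funext fun x => (hf x).deriv
  have hmin : IsLocalMin f a := by
    apply isLocalMin_of_deriv_deriv_pos
    · rw [hd, hf1.deriv]; exact hcon
    · rw [hd]; exact h0
    · exact (hf a).continuousAt
  have hconst : f =ᶠ[𝓝 a] fun _ => f a := by
    filter_upwards [hlm, hmin] with x h1 h2 using le_antisymm h1 h2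
  have h3 : f1 =ᶠ[𝓝 a] fun _ => 0 := by
    filter_upwards [hconst.eventuallyEq_nhds] with x hx
    exact (hf x).unique ((hasDerivAt_const x (f a)).congr_of_eventuallyEq hx)
  have := hf1.unique ((hasDerivAt_const a (0:ℝ)).congr_of_eventuallyEq h3)
  linarith

theorem path_pos {w wt wx wxx : ℝ → ℝ → ℝ} (hw : Sol w wt wx wxx) {t0 t1 p : ℝ} (h0 : 0 < t0)
    (h01 : t0 ≤ t1) (hp : 0 < w t1 p) :
    ∃ γ : ℝ → ℝ, Continuous γ ∧ γ t1 = p ∧ ∀ s ∈ Icc t0 t1, 0 < w s (γ s) := by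
  suffices H : ∃ x, Reach w t1 p t0 x by
    obtain ⟨x, -, k, γ, hγ, h1, -, h3⟩ := H
    refine ⟨fun r => γ r - k * (2*π), by fun_prop, by simp [h1], fun s hs => ?_⟩
    have := hw.per_int s (by linarith [hs.1]) (γ s - k * (2*π)) k
    rw [← this]; simpa using h3 s hs
  by_contra hno
  push Not at hno
  obtain ⟨M, hM, hbd⟩ := hw.bd t0 h0
  set K := M + 1 with hK
  set R0 : Set (ℝ × ℝ) := {q | q ∈ Icc t0 t1 ×ˢ Icc (0:ℝ) (2*π) ∧ Reach w t1 p q.1 q.2} with hR0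
  have hsub : R0 ⊆ Icc t0 t1 ×ˢ Icc (0:ℝ) (2*π) := fun q hq => hq.1
  have hcl : closure R0 ⊆ Icc t0 t1 ×ˢ Icc (0:ℝ) (2*π) :=
    closure_minimal hsub (isClosed_Icc.prod isClosed_Icc)
  have hcomp : IsCompact (closure R0) :=
    (isCompact_Icc.prod isCompact_Icc).of_isClosed_subset isClosed_closure hcl
  have tomod : ∀ s x, t0 ≤ s → s ≤ t1 → Reach w t1 p s x → ∃ y, (s, y) ∈ R0 ∧ w s y = w s x := by
    intro s x hs1 hs2 hr
    have hper : Function.Periodic (w s) (2*π) := hw.per s (by linarith)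
    obtain ⟨n, hn, -⟩ := existsUnique_add_zsmul_mem_Ico (show 0 < 2*π by positivity) x 0
    rw [zsmul_eq_mul] at hn
    refine ⟨x + n * (2*π), ⟨⟨⟨hs1, hs2⟩, hn.1, by linarith [hn.2]⟩, hr.translate hw (by linarith) n⟩, ?_⟩
    exact hw.per_int s (by linarith) x n
  have hne : ∃ q ∈ R0, 0 < w q.1 q.2 := by
    have : Reach w t1 p t1 p := ⟨le_rfl, 0, fun _ => p, continuous_const, by simp, rfl, by
      intro r hr
      have : r = t1 := le_antisymm hr.2 hr.1
      rw [this]; exact hp⟩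
    obtain ⟨y, hy, hy2⟩ := tomod t1 p h01 le_rfl this
    exact ⟨_, hy, by simpa [hy2] using hp⟩
  obtain ⟨q0, hq0, hq0p⟩ := hne
  have hcont : ContinuousOn (fun q : ℝ × ℝ => exp (-K * q.1) * w q.1 q.2) (closure R0) := by
    rintro ⟨s, x⟩ hq
    refine ContinuousAt.continuousWithinAt ?_
    exact ContinuousAt.mul (by fun_prop) (hw.c0 s (by linarith [(hcl hq).1.1]) x)
  obtain ⟨⟨a, b⟩, hab, hmax⟩ := hcomp.exists_isMaxOn ⟨q0, subset_closure hq0⟩ hcont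
  have hmax' : ∀ s x, t0 ≤ s → s ≤ t1 → Reach w t1 p s x → exp (-K * s) * w s x ≤ exp (-K * a) * w a b := by
    intro s x h1 h2 hr
    obtain ⟨y, hy, hy2⟩ := tomod s x h1 h2 hr
    rw [← hy2]
    exact hmax (subset_closure hy)
  have ha0 : t0 ≤ a := (hcl hab).1.1
  have ha1 : a ≤ t1 := (hcl hab).1.2
  have ha : 0 < a := by linarith
  have hwab : 0 < w a b := by
    have h1 : exp (-K * q0.1) * w q0.1 q0.2 ≤ exp (-K * a) * w a b := hmax (subset_closure hq0)
    have h2 : 0 < exp (-K * q0.1) * w q0.1 q0.2 := by positivity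
    have h3 : 0 < exp (-K * a) * w a b := by linarith
    exact (pos_iff_pos_of_mul_pos h3).1 (exp_pos _)
  obtain ⟨ρ, hρ, hbox⟩ : ∃ ρ > 0, ∀ s x, |s - a| < ρ → |x - b| < ρ → 0 < w s x := by
    have := (hw.c0 a ha b).eventually (lt_mem_nhds hwab)
    rw [Metric.eventually_nhds_iff] at this
    obtain ⟨ρ, hρ, h⟩ := this
    refine ⟨ρ, hρ, fun s x h1 h2 => ?_⟩
    exact h (y := (s, x)) (by rw [Prod.dist_eq]; exact max_lt h1 h2)
  have hcls : ∀ ε > 0, ∃ s x, |s - a| < ε ∧ |x - b| < ε ∧ t0 ≤ s ∧ Reach w t1 p s x := by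
    intro ε hε
    obtain ⟨⟨s, x⟩, hq, hd⟩ := Metric.mem_closure_iff.1 hab ε hε
    rw [dist_comm, Prod.dist_eq, max_lt_iff] at hd
    exact ⟨s, x, hd.1, hd.2, hq.1.1.1, hq.2⟩
  have hloc : ∀ s' x', |s' - a| < ρ → |x' - b| < ρ → s' < a → Reach w t1 p s' x' := by
    intro s' x' h1 h2 h3
    obtain ⟨s, x, g1, g2, g3, g4⟩ := hcls (min ρ (a - s')) (lt_min hρ (by linarith))
    refine g4.extend hbox (g1.trans_le (min_le_left _ _)) (g2.trans_le (min_le_left _ _)) h1 h2 ?_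
    have := g1.trans_le (min_le_right _ _)
    rw [abs_lt] at this; linarith
  have hat : t0 < a := by
    rcases eq_or_lt_of_le ha0 with h | h
    · exfalso
      obtain ⟨s, x, g1, g2, g3, g4⟩ := hcls ρ hρ
      rcases eq_or_lt_of_le g3 with h' | h'
      · exact hno x (h' ▸ g4)
      · exact hno x (g4.extend hbox g1 g2 (by rw [h]; simpa using hρ) g2 h')
    · exact h
  -- maximum on the past box
  set ε := min ρ (a - t0) with hε
  have hεp : 0 < ε := lt_min hρ (by linarith)
  have hv1 : ∀ s x, a - ε < s → s < a → |x - b| < ρ → exp (-K * s) * w s x ≤ exp (-K * a) * w a b := by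
    intro s x h1 h2 h3
    have e1 : ε ≤ ρ := min_le_left _ _
    have e2 : ε ≤ a - t0 := min_le_right _ _
    exact hmax' s x (by linarith) (by linarith)
      (hloc s x (by rw [abs_lt]; constructor <;> linarith) h3 h2)
  have hv2 : ∀ x, |x - b| < ρ → w a x ≤ w a b := by
    intro x hx
    have hc : Tendsto (fun s => exp (-K * s) * w s x) (𝓝[<] a) (𝓝 (exp (-K * a) * w a x)) := by
      apply tendsto_nhdsWithin_of_tendsto_nhds
      exact (ContinuousAt.mul (by fun_prop) (hw.dt a ha x).continuousAt).tendsto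
    have : exp (-K * a) * w a x ≤ exp (-K * a) * w a b := by
      refine le_of_tendsto hc ?_
      filter_upwards [self_mem_nhdsWithin, mem_nhdsWithin_of_mem_nhds (lt_mem_nhds (show a - ε < a by linarith))] with s hs hs2
      exact hv1 s x hs2 hs hx
    exact le_of_mul_le_mul_left this (exp_pos _)
  obtain ⟨hx0, hxx0⟩ := second_deriv_nonpos_of_max (fun x => hw.dx a ha x) (hw.dxx a ha b) hρ hv2
  have hdv : HasDerivAt (fun s => exp (-K * s) * w s b) (exp (-K * a) * (-K) * w a b + exp (-K * a) * wt a b) a := by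
    have h1 : HasDerivAt (fun s => exp (-K * s)) (exp (-K * a) * (-K)) a := by
      have := ((hasDerivAt_id a).const_mul (-K)).exp
      simpa using this
    exact h1.mul (hw.dt a ha b)
  have ht0 := deriv_nonneg_of_left_max hdv hεp (fun s h1 h2 => hv1 s b h1 h2 (by simpa using hρ))
  have ht1 : 0 ≤ wt a b - K * w a b := by
    have : 0 ≤ exp (-K * a) * (wt a b - K * w a b) := by linarith
    exact (mul_nonneg_iff_of_pos_left (exp_pos _)).1 this
  have h5 := hbd a ha0 b
  rw [hx0, abs_zero, zero_add, abs_of_pos hwab] at h5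
  have := (abs_le.1 h5).2
  rw [hK] at ht1
  nlinarith

theorem path_neg {w wt wx wxx : ℝ → ℝ → ℝ} (hw : Sol w wt wx wxx) {t0 t1 p : ℝ} (h0 : 0 < t0)
    (h01 : t0 ≤ t1) (hp : w t1 p < 0) :
    ∃ γ : ℝ → ℝ, Continuous γ ∧ γ t1 = p ∧ ∀ s ∈ Icc t0 t1, w s (γ s) < 0 := by
  obtain ⟨γ, h1, h2, h3⟩ := path_pos hw.neg h0 h01 (p := p) (by simpa using hp)
  exact ⟨γ, h1, h2, fun s hs => by simpa using h3 s hs⟩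

theorem strong_pos {w wt wx wxx : ℝ → ℝ → ℝ} (hw : Sol w wt wx wxx) {ts t0 x1 : ℝ} (h0 : 0 < ts)
    (h01 : ts < t0) (hnn : ∀ t ∈ Icc ts t0, ∀ x, 0 ≤ w t x) (hp : 0 < w ts x1) (x0 : ℝ) :
    0 < w t0 x0 := by
  obtain ⟨M, hM, hbd⟩ := hw.bd ts h0
  -- radius
  obtain ⟨r, hr, hr1⟩ : ∃ r > 0, ∀ x, |x - x1| ≤ r → w ts x1 / 2 ≤ w ts x := by
    have := (hw.dx ts h0 x1).continuousAt.eventually (lt_mem_nhds (show w ts x1 / 2 < w ts x1 by linarith))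
    rw [Metric.eventually_nhds_iff] at this
    obtain ⟨ρ, hρ, h⟩ := this
    refine ⟨ρ/2, by positivity, fun x hx => (h (lt_of_le_of_lt hx (by linarith))).le⟩
  obtain ⟨v, hv⟩ : ∃ v, v = (x0 - x1) / (t0 - ts) := ⟨_, rfl⟩
  obtain ⟨A, hA⟩ : ∃ A, A = 12 + 4 * M * r + 4 * r * |v| := ⟨_, rfl⟩
  obtain ⟨K, hK⟩ : ∃ K, K = M + A^2/(32*r^2) := ⟨_, rfl⟩
  obtain ⟨ε, hε⟩ : ∃ ε, ε = w ts x1 / 2 / r^4 := ⟨_, rfl⟩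
  have hεp : 0 < ε := by rw [hε]; positivity
  obtain ⟨ξ, hξ⟩ : ∃ ξ : ℝ → ℝ, ξ = fun t => x1 + (t - ts) * v := ⟨_, rfl⟩
  obtain ⟨S, hS⟩ : ∃ S : ℝ → ℝ → ℝ, S = fun t x => r^2 - (x - ξ t)^2 := ⟨_, rfl⟩
  obtain ⟨E, hE'⟩ : ∃ E : ℝ → ℝ, E = fun t => ε * exp (-K * (t - ts)) := ⟨_, rfl⟩
  have hE : ∀ t, 0 < E t := fun t => by rw [hE']; positivity
  let Q : Set (ℝ × ℝ) := {q | q.1 ∈ Icc ts t0 ∧ 0 ≤ S q.1 q.2}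
  have hξc : Continuous ξ := by rw [hξ]; fun_prop
  have hEc : Continuous E := by rw [hE']; fun_prop
  have hSc : Continuous (fun q : ℝ × ℝ => S q.1 q.2) := by rw [hS]; fun_prop
  have habs : ∀ t x, 0 ≤ S t x → |x - ξ t| ≤ r := fun t x h => abs_le_of_sq_le_sq (by simp only [hS] at h; linarith) hr.le
  have hQ : IsCompact Q := by
    have hcl : IsClosed Q := (isClosed_Icc.preimage continuous_fst).inter (isClosed_Ici.preimage hSc)
    refine ((isCompact_Icc (a := ts) (b := t0)).prod (isCompact_Icc (a := -(|x1| + (t0-ts)*|v| + r)) (b := |x1| + (t0-ts)*|v| + r))).of_isClosed_subset hcl ?_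
    rintro ⟨t, x⟩ ⟨h1, h2⟩
    refine ⟨h1, ?_⟩
    have h3 := habs t x h2
    rw [mem_Icc, ← abs_le]
    have h4 : |(t - ts) * v| ≤ (t0 - ts) * |v| := by
      rw [abs_mul, abs_of_nonneg (by linarith [h1.1])]
      exact mul_le_mul_of_nonneg_right (by linarith [h1.2]) (abs_nonneg _)
    have e : x = (x - ξ t) + (x1 + (t-ts)*v) := by simp [hξ]
    calc |x| = |(x - ξ t) + (x1 + (t-ts)*v)| := by rw [← e]
      _ ≤ |x - ξ t| + (|x1| + |(t-ts)*v|) := (abs_add_le _ _).trans (by gcongr; exact abs_add_le _ _)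
      _ ≤ _ := by linarith
  have hcont : ContinuousOn (fun q : ℝ × ℝ => w q.1 q.2 - E q.1 * S q.1 q.2 ^ 2) Q := by
    rintro ⟨t, x⟩ hq
    refine ContinuousAt.continuousWithinAt ?_
    exact (hw.c0 t (by linarith [hq.1.1]) x).sub (by fun_prop)
  have hend : ξ t0 = x0 := by
    have : t0 - ts ≠ 0 := by linarith
    simp only [hξ, hv]; field_simp; ring
  have hS0 : S t0 x0 = r^2 := by simp [hS, hend]
  have hmem : (t0, x0) ∈ Q := ⟨⟨h01.le, le_rfl⟩, by rw [hS0]; positivity⟩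
  obtain ⟨⟨a, b⟩, hab, hmin⟩ := hQ.exists_isMinOn ⟨_, hmem⟩ hcont
  have hmin' : ∀ t x, t ∈ Icc ts t0 → 0 ≤ S t x → w a b - E a * S a b ^ 2 ≤ w t x - E t * S t x ^ 2 :=
    fun t x h1 h2 => hmin (show (t, x) ∈ Q from ⟨h1, h2⟩)
  have hfin := hmin' t0 x0 ⟨h01.le, le_rfl⟩ hmem.2
  rw [hS0] at hfin
  suffices H : 0 ≤ w a b - E a * S a b ^ 2 by
    have : 0 < E t0 * (r^2)^2 := mul_pos (hE _) (by positivity)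
    linarith
  by_contra hneg
  push Not at hneg
  obtain ⟨ha, hSab⟩ := hab
  simp only at ha hSab
  have hwab := hnn a ha b
  have hSp : 0 < S a b := by
    rcases eq_or_lt_of_le hSab with h | h
    · rw [← h] at hneg; simp at hneg; linarith
    · exact h
  have hat : ts < a := by
    rcases eq_or_lt_of_le ha.1 with h | h
    · exfalso
      subst h
      have h1 := hr1 b (by simpa [hξ] using habs _ _ hSab)
      have h2 : S ts b ≤ r^2 := by simp only [hS]; nlinarith [sq_nonneg (b - ξ ts)]
      have h3 : S ts b ^2 ≤ (r^2)^2 := pow_le_pow_left₀ hSab h2 2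
      have h4 : E ts * S ts b ^ 2 ≤ ε * (r^2)^2 := by
        simp only [hE', sub_self, mul_zero, exp_zero, mul_one]
        exact mul_le_mul_of_nonneg_left h3 hεp.le
      have h5 : ε * (r^2)^2 = w ts x1 / 2 := by rw [hε]; field_simp
      linarith
    · exact h
  have ha0 : 0 < a := by linarith
  obtain ⟨ρ, hρ, hbox⟩ : ∃ ρ > 0, ∀ s x, |s - a| < ρ → |x - b| < ρ → 0 < S s x := by
    have := (hSc.continuousAt (x := (a,b))).eventually (lt_mem_nhds hSp)
    rw [Metric.eventually_nhds_iff] at this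
    obtain ⟨ρ, hρ, h⟩ := this
    refine ⟨ρ, hρ, fun s x h1 h2 => ?_⟩
    exact h (y := (s, x)) (by rw [Prod.dist_eq]; exact max_lt h1 h2)
  -- space derivatives
  have hSx : ∀ x, HasDerivAt (fun y => S a y) (-(2 * (x - ξ a))) x := by
    intro x
    rw [hS]
    exact ((((hasDerivAt_id x).sub_const (ξ a)).pow 2).const_sub (r^2)).congr_deriv (by simp)
  have hd1 : ∀ x, HasDerivAt (fun y => - (w a y - E a * S a y ^ 2))
      (- (wx a x - E a * (2 * S a x * (-(2 * (x - ξ a)))))) x := by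
    intro x
    exact (((hw.dx a ha0 x).sub (((hSx x).pow 2).const_mul (E a))).neg).congr_deriv (by ring)
  have hd2 : HasDerivAt (fun x => - (wx a x - E a * (2 * S a x * (-(2 * (x - ξ a))))))
      (- (wxx a b - E a * (8 * r^2 - 12 * S a b))) b := by
    have h1 : HasDerivAt (fun x => -(2 * (x - ξ a))) (-2) b := by
      exact ((((hasDerivAt_id b).sub_const (ξ a)).const_mul 2).neg).congr_deriv (by ring)
    have h2 := ((hw.dxx a ha0 b).sub ((((hSx b).const_mul 2).mul h1).const_mul (E a))).neg
    refine h2.congr_deriv ?_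
    simp only [hS]; ring
  obtain ⟨k1, k2⟩ := second_deriv_nonpos_of_max hd1 hd2 hρ (fun x hx => by
    have := hmin' a x ha (hbox a x (by rw [sub_self, abs_zero]; exact hρ) hx).le
    linarith)
  have hdt : HasDerivAt (fun s => - (w s b - E s * S s b ^ 2))
      (- (wt a b - (E a * (-K) * S a b ^ 2 + E a * (2 * S a b * (2 * (b - ξ a) * v))))) a := by
    have h1 : HasDerivAt E (E a * (-K)) a := by
      rw [hE']
      refine (((((hasDerivAt_id a).sub_const ts).const_mul (-K)).exp).const_mul ε).congr_deriv ?_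
      simp only [id]; ring
    have h2 : HasDerivAt ξ v a := by
      rw [hξ]
      exact ((((hasDerivAt_id a).sub_const ts).mul_const v).const_add x1).congr_deriv (by ring)
    have h3 : HasDerivAt (fun s => S s b) (2 * (b - ξ a) * v) a := by
      rw [hS]
      exact (((h2.const_sub b).pow 2).const_sub (r^2)).congr_deriv (by ring)
    exact (((hw.dt a ha0 b).sub (h1.mul (h3.fun_pow 2))).neg).congr_deriv (by ring)
  have k3 := deriv_nonneg_of_left_max hdt (lt_min hρ (show 0 < a - ts by linarith)) (fun s g1 g2 => by
    have e1 : min ρ (a - ts) ≤ ρ := min_le_left _ _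
    have e2 : min ρ (a - ts) ≤ a - ts := min_le_right _ _
    have := hmin' s b ⟨by linarith, by linarith [ha.2]⟩ (hbox s b (by rw [abs_lt]; constructor <;> linarith) (by rw [sub_self, abs_zero]; exact hρ)).le
    linarith)
  have k4 := (abs_le.1 (hbd a ha.1 b)).1
  rw [abs_of_nonneg hwab] at k4
  have hb := habs a b hSab
  set s := S a b with hs
  set e := E a with he
  have hep : 0 < e := hE a
  have hwx : |wx a b| ≤ e * (4 * s * r) := by
    have : wx a b = - (e * (4 * s)) * (b - ξ a) := by linarith
    rw [this, abs_mul, abs_neg, abs_of_pos (show 0 < e * (4*s) by positivity)]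
    have := mul_le_mul_of_nonneg_left hb (show 0 ≤ e * (4*s) by positivity)
    linarith
  have hvv : e * (2 * s * (2 * (b - ξ a) * v)) ≤ e * (4 * s * r * |v|) := by
    have h1 : (b - ξ a) * v ≤ r * |v| := by
      calc (b - ξ a) * v ≤ |(b - ξ a) * v| := le_abs_self _
        _ = |b - ξ a| * |v| := abs_mul _ _
        _ ≤ _ := mul_le_mul_of_nonneg_right hb (abs_nonneg _)
    have := mul_le_mul_of_nonneg_left h1 (show 0 ≤ e * (4*s) by positivity)
    linarith
  have hquad : 0 ≤ 8 * r^2 - A * s + (K - M) * s^2 := by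
    have : 8 * r^2 - A * s + (K - M) * s^2 = 8 * (r - A * s / (16 * r))^2 := by
      rw [hK]; field_simp; ring
    rw [this]; positivity
  have hq2 := mul_nonneg hep.le hquad
  have hMw : M * w a b < M * (e * s^2) := mul_lt_mul_of_pos_left (by linarith) hM
  have hMx := mul_le_mul_of_nonneg_left hwx hM.le
  rw [hA] at hq2
  linarith

theorem disc_V (n : ℤ) (pp pm q : ℕ → ℤ → ℝ) (P Q C0 : ℝ) (hC0 : 0 ≤ C0)
    (hpp : ∀ m k, 0 ≤ pp m k) (hpm : ∀ m k, 0 ≤ pm m k) (hP : ∀ m k, pp m k + pm m k ≤ P)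
    (hq : ∀ m k, |q m k| ≤ Q) (hPQ : 2 * P + 2 * Q ≤ 1) (v0 : ℤ → ℝ) (hv0 : ∀ k, 0 ≤ k → k ≤ n → |v0 k| ≤ C0) :
    ∃ V : ℕ → ℤ → ℝ, (∀ k, 0 < k → k < n → V 0 k = |v0 k|) ∧
      (∀ m k, ¬ (0 < k ∧ k < n) → V m k = 0) ∧
      (∀ m k, 0 < k → k < n → V (m+1) k = V m k + pp m k * (V m (k+1) - V m k) +
        pm m k * (V m (k-1) - V m k) + q m k * V m k) ∧
      (∀ m k, 0 ≤ V m k ∧ V m k ≤ C0 * (1 + Q)^m) := by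
  classical
  let V : ℕ → ℤ → ℝ := fun m => Nat.rec (fun k => if 0 < k ∧ k < n then |v0 k| else 0)
    (fun m V k => if 0 < k ∧ k < n then V k + pp m k * (V (k+1) - V k) +
        pm m k * (V (k-1) - V k) + q m k * V k else 0) m
  have hz : ∀ k, V 0 k = if 0 < k ∧ k < n then |v0 k| else 0 := fun k => rfl
  have hs : ∀ m k, V (m+1) k = if 0 < k ∧ k < n then V m k + pp m k * (V m (k+1) - V m k) +
        pm m k * (V m (k-1) - V m k) + q m k * V m k else 0 := fun m k => rfl
  have hQ : 0 ≤ Q := (abs_nonneg _).trans (hq 0 0)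
  have hP0 : 0 ≤ P := by linarith [hP 0 0, hpp 0 0, hpm 0 0]
  clear_value V
  refine ⟨V, fun k h1 h2 => by rw [hz, if_pos ⟨h1, h2⟩], fun m k h => ?_, fun m k h1 h2 => by rw [hs, if_pos ⟨h1, h2⟩], ?_⟩
  · cases m with
    | zero => rw [hz, if_neg h]
    | succ m => rw [hs, if_neg h]
  · intro m
    induction m with
    | zero =>
      intro k
      rw [hz]
      split_ifs with h
      · exact ⟨abs_nonneg _, by simpa using hv0 k h.1.le h.2.le⟩
      · simpa using hC0
    | succ m ih =>
      intro k
      rw [hs]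
      have hpos : 0 ≤ C0 * (1 + Q)^m := (ih k).1.trans (ih k).2
      rw [pow_succ, ← mul_assoc]
      generalize C0 * (1 + Q)^m = B at *
      split_ifs with h
      · have a0 := ih k
        have a1 := ih (k+1)
        have a2 := ih (k-1)
        have b := abs_le.1 (hq m k)
        have e : V m k + pp m k * (V m (k+1) - V m k) + pm m k * (V m (k-1) - V m k) + q m k * V m k
          = (1 - (pp m k + pm m k) + q m k) * V m k + pp m k * V m (k+1) + pm m k * V m (k-1) := by ring
        rw [e]
        have hc : 0 ≤ 1 - (pp m k + pm m k) + q m k := by linarith [hP m k]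
        have h1 := mul_nonneg hc a0.1
        have h2 := mul_nonneg (hpp m k) a1.1
        have h3 := mul_nonneg (hpm m k) a2.1
        have g1 := mul_le_mul_of_nonneg_left a0.2 hc
        have g2 := mul_le_mul_of_nonneg_left a1.2 (hpp m k)
        have g3 := mul_le_mul_of_nonneg_left a2.2 (hpm m k)
        have g4 := mul_le_mul_of_nonneg_right b.2 hpos
        constructor
        · linarith
        · linarith
      · exact ⟨le_rfl, by positivity⟩

theorem disc_compare (n : ℤ) (N : ℕ) (pp pm q w : ℕ → ℤ → ℝ) (ψ : ℕ → ℤ → ℤ → ℝ) (P Q C0 a e1 e2 : ℝ)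
    (hC0 : 0 ≤ C0) (ha : 0 ≤ a) (he1 : 0 ≤ e1) (he2 : 0 ≤ e2)
    (hpp : ∀ m k, 0 ≤ pp m k) (hpm : ∀ m k, 0 ≤ pm m k) (hP : ∀ m k, pp m k + pm m k ≤ P)
    (hq : ∀ m k, |q m k| ≤ Q) (hPQ : 2 * P + 2 * Q ≤ 1)
    (hw0 : ∀ k, 0 ≤ k → k ≤ n → |w 0 k| ≤ C0)
    (hwa : ∀ m < N, ∀ k, 0 < k → k < n → |w (m+1) k - w m k| ≤ a)
    (hweq : ∀ m < N, ∀ k, 0 < k → k < n → |w (m+1) k - (w m k + pp m k * (w m (k+1) - w m k) +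
        pm m k * (w m (k-1) - w m k) + q m k * w m k)| ≤ e1)
    (hψ : ∀ m < N, ∀ k l, 0 < k → k < l → l < n → ψ (m+1) k l ≤ ψ m k l +
        (pp m k * (ψ m (k+1) l - ψ m k l) + pm m k * (ψ m (k-1) l - ψ m k l) + q m k * ψ m k l) +
        (pp m l * (ψ m k (l+1) - ψ m k l) + pm m l * (ψ m k (l-1) - ψ m k l) + q m l * ψ m k l) + e2)
    (hψd : ∀ m ≤ N, ∀ k, ψ m k k ≤ 0) (hψ0 : ∀ m ≤ N, ∀ l, ψ m 0 l ≤ 0) (hψn : ∀ m ≤ N, ∀ k, ψ m k n ≤ 0)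
    (hwl : ∀ m ≤ N, 0 ≤ w m 0) (hwr : ∀ m ≤ N, w m n ≤ 0)
    (hinit : ∀ k l, 0 < k → k < l → l < n → ψ 0 k l ≤ w 0 k * |w 0 l| - w 0 l * |w 0 k|)
    (k l : ℤ) (hk : 0 ≤ k) (hkl : k ≤ l) (hl : l ≤ n) :
    ψ N k l ≤ C0 * (1 + Q)^N * (max (w N k) 0 + max (- w N l) 0) +
      N * (1 + 2 * Q)^N * (2 * a * (2 * P + Q) * (C0 * (1 + Q)^N) + 2 * e1 * (C0 * (1 + Q)^N) + e2) := by
  obtain ⟨V, hV0, hVb, hVs, hV⟩ := disc_V n pp pm q P Q C0 hC0 hpp hpm hP hq hPQ (w 0) hw0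
  have hQ : 0 ≤ Q := (abs_nonneg _).trans (hq 0 0)
  have hP0 : 0 ≤ P := by linarith [hP 0 0, hpp 0 0, hpm 0 0]
  obtain ⟨B, hB⟩ : ∃ B, B = C0 * (1 + Q)^N := ⟨_, rfl⟩
  rw [← hB]
  have hVB : ∀ m ≤ N, ∀ k, V m k ≤ B := by
    intro m hm k
    rw [hB]
    exact (hV m k).2.trans (mul_le_mul_of_nonneg_left (pow_le_pow_right₀ (by linarith) hm) hC0)
  have hB0 : 0 ≤ B := (hV N 0).1.trans (hVB N le_rfl 0)
  obtain ⟨err, herr⟩ : ∃ err, err = 2 * a * (2 * P + Q) * B + 2 * e1 * B + e2 := ⟨_, rfl⟩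
  rw [← herr]
  have herr0 : 0 ≤ err := by rw [herr]; positivity
  have main : ∀ m ≤ N, ∀ k l, 0 ≤ k → k ≤ l → l ≤ n →
      - (m * (1 + 2 * Q)^m * err) ≤ w m k * V m l - w m l * V m k - ψ m k l := by
    have hbdry : ∀ m ≤ N, ∀ k l, 0 ≤ k → k ≤ l → l ≤ n → ¬ (0 < k ∧ k < l ∧ l < n) →
        - (m * (1 + 2 * Q)^m * err) ≤ w m k * V m l - w m l * V m k - ψ m k l := by
      intro m hm k l h1 h2 h3 h4
      have hE : 0 ≤ m * (1 + 2 * Q)^m * err := by positivity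
      suffices 0 ≤ w m k * V m l - w m l * V m k - ψ m k l by linarith
      rcases eq_or_lt_of_le h2 with h | h
      · subst h; linarith [hψd m hm k]
      · rcases eq_or_lt_of_le h1 with h' | h'
        · subst h'
          rw [hVb m 0 (by omega)]
          have := mul_nonneg (hwl m hm) (hV m l).1
          linarith [hψ0 m hm l]
        · have : l = n := by
            by_contra hne
            exact h4 ⟨h', h, lt_of_le_of_ne h3 hne⟩
          subst this
          rw [hVb m l (by omega)]
          have := mul_nonneg (neg_nonneg.2 (hwr m hm)) (hV m k).1
          linarith [hψn m hm k]
    intro m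
    induction m with
    | zero =>
      intro hm k l h1 h2 h3
      by_cases hin : 0 < k ∧ k < l ∧ l < n
      · obtain ⟨i1, i2, i3⟩ := hin
        rw [hV0 k i1 (by omega), hV0 l (by omega) i3]
        have := hinit k l i1 i2 i3
        simp only [Nat.cast_zero, zero_mul, neg_zero]
        linarith
      · exact hbdry 0 hm k l h1 h2 h3 hin
    | succ m ih =>
      intro hm k l h1 h2 h3
      by_cases hin : 0 < k ∧ k < l ∧ l < n
      swap
      · exact hbdry (m+1) hm k l h1 h2 h3 hin
      obtain ⟨i1, i2, i3⟩ := hin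
      have hmN : m < N := by omega
      have ih' := ih hmN.le
      obtain ⟨E, hE⟩ : ∃ E, E = m * (1 + 2 * Q)^m * err := ⟨_, rfl⟩
      rw [← hE] at ih'
      have hE0 : 0 ≤ E := by rw [hE]; positivity
      have hEs : (1 + 2 * Q) * E + err ≤ ((m + 1 : ℕ) : ℝ) * (1 + 2 * Q)^(m+1) * err := by
        have : 1 ≤ (1 + 2 * Q)^(m+1) := one_le_pow₀ (by linarith)
        have := mul_le_mul_of_nonneg_right this herr0
        rw [hE]; push_cast
        rw [pow_succ] at *
        linarith
      refine le_trans (neg_le_neg hEs) ?_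
      -- neighbours
      have z0 := ih' k l h1 h2 h3
      have z1 := ih' (k+1) l (by omega) (by omega) h3
      have z2 := ih' (k-1) l (by omega) (by omega) h3
      have z3 := ih' k (l+1) (by omega) (by omega) (by omega)
      have z4 := ih' k (l-1) (by omega) (by omega) (by omega)
      have hps := hψ m hmN k l i1 i2 i3
      -- step data
      obtain ⟨AVk, hAVk⟩ : ∃ A, A = pp m k * (V m (k+1) - V m k) + pm m k * (V m (k-1) - V m k) + q m k * V m k := ⟨_, rfl⟩
      obtain ⟨AVl, hAVl⟩ : ∃ A, A = pp m l * (V m (l+1) - V m l) + pm m l * (V m (l-1) - V m l) + q m l * V m l := ⟨_, rfl⟩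
      have hAV : ∀ j, |pp m j * (V m (j+1) - V m j) + pm m j * (V m (j-1) - V m j) + q m j * V m j| ≤ (2 * P + Q) * B := by
        intro j
        have b0 := hV m j
        have b1 := hV m (j+1)
        have b2 := hV m (j-1)
        have c0 := hVB m hmN.le j
        have c1 := hVB m hmN.le (j+1)
        have c2 := hVB m hmN.le (j-1)
        have t1 : |pp m j * (V m (j+1) - V m j)| ≤ pp m j * B := by
          rw [abs_mul, abs_of_nonneg (hpp m j)]
          exact mul_le_mul_of_nonneg_left (abs_le.2 ⟨by linarith, by linarith⟩) (hpp m j)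
        have t2 : |pm m j * (V m (j-1) - V m j)| ≤ pm m j * B := by
          rw [abs_mul, abs_of_nonneg (hpm m j)]
          exact mul_le_mul_of_nonneg_left (abs_le.2 ⟨by linarith, by linarith⟩) (hpm m j)
        have t3 : |q m j * V m j| ≤ Q * B := by
          rw [abs_mul, abs_of_nonneg b0.1]
          exact mul_le_mul (hq m j) c0 b0.1 hQ
        have := abs_add_three (pp m j * (V m (j+1) - V m j)) (pm m j * (V m (j-1) - V m j)) (q m j * V m j)
        have t4 := mul_le_mul_of_nonneg_right (hP m j) hB0
        have t5 : 0 ≤ P * B := by positivity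
        linarith
      have hk' := hAV k
      have hl' := hAV l
      rw [← hAVk] at hk'
      rw [← hAVl] at hl'
      have hVk : V (m+1) k = V m k + AVk := by rw [hVs m k i1 (by omega), hAVk]; ring
      have hVl : V (m+1) l = V m l + AVl := by rw [hVs m l (by omega) i3, hAVl]; ring
      obtain ⟨dk, hdk⟩ : ∃ A, A = w (m+1) k - w m k := ⟨_, rfl⟩
      obtain ⟨dl, hdl⟩ : ∃ A, A = w (m+1) l - w m l := ⟨_, rfl⟩
      have hdka := hwa m hmN k i1 (by omega)
      have hdla := hwa m hmN l (by omega) i3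
      rw [← hdk] at hdka
      rw [← hdl] at hdla
      obtain ⟨rk, hrk⟩ : ∃ A, A = w (m+1) k - (w m k + pp m k * (w m (k+1) - w m k) +
        pm m k * (w m (k-1) - w m k) + q m k * w m k) := ⟨_, rfl⟩
      obtain ⟨rl, hrl⟩ : ∃ A, A = w (m+1) l - (w m l + pp m l * (w m (l+1) - w m l) +
        pm m l * (w m (l-1) - w m l) + q m l * w m l) := ⟨_, rfl⟩
      have hrk' := hweq m hmN k i1 (by omega)
      have hrl' := hweq m hmN l (by omega) i3
      rw [← hrk] at hrk'
      rw [← hrl] at hrl'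
      -- products
      have m1 : |dk * AVl| ≤ a * ((2 * P + Q) * B) := by
        rw [abs_mul]; exact mul_le_mul hdka hl' (abs_nonneg _) ha
      have m2 : |dl * AVk| ≤ a * ((2 * P + Q) * B) := by
        rw [abs_mul]; exact mul_le_mul hdla hk' (abs_nonneg _) ha
      have m3 : |rk * V m l| ≤ e1 * B := by
        rw [abs_mul, abs_of_nonneg (hV m l).1]; exact mul_le_mul hrk' (hVB m hmN.le l) (hV m l).1 he1
      have m4 : |rl * V m k| ≤ e1 * B := by
        rw [abs_mul, abs_of_nonneg (hV m k).1]; exact mul_le_mul hrl' (hVB m hmN.le k) (hV m k).1 he1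
      have m1' := (abs_le.1 m1).1
      have m2' := (abs_le.1 m2).2
      have m3' := (abs_le.1 m3).1
      have m4' := (abs_le.1 m4).2
      have hc : 0 ≤ 1 - (pp m k + pm m k) - (pp m l + pm m l) + q m k + q m l := by
        linarith [hP m k, hP m l, (abs_le.1 (hq m k)).1, (abs_le.1 (hq m l)).1]
      have y0 := mul_le_mul_of_nonneg_left z0 hc
      have y1 := mul_le_mul_of_nonneg_left z1 (hpp m k)
      have y2 := mul_le_mul_of_nonneg_left z2 (hpm m k)
      have y3 := mul_le_mul_of_nonneg_left z3 (hpp m l)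
      have y4 := mul_le_mul_of_nonneg_left z4 (hpm m l)
      have y5 := mul_le_mul_of_nonneg_right (abs_le.1 (hq m k)).2 hE0
      have y6 := mul_le_mul_of_nonneg_right (abs_le.1 (hq m l)).2 hE0
      have key : w (m+1) k * V (m+1) l - w (m+1) l * V (m+1) k =
          (w m k * V m l - w m l * V m k) +
          (pp m k * ((w m (k+1) * V m l - w m l * V m (k+1)) - (w m k * V m l - w m l * V m k)) +
           pm m k * ((w m (k-1) * V m l - w m l * V m (k-1)) - (w m k * V m l - w m l * V m k)) +
           q m k * (w m k * V m l - w m l * V m k)) +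
          (pp m l * ((w m k * V m (l+1) - w m (l+1) * V m k) - (w m k * V m l - w m l * V m k)) +
           pm m l * ((w m k * V m (l-1) - w m (l-1) * V m k) - (w m k * V m l - w m l * V m k)) +
           q m l * (w m k * V m l - w m l * V m k)) +
          (dk * AVl - dl * AVk + rk * V m l - rl * V m k) := by
        rw [hVk, hVl, hdk, hdl, hAVk, hAVl, hrk, hrl]; ring
      rw [key]
      rw [herr]
      linarith
  have hfin := main N le_rfl k l hk hkl hl
  have u1 : w N k * V N l ≤ B * max (w N k) 0 := by
    calc w N k * V N l ≤ max (w N k) 0 * V N l := mul_le_mul_of_nonneg_right (le_max_left _ _) (hV N l).1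
      _ ≤ max (w N k) 0 * B := mul_le_mul_of_nonneg_left (hVB N le_rfl l) (le_max_right _ _)
      _ = _ := mul_comm _ _
  have u2 : - w N l * V N k ≤ B * max (- w N l) 0 := by
    calc - w N l * V N k ≤ max (- w N l) 0 * V N k := mul_le_mul_of_nonneg_right (le_max_left _ _) (hV N k).1
      _ ≤ max (- w N l) 0 * B := mul_le_mul_of_nonneg_left (hVB N le_rfl k) (le_max_right _ _)
      _ = _ := mul_comm _ _
  linarith

theorem taylor1 {F F1 : ℝ → ℝ} (a h η : ℝ) (hF : ∀ y, |y - a| ≤ h → HasDerivAt F (F1 y) y)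
    (hη : ∀ y, |y - a| ≤ h → |F1 y - F1 a| ≤ η) (y : ℝ) (hy : |y - a| ≤ h) :
    |F y - F a - F1 a * (y - a)| ≤ η * |y - a| := by
  have hset : ∀ z ∈ Icc (a - h) (a + h), |z - a| ≤ h := fun z hz => abs_le.2 ⟨by linarith [hz.1], by linarith [hz.2]⟩
  have h0 : 0 ≤ h := (abs_nonneg _).trans hy
  have := Convex.norm_image_sub_le_of_norm_hasDerivWithin_le (f := fun z => F z - F1 a * (z - a))
      (f' := fun z => F1 z - F1 a) (s := Icc (a-h) (a+h)) (C := η)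
      (x := a) (y := y) (fun z hz => (((hF z (hset z hz)).sub (((hasDerivAt_id z).sub_const a).const_mul (F1 a))).congr_deriv (by ring)).hasDerivWithinAt)
      (fun z hz => hη z (hset z hz)) (convex_Icc _ _) ⟨by linarith, by linarith⟩
      (by rw [abs_le] at hy; constructor <;> linarith)
  simp only [Real.norm_eq_abs] at this
  convert this using 2
  ring

theorem taylor2 {F F1 F2 : ℝ → ℝ} (a h η : ℝ) (hF : ∀ y, |y - a| ≤ h → HasDerivAt F (F1 y) y)
    (hF1 : ∀ y, |y - a| ≤ h → HasDerivAt F1 (F2 y) y)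
    (hη : ∀ y, |y - a| ≤ h → |F2 y - F2 a| ≤ η) (y : ℝ) (hy : |y - a| ≤ h) :
    |F y - F a - F1 a * (y - a) - F2 a * (y - a)^2/2| ≤ η * h^2 := by
  have h0 : 0 ≤ h := (abs_nonneg _).trans hy
  have hη0 : 0 ≤ η := (abs_nonneg _).trans (hη y hy)
  have h1 := taylor1 (F := fun z => F z - F2 a * (z - a)^2/2) (F1 := fun z => F1 z - F2 a * (z - a)) a h (η * h)
    (fun z hz => ((hF z hz).sub (((((hasDerivAt_id z).sub_const a).fun_pow 2).const_mul (F2 a)).div_const 2)).congr_deriv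
      (by simp; ring))
    (fun z hz => by
      have := taylor1 a h η hF1 hη z hz
      have h2 := mul_le_mul_of_nonneg_left hz hη0
      refine le_trans (le_of_eq ?_) (this.trans h2)
      congr 1; ring) y hy
  have h2 := mul_le_mul_of_nonneg_left hy (show 0 ≤ η * h by positivity)
  refine le_trans (le_of_eq ?_) (h1.trans (h2.trans (le_of_eq (by ring))))
  congr 1; ring

theorem step_cons {F F1 F2 : ℝ → ℝ} (a h η τ b : ℝ) (hh : 0 < h) (hτ : 0 < τ) (hb : |b| * h ≤ 2)
    (hF : ∀ y, |y - a| ≤ h → HasDerivAt F (F1 y) y)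
    (hF1 : ∀ y, |y - a| ≤ h → HasDerivAt F1 (F2 y) y)
    (hη : ∀ y, |y - a| ≤ h → |F2 y - F2 a| ≤ η) :
    |τ * (1/h^2 + b/(2*h)) * (F (a+h) - F a) + τ * (1/h^2 - b/(2*h)) * (F (a-h) - F a)
      - τ * (F2 a + b * F1 a)| ≤ 2 * η * τ := by
  have h1 := taylor2 a h η hF hF1 hη (a+h) (by simp [abs_of_pos hh])
  have h2 := taylor2 a h η hF hF1 hη (a-h) (by simp [abs_of_pos hh])
  have hb' := abs_le.1 (show |b * h| ≤ 2 by rwa [abs_mul, abs_of_pos hh])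
  have p1 : 0 ≤ τ * (1/h^2 + b/(2*h)) := by
    have : τ * (1/h^2 + b/(2*h)) = τ * (2 + b*h)/(2 * h^2) := by field_simp
    rw [this]; have : 0 ≤ 2 + b * h := by linarith
    positivity
  have p2 : 0 ≤ τ * (1/h^2 - b/(2*h)) := by
    have : τ * (1/h^2 - b/(2*h)) = τ * (2 - b*h)/(2 * h^2) := by field_simp
    rw [this]; have : 0 ≤ 2 - b * h := by linarith
    positivity
  obtain ⟨r1, hr1⟩ : ∃ r, r = F (a+h) - F a - F1 a * (a + h - a) - F2 a * (a + h - a)^2/2 := ⟨_, rfl⟩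
  obtain ⟨r2, hr2⟩ : ∃ r, r = F (a-h) - F a - F1 a * (a - h - a) - F2 a * (a - h - a)^2/2 := ⟨_, rfl⟩
  rw [← hr1] at h1
  rw [← hr2] at h2
  have e : τ * (1/h^2 + b/(2*h)) * (F (a+h) - F a) + τ * (1/h^2 - b/(2*h)) * (F (a-h) - F a)
      - τ * (F2 a + b * F1 a) = τ * (1/h^2 + b/(2*h)) * r1 + τ * (1/h^2 - b/(2*h)) * r2 := by
    rw [hr1, hr2]; field_simp; ring
  rw [e]
  refine (abs_add_le _ _).trans ?_
  rw [abs_mul _ r1, abs_mul _ r2, abs_of_nonneg p1, abs_of_nonneg p2]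
  have q1 := mul_le_mul_of_nonneg_left h1 p1
  have q2 := mul_le_mul_of_nonneg_left h2 p2
  have : τ * (1/h^2 + b/(2*h)) * (η * h^2) + τ * (1/h^2 - b/(2*h)) * (η * h^2) = 2 * η * τ := by
    field_simp; ring
  linarith

theorem pow_le_exp_aux (a : ℝ) (ha : 0 ≤ a) (N : ℕ) (c : ℝ) (h : N * a ≤ c) : (1 + a)^N ≤ exp c := by
  calc (1 + a)^N ≤ (exp a)^N := pow_le_pow_left₀ (by linarith) (by linarith [add_one_le_exp a]) N
    _ = exp (N * a) := by rw [← exp_nat_mul]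
    _ ≤ _ := exp_le_exp.2 h

theorem unif2 {f : ℝ → ℝ → ℝ} (hc : ∀ t > 0, ∀ x, ContinuousAt (fun p : ℝ × ℝ => f p.1 p.2) (t, x))
    (a b α β : ℝ) (ha : 0 < a) (η : ℝ) (hη : 0 < η) :
    ∃ δ > 0, ∀ t ∈ Icc a b, ∀ t' ∈ Icc a b, ∀ x ∈ Icc α β, ∀ x' ∈ Icc α β, |t' - t| ≤ δ → |x' - x| ≤ δ →
      |f t' x' - f t x| ≤ η := by
  have hK : IsCompact (Icc a b ×ˢ Icc α β) := isCompact_Icc.prod isCompact_Icc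
  have hco : ContinuousOn (fun p : ℝ × ℝ => f p.1 p.2) (Icc a b ×ˢ Icc α β) := by
    rintro ⟨t, x⟩ ⟨h1, -⟩
    exact (hc t (lt_of_lt_of_le ha h1.1) x).continuousWithinAt
  obtain ⟨δ, hδ, h⟩ := Metric.uniformContinuousOn_iff.1 (hK.uniformContinuousOn_of_continuous hco) η hη
  refine ⟨δ/2, by positivity, fun t ht t' ht' x hx x' hx' h1 h2 => ?_⟩
  exact (h (t', x') ⟨ht', hx'⟩ (t, x) ⟨ht, hx⟩ (by
    rw [Prod.dist_eq]; exact max_lt (lt_of_le_of_lt h1 (by linarith)) (lt_of_le_of_lt h2 (by linarith)))).le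

theorem unif3 {f : ℝ → ℝ → ℝ → ℝ} (hc : Continuous (fun p : ℝ × ℝ × ℝ => f p.1 p.2.1 p.2.2))
    (a b α β : ℝ) (η : ℝ) (hη : 0 < η) :
    ∃ δ > 0, ∀ t ∈ Icc a b, ∀ t' ∈ Icc a b, ∀ x ∈ Icc α β, ∀ x' ∈ Icc α β, ∀ y ∈ Icc α β, ∀ y' ∈ Icc α β,
      |t' - t| ≤ δ → |x' - x| ≤ δ → |y' - y| ≤ δ → |f t' x' y' - f t x y| ≤ η := by
  have hK : IsCompact (Icc a b ×ˢ (Icc α β ×ˢ Icc α β)) := isCompact_Icc.prod (isCompact_Icc.prod isCompact_Icc)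
  obtain ⟨δ, hδ, h⟩ := Metric.uniformContinuousOn_iff.1 (hK.uniformContinuousOn_of_continuous hc.continuousOn) η hη
  refine ⟨δ/2, by positivity, fun t ht t' ht' x hx x' hx' y hy y' hy' h1 h2 h3 => ?_⟩
  exact (h (t', x', y') ⟨ht', hx', hy'⟩ (t, x, y) ⟨ht, hx, hy⟩ (by
    rw [Prod.dist_eq, Prod.dist_eq]
    exact max_lt (lt_of_le_of_lt h1 (by linarith)) (max_lt (lt_of_le_of_lt h2 (by linarith)) (lt_of_le_of_lt h3 (by linarith))))).le

theorem coef_exists (M r p z : ℝ) (hM : 0 < M) (h : |r| ≤ M * (|p| + |z|)) :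
    ∃ b c : ℝ, |b| ≤ M ∧ |c| ≤ M ∧ r = b * p + c * z := by
  by_cases h0 : |p| + |z| = 0
  · refine ⟨0, 0, by simpa using hM.le, by simpa using hM.le, ?_⟩
    rw [h0, mul_zero] at h
    have := abs_nonpos_iff.1 h
    simp [this]
  · have hpos : 0 < |p| + |z| := lt_of_le_of_ne (by positivity) (Ne.symm h0)
    have hr : |r / (|p| + |z|)| ≤ M := by
      rw [abs_div, abs_of_pos hpos, div_le_iff₀ hpos]; exact h
    have hs : ∀ u : ℝ, |(SignType.sign u : ℝ)| ≤ 1 := by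
      intro u
      rcases lt_trichotomy u 0 with h | h | h <;> simp [h]
    have hbd : ∀ u : ℝ, |r / (|p| + |z|) * (SignType.sign u : ℝ)| ≤ M := by
      intro u
      rw [abs_mul]
      calc _ ≤ M * 1 := mul_le_mul hr (hs u) (abs_nonneg _) hM.le
        _ = M := mul_one M
    refine ⟨_, _, hbd p, hbd z, ?_⟩
    have e1 : (SignType.sign p : ℝ) * p = |p| := sign_mul_self p
    have e2 : (SignType.sign z : ℝ) * z = |z| := sign_mul_self z
    rw [mul_assoc, mul_assoc, e1, e2]
    field_simp

set_option maxHeartbeats 4000000 in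
theorem cont_compare_grid {w wt wx wxx : ℝ → ℝ → ℝ} (hw : Sol w wt wx wxx) {ts t0 α β M C0 : ℝ} (h0 : 0 < ts)
    (h01 : ts < t0) (hαβ : α < β) (hM : 0 < M)
    (hbd : ∀ t ≥ ts, ∀ x, |wt t x - wxx t x| ≤ M * (|wx t x| + |w t x|))
    (hC0 : ∀ x, |w ts x| ≤ C0)
    (hwl : ∀ t ∈ Icc ts t0, 0 ≤ w t α) (hwr : ∀ t ∈ Icc ts t0, w t β ≤ 0)
    (ψ ψt ψx ψxx ψy ψyy : ℝ → ℝ → ℝ → ℝ)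
    (hψt : ∀ t x y, HasDerivAt (fun s => ψ s x y) (ψt t x y) t)
    (hψx : ∀ t x y, HasDerivAt (fun s => ψ t s y) (ψx t x y) x)
    (hψxx : ∀ t x y, HasDerivAt (fun s => ψx t s y) (ψxx t x y) x)
    (hψy : ∀ t x y, HasDerivAt (fun s => ψ t x s) (ψy t x y) y)
    (hψyy : ∀ t x y, HasDerivAt (fun s => ψy t x s) (ψyy t x y) y)
    (hct : Continuous (fun p : ℝ × ℝ × ℝ => ψt p.1 p.2.1 p.2.2))
    (hcxx : Continuous (fun p : ℝ × ℝ × ℝ => ψxx p.1 p.2.1 p.2.2))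
    (hcyy : Continuous (fun p : ℝ × ℝ × ℝ => ψyy p.1 p.2.1 p.2.2))
    (hineq : ∀ t ∈ Icc ts t0, ∀ x y, α ≤ x → x ≤ y → y ≤ β →
      ψt t x y ≤ ψxx t x y + ψyy t x y - M * (|ψx t x y| + |ψy t x y|) - 2 * M * |ψ t x y|)
    (hd : ∀ t ∈ Icc ts t0, ∀ x, ψ t x x ≤ 0) (hl : ∀ t ∈ Icc ts t0, ∀ y, ψ t α y ≤ 0)
    (hr : ∀ t ∈ Icc ts t0, ∀ x, ψ t x β ≤ 0)
    (hinit : ∀ x y, α ≤ x → x ≤ y → y ≤ β → ψ ts x y ≤ w ts x * |w ts y| - w ts y * |w ts x|)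
    (ε : ℝ) (hε : 0 < ε) :
    ∃ h0 > 0, ∀ n : ℕ, 0 < n → (β - α) / n < h0 → ∀ k l : ℤ, 0 ≤ k → k ≤ l → l ≤ n →
      ψ t0 (α + k * ((β - α) / n)) (α + l * ((β - α) / n)) ≤
      C0 * exp (M * (t0 - ts)) * (max (w t0 (α + k * ((β - α) / n))) 0 +
        max (- w t0 (α + l * ((β - α) / n))) 0) + ε := by
  obtain ⟨T, hT⟩ : ∃ T, T = t0 - ts := ⟨_, rfl⟩
  have hTp : 0 < T := by linarith
  rw [← hT]
  obtain ⟨B, hB⟩ : ∃ B, B = C0 * exp (M * T) := ⟨_, rfl⟩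
  have hC00 : 0 ≤ C0 := (abs_nonneg _).trans (hC0 0)
  have hB0 : 0 ≤ B := by rw [hB]; positivity
  -- wt bound
  obtain ⟨Cw, hCw, hCwt⟩ := Sol.bound_aux hw.ct hw.pert ts t0 h0
  -- constant in the total error: T * exp(2MT) * (2 Cw (4h + Mτ) B + 6 η B + 5 η)
  obtain ⟨G, hG⟩ : ∃ G, G = T * exp (2 * M * T) * (2 * Cw * (4 + M) * B + 6 * B + 5) := ⟨_, rfl⟩
  have hGp : 0 < G := by rw [hG]; positivity
  obtain ⟨η, hη⟩ : ∃ η, η = ε / G := ⟨_, rfl⟩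
  have hηp : 0 < η := by rw [hη]; positivity
  obtain ⟨δ1, hδ1, u1⟩ := unif2 hw.ct ts t0 α β h0 η hηp
  obtain ⟨δ2, hδ2, u2⟩ := unif2 hw.cxx ts t0 α β h0 η hηp
  obtain ⟨δ3, hδ3, u3⟩ := unif3 hct ts t0 α β η hηp
  obtain ⟨δ4, hδ4, u4⟩ := unif3 hcxx ts t0 α β η hηp
  obtain ⟨δ5, hδ5, u5⟩ := unif3 hcyy ts t0 α β η hηp
  obtain ⟨H, hHp, hH1, hH2, hH3, hH4, hH5, hH6, hH7⟩ : ∃ H > 0, H ≤ δ1 ∧ H ≤ δ2 ∧ H ≤ δ3 ∧ H ≤ δ4 ∧ H ≤ δ5 ∧ H ≤ η ∧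
      H ≤ min 1 (1 / (8 + 2 * M)) := by
    refine ⟨min δ1 (min δ2 (min δ3 (min δ4 (min δ5 (min η (min 1 (1/(8+2*M)))))))), by positivity, ?_, ?_, ?_, ?_, ?_, ?_, ?_⟩
    · simp
    · simp
    · simp
    · simp
    · simp
    · simp
    · exact (min_le_right _ _).trans ((min_le_right _ _).trans ((min_le_right _ _).trans ((min_le_right _ _).trans
        ((min_le_right _ _).trans (min_le_right _ _)))))
  have hH8 : H ≤ 1 := hH7.trans (min_le_left _ _)
  have hH9 : H * (8 + 2 * M) ≤ 1 := by
    have := hH7.trans (min_le_right _ _)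
    rwa [le_div_iff₀ (by positivity)] at this
  refine ⟨H, hHp, fun n hn hhH k l hk hkl hln => ?_⟩
  obtain ⟨h, hh⟩ : ∃ h, h = (β - α) / n := ⟨_, rfl⟩
  rw [← hh] at hhH ⊢
  have hn' : (0:ℝ) < n := by exact_mod_cast hn
  have hhp : 0 < h := by rw [hh]; exact div_pos (by linarith) hn'
  have hnh : n * h = β - α := by rw [hh]; field_simp
  obtain ⟨N, hN⟩ := exists_nat_ge (T / h^3)
  have hNp : (0:ℝ) < N := lt_of_lt_of_le (by positivity) hN
  obtain ⟨τ, hτ⟩ : ∃ τ, τ = T / N := ⟨_, rfl⟩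
  have hτp : 0 < τ := by rw [hτ]; positivity
  have hNτ : N * τ = T := by rw [hτ]; field_simp
  have hτh : τ ≤ h^3 := by
    rw [hτ, div_le_iff₀ hNp]
    rwa [div_le_iff₀ (by positivity), mul_comm] at hN
  have hh1 : h ≤ 1 := by linarith
  have hτh2 : τ ≤ h * h^2 := by linarith [hτh, show h^3 = h * h^2 by ring]
  have hτh1 : τ ≤ h := by
    have : h * h^2 ≤ h * 1 := mul_le_mul_of_nonneg_left (pow_le_one₀ hhp.le hh1) hhp.le
    linarith
  have hMH : M * h ≤ M * H := mul_le_mul_of_nonneg_left hhH.le hM.le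
  have hMH0 : 0 ≤ M * H := by positivity
  have hH10 : 8 * H + 2 * (M * H) ≤ 1 := by linarith
  have hMh : M * h ≤ 1 := by linarith
  -- coefficients
  have hco : ∀ t x, ∃ b c : ℝ, |b| ≤ M ∧ |c| ≤ M ∧ (ts ≤ t → wt t x - wxx t x = b * wx t x + c * w t x) := by
    intro t x
    by_cases ht : ts ≤ t
    · obtain ⟨b, c, h1, h2, h3⟩ := coef_exists M _ _ _ hM (hbd t ht x)
      exact ⟨b, c, h1, h2, fun _ => h3⟩
    · exact ⟨0, 0, by simpa using hM.le, by simpa using hM.le, fun h => absurd h ht⟩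
  choose b c hb hc hbc using hco
  -- grid
  obtain ⟨X, hX⟩ : ∃ X : ℤ → ℝ, ∀ k, X k = α + k * h := ⟨_, fun _ => rfl⟩
  obtain ⟨S, hS⟩ : ∃ S : ℕ → ℝ, ∀ m, S m = ts + m * τ := ⟨_, fun _ => rfl⟩
  have hXs : ∀ k, X (k+1) = X k + h := by intro k; rw [hX, hX]; push_cast; ring
  have hXp : ∀ k, X (k-1) = X k - h := by intro k; rw [hX, hX]; push_cast; ring
  have hSs : ∀ m, S (m+1) = S m + τ := by intro k; rw [hS, hS]; push_cast; ring
  have hX0 : X 0 = α := by rw [hX]; simp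
  have hXn : X n = β := by rw [hX]; push_cast; linarith
  have hXm : ∀ i j : ℤ, i ≤ j → X i ≤ X j := by
    intro i j hij
    rw [hX, hX]
    have : (i:ℝ) ≤ j := by exact_mod_cast hij
    have := mul_le_mul_of_nonneg_right this hhp.le
    linarith
  have hXI : ∀ k : ℤ, 0 ≤ k → k ≤ n → X k ∈ Icc α β := fun k h1 h2 =>
    ⟨by rw [← hX0]; exact hXm _ _ h1, by rw [← hXn]; exact hXm _ _ h2⟩
  have hXI2 : ∀ k : ℤ, 0 < k → k < n → ∀ y, |y - X k| ≤ h → y ∈ Icc α β := by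
    intro k h1 h2 y hy
    have a1 := (hXI (k-1) (by omega) (by omega)).1
    have a2 := (hXI (k+1) (by omega) (by omega)).2
    rw [hXp] at a1; rw [hXs] at a2
    rw [abs_le] at hy
    constructor <;> linarith
  have hSI : ∀ m ≤ N, S m ∈ Icc ts t0 := by
    intro m hm
    have : (m:ℝ) ≤ N := by exact_mod_cast hm
    have : (m:ℝ) * τ ≤ N * τ := mul_le_mul_of_nonneg_right this hτp.le
    rw [hS]
    constructor
    · have : 0 ≤ (m:ℝ) * τ := by positivity
      linarith
    · linarith
  have hSN : S N = t0 := by rw [hS, hNτ]; linarith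
  have hS0 : S 0 = ts := by rw [hS]; simp
  have hST : ∀ m < N, ∀ s, |s - S m| ≤ τ → S m ≤ s → s ∈ Icc ts t0 := by
    intro m hm s hs1 hs2
    have a1 := (hSI m hm.le).1
    have a2 := (hSI (m+1) hm).2
    rw [hSs] at a2
    rw [abs_le] at hs1
    constructor <;> linarith
  -- time consistency
  have tcons : ∀ (F F1 : ℝ → ℝ) (m : ℕ), m < N → (∀ s ∈ Icc ts t0, HasDerivAt F (F1 s) s) →
      (∀ s ∈ Icc ts t0, |s - S m| ≤ τ → |F1 s - F1 (S m)| ≤ η) →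
      |F (S m + τ) - F (S m) - F1 (S m) * τ| ≤ η * τ := by
    intro F F1 m hm hF hF1
    have hset : ∀ z ∈ Icc (S m) (S m + τ), z ∈ Icc ts t0 ∧ |z - S m| ≤ τ := fun z hz => by
      have : |z - S m| ≤ τ := abs_le.2 ⟨by linarith [hz.1], by linarith [hz.2]⟩
      exact ⟨hST m hm z this hz.1, this⟩
    have := Convex.norm_image_sub_le_of_norm_hasDerivWithin_le (f := fun z => F z - F1 (S m) * (z - S m))
      (f' := fun z => F1 z - F1 (S m)) (s := Icc (S m) (S m + τ)) (C := η)
      (x := S m) (y := S m + τ) (fun z hz => (((hF z (hset z hz).1).sub (((hasDerivAt_id z).sub_const (S m)).const_mul (F1 (S m)))).congr_deriv (by ring)).hasDerivWithinAt)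
      (fun z hz => hF1 z (hset z hz).1 (hset z hz).2) (convex_Icc _ _) ⟨le_rfl, by linarith⟩
      ⟨by linarith, le_rfl⟩
    simp only [Real.norm_eq_abs, add_sub_cancel_left, abs_of_pos hτp] at this
    convert this using 2
    ring
  have hbh : ∀ t x, |b t x| * h ≤ 2 := fun t x => by
    have := mul_le_mul_of_nonneg_right (hb t x) hhp.le
    linarith
  have hbh' : ∀ t x, -2 ≤ b t x * h ∧ b t x * h ≤ 2 := fun t x => by
    rw [← abs_le, abs_mul, abs_of_pos hhp]; exact hbh t x
  have hmain := disc_compare n N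
    (fun m k => τ * (1/h^2 + b (S m) (X k)/(2*h))) (fun m k => τ * (1/h^2 - b (S m) (X k)/(2*h)))
    (fun m k => τ * c (S m) (X k)) (fun m k => w (S m) (X k)) (fun m k l => ψ (S m) (X k) (X l))
    (2 * τ / h^2) (M * τ) C0 (Cw * τ) (3 * η * τ) (5 * η * τ) hC00 (by positivity) (by positivity) (by positivity)
    (fun m k => by
      have : τ * (1/h^2 + b (S m) (X k)/(2*h)) = τ * (2 + b (S m) (X k)*h)/(2 * h^2) := by field_simp
      rw [this]; have : 0 ≤ 2 + b (S m) (X k) * h := by linarith [(hbh' (S m) (X k)).1]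
      positivity)
    (fun m k => by
      have : τ * (1/h^2 - b (S m) (X k)/(2*h)) = τ * (2 - b (S m) (X k)*h)/(2 * h^2) := by field_simp
      rw [this]; have : 0 ≤ 2 - b (S m) (X k) * h := by linarith [(hbh' (S m) (X k)).2]
      positivity)
    (fun m k => le_of_eq (by field_simp; ring))
    (fun m k => by
      rw [abs_mul, abs_of_pos hτp, mul_comm]
      exact mul_le_mul_of_nonneg_right (hc _ _) hτp.le)
    (by
      have : 2 * τ / h^2 ≤ 2 * h := by
        rw [div_le_iff₀ (by positivity)]; linarith
      have : M * τ ≤ M * h := mul_le_mul_of_nonneg_left hτh1 hM.le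
      linarith)
    (fun k _ _ => by rw [hS0]; exact hC0 _)
    (fun m hm k h1 h2 => by
      have := Convex.norm_image_sub_le_of_norm_hasDerivWithin_le (f := fun s => w s (X k))
        (f' := fun s => wt s (X k)) (s := Icc ts t0) (C := Cw) (x := S m) (y := S (m+1))
        (fun z hz => (hw.dt z (by linarith [hz.1]) (X k)).hasDerivWithinAt)
        (fun z hz => hCwt z hz _) (convex_Icc _ _) (hSI m hm.le) (hSI (m+1) hm)
      rw [hSs, add_sub_cancel_left, Real.norm_eq_abs, Real.norm_eq_abs, abs_of_pos hτp] at this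
      rw [hSs]; exact this)
    (fun m hm k h1 h2 => by
      have hSm := hSI m hm.le
      have hSp : 0 < S m := by linarith [hSm.1]
      have hXk := hXI k h1.le h2.le
      have a1 := tcons (fun s => w s (X k)) (fun s => wt s (X k)) m hm (fun s hs => hw.dt s (by linarith [hs.1]) _)
        (fun s hs hs2 => u1 _ hSm _ hs _ hXk _ hXk (by linarith) (by simpa using hδ1.le))
      have a2 := step_cons (F := fun x => w (S m) x) (F1 := fun x => wx (S m) x) (F2 := fun x => wxx (S m) x)
        (X k) h η τ (b (S m) (X k)) hhp hτp (hbh _ _)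
        (fun y _ => hw.dx _ hSp y) (fun y _ => hw.dxx _ hSp y)
        (fun y hy => u2 _ hSm _ hSm _ hXk _ (hXI2 k h1 h2 y hy) (by simpa using hδ2.le) (by linarith))
      have a3 := hbc (S m) (X k) hSm.1
      simp only [hXs, hXp, hSs]
      rw [abs_le] at *
      have a4 : τ * (wt (S m) (X k) - wxx (S m) (X k)) = τ * (b (S m) (X k) * wx (S m) (X k) + c (S m) (X k) * w (S m) (X k)) := by rw [a3]
      constructor <;> linarith)
    (fun m hm k l h1 h2 h3 => by
      have hSm := hSI m hm.le
      have hXk := hXI k h1.le (by omega)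
      have hXl := hXI l (by omega) h3.le
      have a1 := tcons (fun s => ψ s (X k) (X l)) (fun s => ψt s (X k) (X l)) m hm (fun s hs => hψt s _ _)
        (fun s hs hs2 => u3 _ hSm _ hs _ hXk _ hXk _ hXl _ hXl (by linarith) (by simpa using hδ3.le) (by simpa using hδ3.le))
      have a2 := step_cons (F := fun x => ψ (S m) x (X l)) (F1 := fun x => ψx (S m) x (X l)) (F2 := fun x => ψxx (S m) x (X l))
        (X k) h η τ (b (S m) (X k)) hhp hτp (hbh _ _)
        (fun y _ => hψx _ y _) (fun y _ => hψxx _ y _)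
        (fun y hy => u4 _ hSm _ hSm _ hXk _ (hXI2 k h1 (by omega) y hy) _ hXl _ hXl (by simpa using hδ4.le) (by linarith) (by simpa using hδ4.le))
      have a3 := step_cons (F := fun x => ψ (S m) (X k) x) (F1 := fun x => ψy (S m) (X k) x) (F2 := fun x => ψyy (S m) (X k) x)
        (X l) h η τ (b (S m) (X l)) hhp hτp (hbh _ _)
        (fun y _ => hψy _ _ y) (fun y _ => hψyy _ _ y)
        (fun y hy => u5 _ hSm _ hSm _ hXk _ hXk _ hXl _ (hXI2 l (by omega) h3 y hy) (by simpa using hδ5.le) (by simpa using hδ5.le) (by linarith))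
      have a4 := hineq (S m) hSm (X k) (X l) hXk.1 (hXm _ _ h2.le) hXl.2
      have prod : ∀ u v : ℝ, |u| ≤ M → - (M * |v|) ≤ u * v := by
        intro u v hu
        have : |u * v| ≤ M * |v| := by rw [abs_mul]; exact mul_le_mul_of_nonneg_right hu (abs_nonneg _)
        exact (abs_le.1 this).1
      have b1 := prod _ (ψx (S m) (X k) (X l)) (hb (S m) (X k))
      have b2 := prod _ (ψy (S m) (X k) (X l)) (hb (S m) (X l))
      have b3 := prod _ (ψ (S m) (X k) (X l)) (hc (S m) (X k))
      have b4 := prod _ (ψ (S m) (X k) (X l)) (hc (S m) (X l))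
      have a5 : ψt (S m) (X k) (X l) ≤ ψxx (S m) (X k) (X l) + ψyy (S m) (X k) (X l) +
        b (S m) (X k) * ψx (S m) (X k) (X l) + b (S m) (X l) * ψy (S m) (X k) (X l) +
        c (S m) (X k) * ψ (S m) (X k) (X l) + c (S m) (X l) * ψ (S m) (X k) (X l) := by linarith
      have a6 := mul_le_mul_of_nonneg_left a5 hτp.le
      simp only [hXs, hXp, hSs]
      rw [abs_le] at a1 a2 a3
      linarith [a1.2, a2.1, a3.1])
    (fun m hm k => hd _ (hSI m hm) _) (fun m hm l => by rw [hX0]; exact hl _ (hSI m hm) _)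
    (fun m hm k => by rw [hXn]; exact hr _ (hSI m hm) _)
    (fun m hm => by rw [hX0]; exact hwl _ (hSI m hm)) (fun m hm => by rw [hXn]; exact hwr _ (hSI m hm))
    (fun k l h1 h2 h3 => by
      rw [hS0]
      exact hinit _ _ (hXI k h1.le (by omega)).1 (hXm _ _ h2.le) (hXI l (by omega) h3.le).2)
    k l hk hkl hln
  simp only [hSN] at hmain
  rw [← hX, ← hX]
  have c1 : C0 * (1 + M * τ)^N ≤ B := by
    rw [hB]
    exact mul_le_mul_of_nonneg_left (pow_le_exp_aux _ (by positivity) N _ (le_of_eq (by rw [← hNτ]; ring))) hC00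
  have c2 : (1 + 2 * (M * τ))^N ≤ exp (2 * M * T) :=
    pow_le_exp_aux _ (by positivity) N _ (le_of_eq (by rw [← hNτ]; ring))
  rw [← hB]
  refine hmain.trans ?_
  have d1 : C0 * (1 + M * τ)^N * (max (w t0 (X k)) 0 + max (- w t0 (X l)) 0) ≤ B * (max (w t0 (X k)) 0 + max (- w t0 (X l)) 0) :=
    mul_le_mul_of_nonneg_right c1 (by positivity)
  have e0 : 2 * τ / h^2 ≤ 2 * h := by
    rw [div_le_iff₀ (by positivity)]; linarith
  have d2 : 2 * (Cw * τ) * (2 * (2 * τ / h^2) + M * τ) * (C0 * (1 + M * τ)^N) + 2 * (3 * η * τ) * (C0 * (1 + M * τ)^N) + 5 * η * τ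
      ≤ τ * η * (2 * Cw * (4 + M) * B + 6 * B + 5) := by
    have f1 : 2 * (2 * τ / h^2) + M * τ ≤ (4 + M) * η := by
      have : M * τ ≤ M * η := mul_le_mul_of_nonneg_left (by linarith) hM.le
      linarith
    have f2 : 0 ≤ C0 * (1 + M * τ)^N := by positivity
    have f3 : 2 * (Cw * τ) * (2 * (2 * τ / h^2) + M * τ) * (C0 * (1 + M * τ)^N) ≤ 2 * (Cw * τ) * ((4 + M) * η) * B :=
      mul_le_mul (mul_le_mul_of_nonneg_left f1 (by positivity)) c1 f2 (by positivity)
    have f4 : 2 * (3 * η * τ) * (C0 * (1 + M * τ)^N) ≤ 2 * (3 * η * τ) * B := mul_le_mul_of_nonneg_left c1 (by positivity)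
    linarith
  have d3 : N * (1 + 2 * (M * τ))^N * (2 * (Cw * τ) * (2 * (2 * τ / h^2) + M * τ) * (C0 * (1 + M * τ)^N) + 2 * (3 * η * τ) * (C0 * (1 + M * τ)^N) + 5 * η * τ)
      ≤ N * exp (2 * M * T) * (τ * η * (2 * Cw * (4 + M) * B + 6 * B + 5)) :=
    mul_le_mul (mul_le_mul_of_nonneg_left c2 hNp.le) d2 (by positivity) (by positivity)
  have d4 : N * exp (2 * M * T) * (τ * η * (2 * Cw * (4 + M) * B + 6 * B + 5)) = ε := by
    have : N * exp (2 * M * T) * (τ * η * (2 * Cw * (4 + M) * B + 6 * B + 5)) = (N * τ) * exp (2 * M * T) * (2 * Cw * (4 + M) * B + 6 * B + 5) * η := by ring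
    rw [this, hNτ, ← hG, hη]; field_simp
  linarith

theorem grid_approx (α β x : ℝ) (hαβ : α < β) (hx : α ≤ x) :
    Tendsto (fun n : ℕ => α + (⌊(x - α) / ((β - α) / n)⌋ : ℤ) * ((β - α) / n)) atTop (𝓝 x) := by
  have hh : Tendsto (fun n : ℕ => (β - α) / (n:ℝ)) atTop (𝓝 0) := tendsto_const_div_atTop_nhds_zero_nat _
  have h2 : Tendsto (fun n : ℕ => x - (β - α) / (n:ℝ)) atTop (𝓝 x) := by simpa using hh.const_sub x
  refine tendsto_of_tendsto_of_tendsto_of_le_of_le' h2 tendsto_const_nhds ?_ ?_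
  all_goals
    filter_upwards [eventually_gt_atTop 0] with n hn
    have hn' : (0:ℝ) < n := by exact_mod_cast hn
    obtain ⟨h, hh⟩ : ∃ h, h = (β - α) / n := ⟨_, rfl⟩
    rw [← hh]
    have hhp : 0 < h := by rw [hh]; exact div_pos (by linarith) hn'
    have e : (x - α) / h * h = x - α := by field_simp
  · have := mul_le_mul_of_nonneg_right (Int.lt_floor_add_one ((x - α) / h)).le hhp.le
    linarith
  · have := mul_le_mul_of_nonneg_right (Int.floor_le ((x - α) / h)) hhp.le
    linarith

theorem cont_compare_lim {f : ℝ → ℝ → ℝ} {v : ℝ → ℝ} {α β C : ℝ} (hαβ : α < β)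
    (hf : Continuous (fun p : ℝ × ℝ => f p.1 p.2)) (hv : Continuous v)
    (h : ∀ ε > 0, ∃ h0 > 0, ∀ n : ℕ, 0 < n → (β - α) / n < h0 → ∀ k l : ℤ, 0 ≤ k → k ≤ l → l ≤ n →
      f (α + k * ((β - α) / n)) (α + l * ((β - α) / n)) ≤
      C * (max (v (α + k * ((β - α) / n))) 0 + max (- v (α + l * ((β - α) / n))) 0) + ε)
    (x y : ℝ) (hx : α ≤ x) (hxy : x ≤ y) (hy : y ≤ β) :
    f x y ≤ C * (max (v x) 0 + max (- v y) 0) := by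
  refine le_of_forall_pos_le_add (fun ε hε => ?_)
  obtain ⟨h0, hh0, hh⟩ := h ε hε
  have hx' := grid_approx α β x hαβ hx
  have hy' := grid_approx α β y hαβ (hx.trans hxy)
  have l1 := (hf.tendsto (x, y)).comp (hx'.prodMk_nhds hy')
  have l2 : Tendsto (fun n : ℕ => C * (max (v (α + (⌊(x - α) / ((β - α) / n)⌋ : ℤ) * ((β - α) / n))) 0 +
      max (- v (α + (⌊(y - α) / ((β - α) / n)⌋ : ℤ) * ((β - α) / n))) 0) + ε) atTop
      (𝓝 (C * (max (v x) 0 + max (- v y) 0) + ε)) :=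
    ((((hv.tendsto x).comp hx').max tendsto_const_nhds).add
      ((((hv.tendsto y).comp hy').neg).max tendsto_const_nhds)).const_mul C |>.add_const ε
  refine le_of_tendsto_of_tendsto l1 l2 ?_
  have hht : Tendsto (fun n : ℕ => (β - α) / (n:ℝ)) atTop (𝓝 0) := tendsto_const_div_atTop_nhds_zero_nat _
  filter_upwards [eventually_gt_atTop 0, hht.eventually (gt_mem_nhds hh0)] with n hn hn2
  have hn' : (0:ℝ) < n := by exact_mod_cast hn
  have hp : 0 < (β - α) / n := div_pos (by linarith) hn'
  refine hh n hn hn2 _ _ (Int.floor_nonneg.2 (div_nonneg (by linarith) hp.le))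
    (Int.floor_le_floor (by gcongr)) ?_
  have : (y - α) / ((β - α) / n) ≤ n := by
    rw [div_le_iff₀ hp]; field_simp; linarith
  exact_mod_cast (Int.floor_le _).trans this

theorem hasDerivAt_max_sq (s : ℝ) : HasDerivAt (fun s : ℝ => (max s 0)^2) (2 * max s 0) s := by
  rcases lt_trichotomy s 0 with h | h | h
  · have : (fun s : ℝ => (max s 0)^2) =ᶠ[𝓝 s] fun _ => 0 := by
      filter_upwards [gt_mem_nhds h] with z hz
      simp [max_eq_right hz.le]
    rw [max_eq_right h.le, mul_zero]
    exact (hasDerivAt_const s 0).congr_of_eventuallyEq this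
  · subst h
    rw [max_self, mul_zero, hasDerivAt_iff_isLittleO_nhds_zero]
    have : (fun h : ℝ => (max (0 + h) 0)^2 - (max (0:ℝ) 0)^2 - h • (0:ℝ)) =O[𝓝 0] fun h : ℝ => h^2 := by
      refine Asymptotics.IsBigO.of_bound 1 (Eventually.of_forall fun h => ?_)
      simp only [zero_add, max_self, smul_zero, sub_zero, ne_eq, OfNat.ofNat_ne_zero, not_false_eq_true, zero_pow, norm_pow, one_mul, Real.norm_eq_abs]
      refine pow_le_pow_left₀ (abs_nonneg _) ?_ 2
      rcases le_total h 0 with h1 | h1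
      · simp [h1]
      · simp [h1]
    exact this.trans_isLittleO (Asymptotics.isLittleO_pow_id (by norm_num))
  · have : (fun s : ℝ => (max s 0)^2) =ᶠ[𝓝 s] fun s => s^2 := by
      filter_upwards [lt_mem_nhds h] with z hz
      simp [max_eq_left hz.le]
    rw [max_eq_left h.le]
    exact ((hasDerivAt_pow 2 s).congr_deriv (by norm_num)).congr_of_eventuallyEq this

theorem hasDerivAt_max_cube (s : ℝ) : HasDerivAt (fun s : ℝ => (max s 0)^3) (3 * (max s 0)^2) s := by
  have h : (fun s : ℝ => (max s 0)^3) = fun s : ℝ => (max s 0)^2 * s := by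
    funext s
    rcases le_total s 0 with h | h
    · simp [h]
    · simp [h]; ring
  rw [h]
  refine ((hasDerivAt_max_sq s).mul (hasDerivAt_id s)).congr_deriv ?_
  rcases le_total s 0 with h | h
  · simp [h]
  · simp [h]; ring

theorem barrier_alg (M K r D s St Sx Sy f e ρ v dd A : ℝ) (hM : 0 < M) (hr : 0 < r) (hs : 0 < s)
    (hf : 0 ≤ f) (he : 0 < e) (hρ : 0 ≤ ρ) (hfe : M * e * ρ ≤ D * f)
    (hSt : St ≤ 2 * r * v) (hSx : |Sx| ≤ 2 * r) (hSy : |Sy| ≤ 2 * r)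
    (hsum : Sx^2 + Sy^2 = 4 * (r^2 - s)) (hdiff : Sy - Sx = -2 * ρ + 2 * dd) (hdd : 0 ≤ dd)
    (hA : A = 36 + 12 * D + 12 * M * r + 6 * r * v) (hK : K = 2 * M + A^2 / (96 * r^2)) :
    -K * f * s^3 + f * (3 * s^2) * St ≤
      (M^2 * e * s^3 - 2 * M * e * (3 * s^2) * Sx + f * (6 * s * Sx^2 - 2 * (3 * s^2))) +
      (M^2 * e * s^3 + 2 * M * e * (3 * s^2) * Sy + f * (6 * s * Sy^2 - 2 * (3 * s^2))) -
      M * (|-M * e * s^3 + f * (3 * s^2) * Sx| + |M * e * s^3 + f * (3 * s^2) * Sy|) - 2 * M * (f * s^3) := by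
  have hs2 : 0 ≤ s^2 := by positivity
  have hs3 : 0 ≤ s^3 := by positivity
  have a1 : |-M * e * s^3 + f * (3 * s^2) * Sx| ≤ M * e * s^3 + f * (3 * s^2) * (2 * r) := by
    refine (abs_add_le _ _).trans (add_le_add (le_of_eq ?_) ?_)
    · rw [neg_mul, neg_mul, abs_neg, abs_of_nonneg (by positivity)]
    · rw [abs_mul, abs_of_nonneg (by positivity)]
      exact mul_le_mul_of_nonneg_left hSx (by positivity)
  have a2 : |M * e * s^3 + f * (3 * s^2) * Sy| ≤ M * e * s^3 + f * (3 * s^2) * (2 * r) := by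
    refine (abs_add_le _ _).trans (add_le_add (le_of_eq ?_) ?_)
    · rw [abs_of_nonneg (by positivity)]
    · rw [abs_mul, abs_of_nonneg (by positivity)]
      exact mul_le_mul_of_nonneg_left hSy (by positivity)
  have a3 := mul_le_mul_of_nonneg_left (add_le_add a1 a2) hM.le
  have a4 : f * (3 * s^2) * St ≤ f * (3 * s^2) * (2 * r * v) := mul_le_mul_of_nonneg_left hSt (by positivity)
  have a5 : f * (6 * s * Sx^2) + f * (6 * s * Sy^2) = f * (6 * s) * (4 * (r^2 - s)) := by rw [← hsum]; ring
  have a6 : 2 * M * e * (3 * s^2) * Sy - 2 * M * e * (3 * s^2) * Sx = 2 * M * e * (3 * s^2) * (-2 * ρ + 2 * dd) := by rw [← hdiff]; ring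
  have a7 : 0 ≤ 2 * M * e * (3 * s^2) * (2 * dd) := by positivity
  have a8 := mul_le_mul_of_nonneg_left hfe (show 0 ≤ 12 * s^2 by positivity)
  have key : 0 ≤ 24 * r^2 - A * s + (K - 2 * M) * s^2 := by
    have : 24 * r^2 - A * s + (K - 2 * M) * s^2 = (48 * r^2 - A * s)^2 / (96 * r^2) := by
      rw [hK]; field_simp; ring
    rw [this]; positivity
  have key2 := mul_nonneg (mul_nonneg hf hs.le) key
  rw [hA] at key2
  nlinarith [a3, a4, a5, a6, a7, a8, key2]

set_option maxHeartbeats 2000000 in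
theorem simple_zero {w wt wx wxx : ℝ → ℝ → ℝ} (hw : Sol w wt wx wxx) {ts t0 α β : ℝ} (h0 : 0 < ts)
    (h01 : ts < t0) (hαβ : α < β)
    (hwl : ∀ t ∈ Icc ts t0, 0 < w t α) (hwr : ∀ t ∈ Icc ts t0, w t β < 0)
    (hno : ∀ x y, α ≤ x → x < y → y ≤ β → ¬ (w ts x < 0 ∧ 0 < w ts y))
    (x0 : ℝ) (hx0 : α < x0) (hx0' : x0 < β) (hz : w t0 x0 = 0) : wx t0 x0 < 0 := by
  obtain ⟨M, hM, hbd⟩ := hw.bd ts h0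
  obtain ⟨C0, hC0p, hC0⟩ := Sol.bound_aux hw.c0 hw.per ts ts h0
  have hC0 : ∀ x, |w ts x| ≤ C0 := hC0 ts ⟨le_rfl, le_rfl⟩
  -- κ, r
  have hcs : Continuous (w ts) := hw.cont_x ts h0
  have l1 := hwl ts ⟨le_rfl, h01.le⟩
  have l2 := hwr ts ⟨le_rfl, h01.le⟩
  obtain ⟨κ, hκ, hκ1, hκ2⟩ : ∃ κ > 0, κ < w ts α ∧ κ < - w ts β :=
    ⟨min (w ts α) (- w ts β) / 2, by have : 0 < min (w ts α) (- w ts β) := lt_min l1 (by linarith)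
                                     linarith, by
      have : 0 < min (w ts α) (- w ts β) := lt_min l1 (by linarith)
      have := min_le_left (w ts α) (- w ts β); linarith, by
      have : 0 < min (w ts α) (- w ts β) := lt_min l1 (by linarith)
      have := min_le_right (w ts α) (- w ts β); linarith⟩
  obtain ⟨δ1, hδ1, hd1⟩ := Metric.eventually_nhds_iff.1 ((hcs.tendsto α).eventually (lt_mem_nhds hκ1))
  obtain ⟨δ2, hδ2, hd2⟩ := Metric.eventually_nhds_iff.1 ((hcs.neg.tendsto β).eventually (lt_mem_nhds hκ2))
  simp only [Real.dist_eq] at hd1 hd2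
  obtain ⟨r, hr, hr1, hr2, hr3, hr4⟩ : ∃ r > 0, 2 * r ≤ δ1 ∧ 2 * r ≤ δ2 ∧ 2 * r ≤ x0 - α ∧ 2 * r ≤ β - x0 := by
    have p1 : 0 < x0 - α := by linarith
    have p2 : 0 < β - x0 := by linarith
    refine ⟨min (min δ1 δ2) (min (x0 - α) (β - x0)) / 2, by positivity, ?_, ?_, ?_, ?_⟩ <;>
    simp [mul_div_cancel₀]
  obtain ⟨T, hT⟩ : ∃ T, T = t0 - ts := ⟨_, rfl⟩
  have hTp : 0 < T := by linarith
  obtain ⟨a, ha⟩ : ∃ a, a = (x0 - (α + r)) / T := ⟨_, rfl⟩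
  obtain ⟨b, hb⟩ : ∃ b, b = (x0 - (β - r)) / T := ⟨_, rfl⟩
  have haT : a * T = x0 - (α + r) := by rw [ha]; field_simp
  have hbT : b * T = x0 - (β - r) := by rw [hb]; field_simp
  have ha0 : 0 ≤ a := by rw [ha]; exact div_nonneg (by linarith) hTp.le
  have hb0 : b ≤ 0 := by rw [hb]; exact div_nonpos_of_nonpos_of_nonneg (by linarith) hTp.le
  obtain ⟨D, hD⟩ : ∃ D, D = exp (M * (β - α)) := ⟨_, rfl⟩
  have hDp : 0 < D := by rw [hD]; exact exp_pos _
  obtain ⟨v, hv⟩ : ∃ v, v = |a| + |b| := ⟨_, rfl⟩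
  obtain ⟨A, hA⟩ : ∃ A, A = 36 + 12 * D + 12 * M * r + 6 * r * v := ⟨_, rfl⟩
  obtain ⟨K, hK⟩ : ∃ K, K = 2 * M + A^2 / (96 * r^2) := ⟨_, rfl⟩
  obtain ⟨ε, hε⟩ : ∃ ε, ε = 2 * κ^2 / (D * r^6) := ⟨_, rfl⟩
  have hεp : 0 < ε := by rw [hε]; positivity
  -- functions
  obtain ⟨ξ, hξ⟩ : ∃ ξ : ℝ → ℝ, ∀ t, ξ t = α + r + a * (t - ts) := ⟨_, fun _ => rfl⟩
  obtain ⟨η, hη⟩ : ∃ η : ℝ → ℝ, ∀ t, η t = β - r + b * (t - ts) := ⟨_, fun _ => rfl⟩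
  obtain ⟨S, hS⟩ : ∃ S : ℝ → ℝ → ℝ → ℝ, ∀ t x y, S t x y = r^2 - (x - ξ t)^2 - (y - η t)^2 := ⟨_, fun _ _ _ => rfl⟩
  obtain ⟨E, hE⟩ : ∃ E : ℝ → ℝ, ∀ t, E t = ε * exp (- K * (t - ts)) := ⟨_, fun _ => rfl⟩
  have hEp : ∀ t, 0 < E t := fun t => by rw [hE]; positivity
  obtain ⟨e, he⟩ : ∃ e : ℝ → ℝ → ℝ, ∀ x y, e x y = exp (M * (y - x)) := ⟨_, fun _ _ => rfl⟩
  have dξ : ∀ t, HasDerivAt ξ a t := fun t => by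
    rw [show ξ = fun t => α + r + a * (t - ts) from funext hξ]
    exact ((((hasDerivAt_id t).sub_const ts).const_mul a).const_add _).congr_deriv (by ring)
  have dη : ∀ t, HasDerivAt η b t := fun t => by
    rw [show η = fun t => β - r + b * (t - ts) from funext hη]
    exact ((((hasDerivAt_id t).sub_const ts).const_mul b).const_add _).congr_deriv (by ring)
  have dE : ∀ t, HasDerivAt E (-K * E t) t := fun t => by
    rw [show E = fun t => ε * exp (- K * (t - ts)) from funext hE]
    exact (((((hasDerivAt_id t).sub_const ts).const_mul (-K)).exp).const_mul ε).congr_deriv (by simp; ring)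
  have dex : ∀ x y, HasDerivAt (fun x => e x y) (-M * e x y) x := fun x y => by
    rw [show e = fun x y => exp (M * (y - x)) from funext fun x => funext fun y => he x y]
    exact ((((hasDerivAt_id x).const_sub y).const_mul M).exp).congr_deriv (by simp; ring)
  have dey : ∀ x y, HasDerivAt (fun y => e x y) (M * e x y) y := fun x y => by
    rw [show e = fun x y => exp (M * (y - x)) from funext fun x => funext fun y => he x y]
    exact ((((hasDerivAt_id y).sub_const x).const_mul M).exp).congr_deriv (by simp; ring)
  have dSt : ∀ t x y, HasDerivAt (fun t => S t x y) (2 * (x - ξ t) * a + 2 * (y - η t) * b) t := fun t x y => by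
    rw [show (fun t => S t x y) = fun t => r^2 - (x - ξ t)^2 - (y - η t)^2 from funext fun t => hS t x y]
    exact (((((dξ t).const_sub x).fun_pow 2).const_sub (r^2)).fun_sub (((dη t).const_sub y).fun_pow 2)).congr_deriv (by ring)
  have dSx : ∀ t x y, HasDerivAt (fun x => S t x y) (-2 * (x - ξ t)) x := fun t x y => by
    rw [show (fun x => S t x y) = fun x => r^2 - (x - ξ t)^2 - (y - η t)^2 from funext fun x => hS t x y]
    exact (((((hasDerivAt_id x).sub_const (ξ t)).fun_pow 2).const_sub (r^2)).sub_const ((y - η t)^2)).congr_deriv (by simp)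
  have dSy : ∀ t x y, HasDerivAt (fun y => S t x y) (-2 * (y - η t)) y := fun t x y => by
    rw [show (fun y => S t x y) = fun y => r^2 - (x - ξ t)^2 - (y - η t)^2 from funext fun y => hS t x y]
    exact ((((hasDerivAt_id y).sub_const (η t)).fun_pow 2).const_sub (r^2 - (x - ξ t)^2)).congr_deriv (by simp)
  have cξ : Continuous ξ := continuous_iff_continuousAt.2 fun t => (dξ t).continuousAt
  have cη : Continuous η := continuous_iff_continuousAt.2 fun t => (dη t).continuousAt
  have cE : Continuous E := continuous_iff_continuousAt.2 fun t => (dE t).continuousAt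
  have ce : Continuous (fun p : ℝ × ℝ × ℝ => e p.2.1 p.2.2) := by simp only [he]; fun_prop
  have cS : Continuous (fun p : ℝ × ℝ × ℝ => S p.1 p.2.1 p.2.2) := by simp only [hS]; fun_prop
  obtain ⟨m, hm⟩ : ∃ m : ℝ → ℝ, ∀ s, m s = max s 0 := ⟨_, fun _ => rfl⟩
  have m2 : ∀ s, HasDerivAt (fun s => m s ^2) (2 * m s) s := fun s => by
    simp only [hm]; exact hasDerivAt_max_sq s
  have m3 : ∀ s, HasDerivAt (fun s => m s ^3) (3 * m s ^2) s := fun s => by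
    simp only [hm]; exact hasDerivAt_max_cube s
  have cm : Continuous m := by rw [show m = fun s => max s 0 from funext hm]; fun_prop
  have c3 : Continuous (fun p : ℝ × ℝ × ℝ => m (S p.1 p.2.1 p.2.2)) := cm.comp cS
  have mneg : ∀ s ≤ 0, m s = 0 := fun s hs => by rw [hm]; exact max_eq_right hs
  have hST : ∀ t ∈ Icc ts t0, 0 ≤ t - ts ∧ t - ts ≤ T := fun t ht => ⟨by linarith [ht.1], by linarith [ht.2]⟩
  have ξ1 : ∀ t ∈ Icc ts t0, α + r ≤ ξ t := fun t ht => by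
    rw [hξ]; have := mul_nonneg ha0 (hST t ht).1; linarith
  have η1 : ∀ t ∈ Icc ts t0, η t ≤ β - r := fun t ht => by
    rw [hη]; have := mul_nonneg (neg_nonneg.2 hb0) (hST t ht).1; linarith
  have ξη : ∀ t ∈ Icc ts t0, 0 ≤ η t - ξ t := fun t ht => by
    have q1 := mul_le_mul_of_nonneg_left (hST t ht).2 ha0
    have q2 := mul_le_mul_of_nonneg_left (hST t ht).2 (neg_nonneg.2 hb0)
    rw [hξ, hη]; linarith
  have hξ0 : ξ t0 = x0 := by rw [hξ, ← hT, haT]; ring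
  have hη0 : η t0 = x0 := by rw [hη, ← hT, hbT]; ring
  have hξs : ξ ts = α + r := by rw [hξ]; ring
  have hηs : η ts = β - r := by rw [hη]; ring
  have d3t : ∀ t x y, HasDerivAt (fun t => m (S t x y)^3) (3 * m (S t x y)^2 * (2 * (x - ξ t) * a + 2 * (y - η t) * b)) t :=
    fun t x y => HasDerivAt.comp (h₂ := fun s => m s ^ 3) (h := fun t => S t x y) t (m3 (S t x y)) (dSt t x y)
  have d3x : ∀ t x y, HasDerivAt (fun x => m (S t x y)^3) (3 * m (S t x y)^2 * (-2 * (x - ξ t))) x :=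
    fun t x y => HasDerivAt.comp (h₂ := fun s => m s ^ 3) (h := fun x => S t x y) x (m3 (S t x y)) (dSx t x y)
  have d3y : ∀ t x y, HasDerivAt (fun y => m (S t x y)^3) (3 * m (S t x y)^2 * (-2 * (y - η t))) y :=
    fun t x y => HasDerivAt.comp (h₂ := fun s => m s ^ 3) (h := fun y => S t x y) y (m3 (S t x y)) (dSy t x y)
  have d2x : ∀ t x y, HasDerivAt (fun x => m (S t x y)^2) (2 * m (S t x y) * (-2 * (x - ξ t))) x :=
    fun t x y => HasDerivAt.comp (h₂ := fun s => m s ^ 2) (h := fun x => S t x y) x (m2 (S t x y)) (dSx t x y)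
  have d2y : ∀ t x y, HasDerivAt (fun y => m (S t x y)^2) (2 * m (S t x y) * (-2 * (y - η t))) y :=
    fun t x y => HasDerivAt.comp (h₂ := fun s => m s ^ 2) (h := fun y => S t x y) y (m2 (S t x y)) (dSy t x y)
  -- compare
  have hcomp := cont_compare_grid hw (C0 := C0) h0 h01 hαβ hM hbd hC0 (fun t ht => (hwl t ht).le)
    (fun t ht => (hwr t ht).le)
    (fun t x y => E t * ((e x y - 1) * m (S t x y)^3))
    (fun t x y => E t * (-K * (e x y - 1) * m (S t x y)^3 + (e x y - 1) * (3 * m (S t x y)^2) * (2 * (x - ξ t) * a + 2 * (y - η t) * b)))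
    (fun t x y => E t * (-M * e x y * m (S t x y)^3 + (e x y - 1) * (3 * m (S t x y)^2) * (-2 * (x - ξ t))))
    (fun t x y => E t * (M^2 * e x y * m (S t x y)^3 - 2 * M * e x y * (3 * m (S t x y)^2) * (-2 * (x - ξ t))
      + (e x y - 1) * (6 * m (S t x y) * (-2 * (x - ξ t))^2 - 2 * (3 * m (S t x y)^2))))
    (fun t x y => E t * (M * e x y * m (S t x y)^3 + (e x y - 1) * (3 * m (S t x y)^2) * (-2 * (y - η t))))
    (fun t x y => E t * (M^2 * e x y * m (S t x y)^3 + 2 * M * e x y * (3 * m (S t x y)^2) * (-2 * (y - η t))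
      + (e x y - 1) * (6 * m (S t x y) * (-2 * (y - η t))^2 - 2 * (3 * m (S t x y)^2))))
    (fun t x y => ((dE t).fun_mul ((d3t t x y).const_mul (e x y - 1))).congr_deriv (by ring))
    (fun t x y => ((((dex x y).sub_const 1).fun_mul (d3x t x y)).const_mul (E t)).congr_deriv (by ring))
    (fun t x y => (((((dex x y).const_mul (-M)).fun_mul (d3x t x y)).fun_add
      ((((dex x y).sub_const 1).fun_mul ((d2x t x y).const_mul 3)).fun_mul
        (((hasDerivAt_id x).sub_const (ξ t)).const_mul (-2)))).const_mul (E t)).congr_deriv (by simp only [id]; ring))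
    (fun t x y => ((((dey x y).sub_const 1).fun_mul (d3y t x y)).const_mul (E t)).congr_deriv (by ring))
    (fun t x y => (((((dey x y).const_mul M).fun_mul (d3y t x y)).fun_add
      ((((dey x y).sub_const 1).fun_mul ((d2y t x y).const_mul 3)).fun_mul
        (((hasDerivAt_id y).sub_const (η t)).const_mul (-2)))).const_mul (E t)).congr_deriv (by simp only [id]; ring))
    (by simp only [he, hS, hm]; fun_prop) (by simp only [he, hS, hm]; fun_prop) (by simp only [he, hS, hm]; fun_prop)
    (fun t ht x y hx hxy hy => by
      have hE0 := hEp t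
      have hf : 0 ≤ e x y - 1 := by
        rw [he]; have := add_one_le_exp (M * (y - x))
        have : 0 ≤ M * (y - x) := mul_nonneg hM.le (by linarith)
        linarith
      have hm0 : 0 ≤ m (S t x y) := by rw [hm]; exact le_max_right _ _
      rw [abs_mul, abs_mul, abs_mul, abs_of_pos hE0, abs_of_nonneg (show 0 ≤ (e x y - 1) * m (S t x y)^3 by positivity)]
      rcases le_or_gt (S t x y) 0 with hs | hs
      · rw [mneg _ hs]; simp
      have hmS : m (S t x y) = S t x y := by rw [hm]; exact max_eq_left hs.le
      rw [hmS]
      have hSe := hS t x y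
      have q1 : (x - ξ t)^2 ≤ r^2 := by nlinarith [sq_nonneg (y - η t)]
      have q2 : (y - η t)^2 ≤ r^2 := by nlinarith [sq_nonneg (x - ξ t)]
      have q1 := abs_le_of_sq_le_sq q1 hr.le
      have q2 := abs_le_of_sq_le_sq q2 hr.le
      have key := barrier_alg M K r D (S t x y) (2 * (x - ξ t) * a + 2 * (y - η t) * b) (-2 * (x - ξ t)) (-2 * (y - η t))
        (e x y - 1) (e x y) (y - x) v (η t - ξ t) A hM hr hs hf (by rw [he]; exact exp_pos _) (by linarith)
        (by
          have g1 : e x y ≤ D := by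
            rw [he, hD]; exact exp_le_exp.2 (mul_le_mul_of_nonneg_left (by linarith) hM.le)
          have g2 : M * (y - x) ≤ e x y - 1 := by
            rw [he]; have := add_one_le_exp (M * (y - x)); linarith
          calc M * e x y * (y - x) = e x y * (M * (y - x)) := by ring
            _ ≤ D * (e x y - 1) := mul_le_mul g1 g2 (mul_nonneg hM.le (by linarith)) hDp.le)
        (by
          have g1 : (x - ξ t) * a ≤ r * |a| := (le_abs_self _).trans (by rw [abs_mul]; exact mul_le_mul_of_nonneg_right q1 (abs_nonneg _))
          have g2 : (y - η t) * b ≤ r * |b| := (le_abs_self _).trans (by rw [abs_mul]; exact mul_le_mul_of_nonneg_right q2 (abs_nonneg _))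
          rw [hv]; linarith)
        (by rw [abs_mul]; norm_num; linarith)
        (by rw [abs_mul]; norm_num; linarith)
        (by rw [hSe]; ring) (by ring) (ξη t ht) hA hK
      have := mul_le_mul_of_nonneg_left key hE0.le
      linarith)
    (fun t ht x => by simp [he])
    (fun t ht y => by
      rw [mneg]
      · simp
      · rw [hS]; have := ξ1 t ht
        nlinarith [sq_nonneg (y - η t)])
    (fun t ht x => by
      rw [mneg]
      · simp
      · rw [hS]; have := η1 t ht
        nlinarith [sq_nonneg (x - ξ t)])
    (fun x y hx hxy hy => by
      rcases le_or_gt (S ts x y) 0 with hs | hs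
      · rw [mneg _ hs]
        simp only [ne_eq, OfNat.ofNat_ne_zero, not_false_eq_true, zero_pow, mul_zero]
        rcases hxy.eq_or_lt with rfl | hlt
        · simp
        have := hno x y hx hlt hy
        rcases le_or_gt 0 (w ts x) with h1 | h1
        · rw [abs_of_nonneg h1]
          have := mul_le_mul_of_nonneg_left (le_abs_self (w ts y)) h1
          linarith
        · have h2 : w ts y ≤ 0 := by by_contra h; exact this ⟨h1, not_le.1 h⟩
          rw [abs_of_nonpos h2, abs_of_neg h1]; linarith
      · have hmS : m (S ts x y) = S ts x y := by rw [hm]; exact max_eq_left hs.le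
        rw [hmS]
        have hSe := hS ts x y
        have q1 : (x - ξ ts)^2 < r^2 := by nlinarith [sq_nonneg (y - η ts)]
        have q2 : (y - η ts)^2 < r^2 := by nlinarith [sq_nonneg (x - ξ ts)]
        have q1 := abs_lt_of_sq_lt_sq q1 hr.le
        have q2 := abs_lt_of_sq_lt_sq q2 hr.le
        rw [hξs, abs_lt] at q1; rw [hηs, abs_lt] at q2
        have w1 := @hd1 x (by rw [abs_lt]; constructor <;> linarith [q1.1, q1.2])
        have w2 := @hd2 y (by rw [abs_lt]; constructor <;> linarith [q2.1, q2.2])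
        simp only [Pi.neg_apply] at w2
        have w3 : w ts y < 0 := by linarith
        rw [abs_of_neg w3, abs_of_pos (show 0 < w ts x by linarith)]
        have hEs : E ts = ε := by rw [hE]; simp
        have g1 : e x y - 1 ≤ D := by
          have : e x y ≤ D := by rw [he, hD]; exact exp_le_exp.2 (mul_le_mul_of_nonneg_left (by linarith) hM.le)
          linarith
        have g2 : S ts x y ≤ r^2 := by rw [hSe]; nlinarith [sq_nonneg (x - ξ ts), sq_nonneg (y - η ts)]
        have g3 : S ts x y ^ 3 ≤ (r^2)^3 := pow_le_pow_left₀ hs.le g2 3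
        have g4 : (e x y - 1) * S ts x y ^ 3 ≤ D * (r^2)^3 := mul_le_mul g1 g3 (by positivity) hDp.le
        have g5 : E ts * ((e x y - 1) * S ts x y ^ 3) ≤ 2 * κ^2 := by
          rw [hEs]
          refine (mul_le_mul_of_nonneg_left g4 hεp.le).trans (le_of_eq ?_)
          rw [hε]; field_simp
        have g6 : κ * κ ≤ w ts x * (- w ts y) := mul_le_mul w1.le w2.le hκ.le (by linarith)
        linarith)
  have hlim := cont_compare_lim (f := fun x y => E t0 * ((e x y - 1) * m (S t0 x y)^3)) (v := w t0) hαβ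
    (by
      simp only [he, hS, hm]; fun_prop) (hw.cont_x t0 (by linarith)) hcomp
  obtain ⟨B, hB⟩ : ∃ B, B = C0 * exp (M * (t0 - ts)) := ⟨_, rfl⟩
  have hBp : 0 < B := by rw [hB]; positivity
  rw [← hB] at hlim
  obtain ⟨κ', hκ'⟩ : ∃ κ', κ' = E t0 * M * (r^2 / 2)^3 / B := ⟨_, rfl⟩
  have hκ'p : 0 < κ' := by rw [hκ']; have := hEp t0; positivity
  have hfin : ∀ y, x0 < y → y < x0 + r / 2 → w t0 y ≤ - κ' * (y - x0) := by
    intro y hy1 hy2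
    have h1 := hlim x0 y hx0.le hy1.le (by linarith)
    simp only [hz, max_self, zero_add] at h1
    have g1 : M * (y - x0) ≤ e x0 y - 1 := by
      rw [he]; have := add_one_le_exp (M * (y - x0)); linarith
    have g2 : r^2 / 2 ≤ m (S t0 x0 y) := by
      rw [hm]; refine le_trans ?_ (le_max_left _ _)
      rw [hS, hξ0, hη0]
      have : (y - x0)^2 ≤ (r/2)^2 := pow_le_pow_left₀ (by linarith) (by linarith) 2
      nlinarith
    have g3 : (r^2/2)^3 ≤ m (S t0 x0 y)^3 := pow_le_pow_left₀ (by positivity) g2 3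
    have hp : 0 < M * (y - x0) := mul_pos hM (by linarith)
    have g4 : M * (y - x0) * (r^2/2)^3 ≤ (e x0 y - 1) * m (S t0 x0 y)^3 := mul_le_mul g1 g3 (by positivity) (by linarith)
    have g5 := (mul_le_mul_of_nonneg_left g4 (hEp t0).le).trans h1
    have g6 : κ' * (y - x0) ≤ max (- w t0 y) 0 := by
      have : κ' * (y - x0) = E t0 * (M * (y - x0) * (r^2/2)^3) / B := by rw [hκ']; ring
      rw [this, div_le_iff₀ hBp]; linarith
    have g7 : 0 < κ' * (y - x0) := mul_pos hκ'p (by linarith)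
    rcases le_or_gt (- w t0 y) 0 with h | h
    · rw [max_eq_right h] at g6; linarith
    · rw [max_eq_left h.le] at g6; linarith
  have hder := hw.dx t0 (by linarith) x0
  have : wx t0 x0 ≤ -κ' := by
    have ht := (hasDerivAt_iff_tendsto_slope.1 hder).mono_left (show 𝓝[>] x0 ≤ 𝓝[≠] x0 from nhdsWithin_mono _ (fun y hy => ne_of_gt hy))
    refine le_of_tendsto ht ?_
    filter_upwards [Ioo_mem_nhdsGT (show x0 < x0 + r/2 by linarith)] with y hy
    have := hfin y hy.1 hy.2
    rw [slope_def_field, hz, sub_zero, div_le_iff₀ (by linarith [hy.1])]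
    exact this
  linarith

/-- bounded measurable on `[0,b]` -/
def BM (b : ℝ) (f : ℝ → ℝ) : Prop := Measurable f ∧ ∃ C, ∀ x ∈ Icc 0 b, |f x| ≤ C

theorem BM.add {b : ℝ} {f g : ℝ → ℝ} (hf : BM b f) (hg : BM b g) : BM b (fun x => f x + g x) := by
  obtain ⟨h1, C, hC⟩ := hf
  obtain ⟨h2, D, hD⟩ := hg
  exact ⟨h1.add h2, C + D, fun x hx => (abs_add_le _ _).trans (add_le_add (hC x hx) (hD x hx))⟩

theorem BM.mul {b : ℝ} {f g : ℝ → ℝ} (hf : BM b f) (hg : BM b g) : BM b (fun x => f x * g x) := by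
  obtain ⟨h1, C, hC⟩ := hf
  obtain ⟨h2, D, hD⟩ := hg
  exact ⟨h1.mul h2, C * D, fun x hx => by
    rw [abs_mul]; exact mul_le_mul (hC x hx) (hD x hx) (abs_nonneg _) ((abs_nonneg _).trans (hC x hx))⟩

theorem BM.of_cont {b : ℝ} {f : ℝ → ℝ} (hf : Continuous f) : BM b f := by
  refine ⟨hf.measurable, ?_⟩
  obtain ⟨C, hC⟩ := isCompact_Icc.exists_bound_of_continuousOn (s := Icc 0 b) hf.continuousOn
  exact ⟨C, fun x hx => hC x hx⟩

theorem BM.const {b : ℝ} (c : ℝ) : BM b (fun _ => c) := BM.of_cont continuous_const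

theorem BM.sub {b : ℝ} {f g : ℝ → ℝ} (hf : BM b f) (hg : BM b g) : BM b (fun x => f x - g x) := by
  have := hf.add ((BM.const (-1)).mul hg)
  convert this using 2; ring

theorem BM.sq {b : ℝ} {f : ℝ → ℝ} (hf : BM b f) : BM b (fun x => f x ^ 2) := by
  have := hf.mul hf
  convert this using 2; ring

theorem BM.ii {b : ℝ} (hb : 0 ≤ b) {f : ℝ → ℝ} (hf : BM b f) : IntervalIntegrable f MeasureTheory.volume 0 b := by
  obtain ⟨h1, C, hC⟩ := hf
  rw [intervalIntegrable_iff_integrableOn_Icc_of_le hb]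
  refine MeasureTheory.Measure.integrableOn_of_bounded (M := C) (by simp) h1.aestronglyMeasurable ?_
  filter_upwards [MeasureTheory.ae_restrict_mem measurableSet_Icc] with x hx
  exact hC x hx

theorem BM.integral_mono {b : ℝ} (hb : 0 ≤ b) {f g : ℝ → ℝ} (hf : BM b f) (hg : BM b g)
    (h : ∀ x ∈ Icc 0 b, f x ≤ g x) : ∫ x in (0:ℝ)..b, f x ≤ ∫ x in (0:ℝ)..b, g x :=
  intervalIntegral.integral_mono_on hb (hf.ii hb) (hg.ii hb) h

theorem BM.integral_zero {b : ℝ} (hb : 0 ≤ b) {f f' : ℝ → ℝ} (hf : Continuous f) (hf' : BM b f') {S : Set ℝ}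
    (hS : S.Countable) (hd : ∀ x, x ∉ S → HasDerivAt f (f' x) x) (h0 : f 0 = 0) (h1 : f b = 0) :
    ∫ x in (0:ℝ)..b, f' x = 0 := by
  rw [MeasureTheory.integral_eq_of_hasDerivAt_off_countable_of_le f f' hb hS hf.continuousOn
    (fun x hx => hd x hx.2) (hf'.ii hb), h0, h1, sub_zero]

theorem BM.int4 {b : ℝ} (hb : 0 ≤ b) {f1 f2 f3 f4 : ℝ → ℝ} (h1 : BM b f1) (h2 : BM b f2) (h3 : BM b f3) (h4 : BM b f4)
    (a1 a2 a3 a4 : ℝ) :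
    ∫ x in (0:ℝ)..b, (a1 * f1 x + a2 * f2 x + a3 * f3 x + a4 * f4 x) =
    a1 * (∫ x in (0:ℝ)..b, f1 x) + a2 * (∫ x in (0:ℝ)..b, f2 x) + a3 * (∫ x in (0:ℝ)..b, f3 x) + a4 * (∫ x in (0:ℝ)..b, f4 x) := by
  have i1 := (BM.const a1).mul h1
  have i2 := (BM.const a2).mul h2
  have i3 := (BM.const a3).mul h3
  have i4 := (BM.const a4).mul h4
  rw [intervalIntegral.integral_add (((i1.add i2).add i3).ii hb) (i4.ii hb),
    intervalIntegral.integral_add ((i1.add i2).ii hb) (i3.ii hb),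
    intervalIntegral.integral_add (i1.ii hb) (i2.ii hb)]
  simp only [intervalIntegral.integral_const_mul]

theorem slice_pt1 (M μ x z zx F : ℝ) (hM : 0 < M) (hμ : 2 * M^2 + 1 ≤ μ) (hx : z ≠ 0 → 1 ≤ x)
    (hF : |F| ≤ M * (|zx - μ * x * z| + |z|)) :
    F^2 / 2 + 2 * μ^3 * z^2 ≤ 4 * μ * zx^2 + 4 * μ^3 * (x^2 * z^2) := by
  have hμ1 : 1 ≤ μ := by nlinarith [sq_nonneg M]
  have h1 : F^2 ≤ (M * (|zx - μ * x * z| + |z|))^2 := by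
    rw [← sq_abs F]; exact pow_le_pow_left₀ (abs_nonneg _) hF 2
  have h2 : (|zx - μ * x * z| + |z|)^2 ≤ 2 * ((zx - μ * x * z)^2 + z^2) := by
    rw [← sq_abs (zx - μ * x * z), ← sq_abs z]; nlinarith [sq_nonneg (|zx - μ * x * z| - |z|)]
  have h3 : (zx - μ * x * z)^2 ≤ 2 * zx^2 + 2 * (μ^2 * (x^2 * z^2)) := by nlinarith [sq_nonneg (zx + μ * x * z)]
  have h4 : (|zx - μ * x * z| + |z|)^2 ≤ 4 * zx^2 + 4 * (μ^2 * (x^2 * z^2)) + 2 * z^2 := by linarith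
  have h5 : F^2 ≤ M^2 * (4 * zx^2 + 4 * (μ^2 * (x^2 * z^2)) + 2 * z^2) := by
    rw [mul_pow] at h1; exact h1.trans (mul_le_mul_of_nonneg_left h4 (sq_nonneg M))
  obtain ⟨Q, hQ⟩ : ∃ Q, Q = x^2 * z^2 := ⟨_, rfl⟩
  have hzQ : z^2 ≤ Q := by
    rw [hQ]
    by_cases hz : z = 0
    · simp [hz]
    · have : 1 ≤ x^2 := one_le_pow₀ (hx hz)
      nlinarith [sq_nonneg z]
  rw [← hQ] at h5 ⊢
  have hQ0 : 0 ≤ Q := (sq_nonneg z).trans hzQ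
  have m1 : M^2 * z^2 ≤ M^2 * Q := mul_le_mul_of_nonneg_left hzQ (sq_nonneg M)
  have m2 : M^2 * Q ≤ M^2 * (μ^2 * Q) := by
    refine mul_le_mul_of_nonneg_left ?_ (sq_nonneg M)
    have := one_le_pow₀ hμ1 (n := 2); nlinarith
  have m3 : 2 * M^2 * (μ^2 * Q) ≤ (μ - 1) * (μ^2 * Q) := mul_le_mul_of_nonneg_right (by linarith) (by positivity)
  have m4 : 2 * M^2 * zx^2 ≤ μ * zx^2 := mul_le_mul_of_nonneg_right (by linarith) (by positivity)
  have m5 : 2 * μ^3 * z^2 ≤ 2 * μ^3 * Q := mul_le_mul_of_nonneg_left hzQ (by positivity)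
  have m6 : 0 ≤ μ^2 * Q := by positivity
  have m7 : 0 ≤ μ * zx^2 := by positivity
  nlinarith

theorem slice_pt2 (M μ R x z zx F : ℝ) (hM : 0 < M) (hμ : 1 ≤ μ) (hx : z ≠ 0 → 1 ≤ x ∧ x ≤ R) (hR : 1 ≤ R)
    (hF : |F| ≤ M * (|zx - μ * x * z| + |z|)) :
    2 * z * F + μ^2 * (x^2 * z^2) ≤ zx^2 + μ^2 * (R^2 + M^2 + 2 * M * R + 2 * M) * z^2 := by
  by_cases hz : z = 0
  · simp [hz]; positivity
  obtain ⟨h1, h2⟩ := hx hz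
  have a1 : 2 * z * F ≤ 2 * |z| * (M * (|zx - μ * x * z| + |z|)) := by
    refine (le_abs_self _).trans ?_
    rw [abs_mul, abs_mul, abs_two]
    exact mul_le_mul_of_nonneg_left hF (by positivity)
  have a2 : |zx - μ * x * z| ≤ |zx| + μ * R * |z| := by
    refine (abs_sub _ _).trans ?_
    rw [abs_mul, abs_of_pos (show 0 < μ * x by positivity)]
    have : μ * x ≤ μ * R := mul_le_mul_of_nonneg_left h2 (by linarith)
    have := mul_le_mul_of_nonneg_right this (abs_nonneg z)
    linarith
  have a3 : 2 * |z| * (M * (|zx - μ * x * z| + |z|)) ≤ 2 * |z| * (M * ((|zx| + μ * R * |z|) + |z|)) := by gcongr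
  have a4 : 2 * |z| * (M * |zx|) ≤ zx^2 + M^2 * z^2 := by
    rw [← sq_abs zx, ← sq_abs z]; nlinarith [sq_nonneg (|zx| - M * |z|)]
  have a5 : x^2 * z^2 ≤ R^2 * z^2 := mul_le_mul_of_nonneg_right (pow_le_pow_left₀ (by linarith) h2 2) (sq_nonneg z)
  have a6 := mul_le_mul_of_nonneg_left a5 (sq_nonneg μ)
  have e : |z| * |z| = z^2 := by rw [← sq_abs z]; ring
  have a7 : 2 * |z| * (M * ((|zx| + μ * R * |z|) + |z|)) = 2 * |z| * (M * |zx|) + (2 * M * R * μ + 2 * M) * z^2 := by rw [← e]; ring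
  have b1 : 1 ≤ μ^2 := one_le_pow₀ hμ
  have b2 : μ ≤ μ^2 := by nlinarith
  have b3 : M^2 + (2 * M * R * μ + 2 * M) ≤ μ^2 * (M^2 + 2 * M * R + 2 * M) := by
    have c1 : M^2 * 1 ≤ M^2 * μ^2 := mul_le_mul_of_nonneg_left b1 (sq_nonneg M)
    have c2 : 2 * M * R * μ ≤ 2 * M * R * μ^2 := mul_le_mul_of_nonneg_left b2 (by positivity)
    have c3 : 2 * M * 1 ≤ 2 * M * μ^2 := mul_le_mul_of_nonneg_left b1 (by positivity)
    linarith
  have b4 := mul_le_mul_of_nonneg_right b3 (sq_nonneg z)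
  linarith

theorem slice_est {M μ R : ℝ} (hM : 0 < M) (hμ : 2 * M^2 + 1 ≤ μ) (hR : 1 ≤ R) {z zx zxx zt : ℝ → ℝ}
    (hsupp : ∀ x, z x ≠ 0 → 1 ≤ x ∧ x ≤ R) (hz0 : z 0 = 0) (hzb : z (R+1) = 0) (hzx0 : zx 0 = 0) (hzxb : zx (R+1) = 0)
    (hd : ∀ x, HasDerivAt z (zx x) x) (hc : Continuous zx) {S : Set ℝ} (hS : S.Countable)
    (hdd : ∀ x, x ∉ S → HasDerivAt zx (zxx x) x) (bxx : BM (R+1) zxx) (bt : BM (R+1) zt)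
    (hF : ∀ x, |zt x - (zxx x + μ^2 * x^2 * z x) - (-2 * μ * x * zx x - μ * z x)| ≤ M * (|zx x - μ * x * z x| + |z x|))
    (hH : 0 < ∫ x in (0:ℝ)..(R+1), z x ^ 2) :
    (∫ x in (0:ℝ)..(R+1), (zxx x + μ^2 * x^2 * z x) * z x) ≤ μ^2 * R^2 * ∫ x in (0:ℝ)..(R+1), z x ^ 2 ∧
    (∫ x in (0:ℝ)..(R+1), 2 * z x * zt x) ≤ (∫ x in (0:ℝ)..(R+1), (zxx x + μ^2 * x^2 * z x) * z x) +
      μ^2 * (R^2 + M^2 + 2 * M * R + 2 * M) * ∫ x in (0:ℝ)..(R+1), z x ^ 2 ∧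
    2 * μ^3 * (∫ x in (0:ℝ)..(R+1), z x ^ 2)^2 ≤
      (∫ x in (0:ℝ)..(R+1), 2 * (zxx x + μ^2 * x^2 * z x) * zt x) * (∫ x in (0:ℝ)..(R+1), z x ^ 2) -
      (∫ x in (0:ℝ)..(R+1), (zxx x + μ^2 * x^2 * z x) * z x) * (∫ x in (0:ℝ)..(R+1), 2 * z x * zt x) := by
  have hb : (0:ℝ) ≤ R + 1 := by linarith
  have hμ1 : 1 ≤ μ := by nlinarith [sq_nonneg M]
  have cz : Continuous z := continuous_iff_continuousAt.2 fun x => (hd x).continuousAt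
  have bz : BM (R+1) z := BM.of_cont cz
  have bx : BM (R+1) zx := BM.of_cont hc
  have bX : BM (R+1) (fun x => x) := BM.of_cont continuous_id
  have bX2 : BM (R+1) (fun x => μ^2 * x^2) := BM.of_cont (by fun_prop)
  have bS : BM (R+1) (fun x => zxx x + μ^2 * x^2 * z x) := bxx.add (bX2.mul bz)
  have bA : BM (R+1) (fun x => -2 * μ * x * zx x - μ * z x) := BM.of_cont (by fun_prop)
  have b4 : BM (R+1) (fun x => z x ^ 2) := bz.sq
  have b3 : BM (R+1) (fun x => (zxx x + μ^2 * x^2 * z x) * z x) := bS.mul bz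
  have b2 : BM (R+1) (fun x => 2 * z x * zt x) := ((BM.const 2).mul bz).mul bt
  have b1 : BM (R+1) (fun x => 2 * (zxx x + μ^2 * x^2 * z x) * zt x) := ((BM.const 2).mul bS).mul bt
  have b5 : BM (R+1) (fun x => 2 * (zxx x + μ^2 * x^2 * z x) * (-2 * μ * x * zx x - μ * z x) - (4 * μ * zx x^2 + 4 * μ^3 * (x^2 * z x^2))) :=
    (((BM.const 2).mul bS).mul bA).sub (BM.of_cont (by fun_prop))
  have b6 : BM (R+1) (fun x => z x * (-2 * μ * x * zx x - μ * z x)) := bz.mul bA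
  have b7 : BM (R+1) (fun x => z x * zxx x + zx x ^ 2) := (bz.mul bxx).add bx.sq
  have i5 : ∫ x in (0:ℝ)..(R+1), (2 * (zxx x + μ^2 * x^2 * z x) * (-2 * μ * x * zx x - μ * z x) - (4 * μ * zx x^2 + 4 * μ^3 * (x^2 * z x^2))) = 0 := by
    refine BM.integral_zero (f := fun x => -2 * μ * x * zx x^2 - 2 * μ * (z x * zx x) - 2 * μ^3 * x^3 * z x^2) hb (by fun_prop) b5 hS (fun x hx => ?_) (by simp [hz0, hzx0]) (by simp [hzb, hzxb])
    have := (((((hasDerivAt_id x).const_mul (-2 * μ)).fun_mul ((hdd x hx).fun_pow 2)).fun_sub (((hd x).fun_mul (hdd x hx)).const_mul (2 * μ)))).fun_sub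
      ((((hasDerivAt_id x).fun_pow 3).const_mul (2 * μ^3)).fun_mul ((hd x).fun_pow 2))
    refine this.congr_deriv ?_
    simp only [id]; push_cast; ring
  have i6 : ∫ x in (0:ℝ)..(R+1), z x * (-2 * μ * x * zx x - μ * z x) = 0 := by
    refine BM.integral_zero (f := fun x => -μ * x * z x^2) hb (by fun_prop) b6 hS (fun x hx => ?_) (by simp) (by simp [hzb])
    refine ((((hasDerivAt_id x).const_mul (-μ)).fun_mul ((hd x).fun_pow 2))).congr_deriv ?_
    simp only [id]; push_cast; ring
  have i7 : ∫ x in (0:ℝ)..(R+1), (z x * zxx x + zx x ^ 2) = 0 := by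
    refine BM.integral_zero (f := fun x => z x * zx x) hb (by fun_prop) b7 hS (fun x hx => ?_) (by simp [hz0]) (by simp [hzb])
    exact ((hd x).fun_mul (hdd x hx)).congr_deriv (by ring)
  obtain ⟨H, hHd⟩ : ∃ H, H = ∫ x in (0:ℝ)..(R+1), z x ^ 2 := ⟨_, rfl⟩
  obtain ⟨N, hNd⟩ : ∃ N, N = ∫ x in (0:ℝ)..(R+1), (zxx x + μ^2 * x^2 * z x) * z x := ⟨_, rfl⟩
  obtain ⟨D1, hD1⟩ : ∃ N, N = ∫ x in (0:ℝ)..(R+1), 2 * z x * zt x := ⟨_, rfl⟩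
  obtain ⟨D2, hD2⟩ : ∃ N, N = ∫ x in (0:ℝ)..(R+1), 2 * (zxx x + μ^2 * x^2 * z x) * zt x := ⟨_, rfl⟩
  refine ⟨?_, ?_, ?_⟩
  · have e1 := BM.int4 hb b3 b7 b4 b4 1 (-1) (- (μ^2 * R^2)) 0
    rw [i7, ← hNd, ← hHd] at e1
    rw [← hNd, ← hHd]
    have e2 := BM.integral_mono hb (((((BM.const 1).mul b3).add ((BM.const (-1)).mul b7)).add ((BM.const (- (μ^2 * R^2))).mul b4)).add ((BM.const 0).mul b4)) (BM.const 0)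
      (fun x hx => by
        have : z x = 0 ∨ (1 ≤ x ∧ x ≤ R) := by by_cases h : z x = 0; exact Or.inl h; exact Or.inr (hsupp x h)
        rcases this with h | ⟨h1, h2⟩
        · rw [h]; nlinarith [sq_nonneg (zx x)]
        · have a5 : x^2 * z x^2 ≤ R^2 * z x^2 := mul_le_mul_of_nonneg_right (pow_le_pow_left₀ (by linarith) h2 2) (sq_nonneg _)
          have a6 := mul_le_mul_of_nonneg_left a5 (sq_nonneg μ)
          nlinarith [sq_nonneg (zx x)])
    rw [e1] at e2
    simp at e2
    linarith
  · have e1 := BM.int4 hb (b2.sub b3) b6 b7 b4 1 (-2) (-1) (- (μ^2 * (R^2 + M^2 + 2 * M * R + 2 * M)))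
    rw [i7, i6, intervalIntegral.integral_sub (b2.ii hb) (b3.ii hb), ← hNd, ← hHd, ← hD1] at e1
    rw [← hNd, ← hHd, ← hD1]
    have e2 := BM.integral_mono hb (((((BM.const 1).mul (b2.sub b3)).add ((BM.const (-2)).mul b6)).add ((BM.const (-1)).mul b7)).add ((BM.const (- (μ^2 * (R^2 + M^2 + 2 * M * R + 2 * M)))).mul b4)) (BM.const 0)
      (fun x hx => by
        have key := slice_pt2 M μ R x (z x) (zx x) _ hM hμ1 (hsupp x) hR (hF x)
        nlinarith)
    rw [e1] at e2
    simp at e2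
    linarith
  · rw [← hHd] at hH
    obtain ⟨n, hn⟩ : ∃ n, n = N / H := ⟨_, rfl⟩
    have hnH : n * H = N := by rw [hn]; field_simp
    have c1 := ((((BM.const 1).mul b1).add ((BM.const (-n)).mul b2)).add ((BM.const (-2*n)).mul b3)).add ((BM.const (2*n^2)).mul b4)
    have c2 := ((((BM.const 1).mul b5).add ((BM.const (-2*n)).mul b6)).add ((BM.const 0).mul b3)).add ((BM.const (2 * μ^3)).mul b4)
    have e1 := BM.int4 hb b1 b2 b3 b4 1 (-n) (-2*n) (2*n^2)
    have e2 := BM.int4 hb b5 b6 b3 b4 1 (-2*n) 0 (2 * μ^3)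
    rw [i5, i6] at e2
    rw [← hNd, ← hHd] at e1 e2
    rw [← hD1, ← hD2] at e1
    rw [← hNd, ← hHd, ← hD1, ← hD2]
    have e3 := BM.integral_mono hb c2 c1 (fun x hx => by
        have key := slice_pt1 M μ x (z x) (zx x) _ hM hμ (fun h => (hsupp x h).1) (hF x)
        obtain ⟨s, hs⟩ : ∃ s, s = zxx x + μ^2 * x^2 * z x := ⟨_, rfl⟩
        obtain ⟨A, hA⟩ : ∃ A, A = -2 * μ * x * zx x - μ * z x := ⟨_, rfl⟩
        rw [← hs, ← hA] at key ⊢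
        nlinarith [sq_nonneg (s - n * z x + (zt x - s - A)/2)])
    rw [e1, e2] at e3
    have e4 := mul_le_mul_of_nonneg_right e3 hH.le
    rw [← hnH] at e4 ⊢
    nlinarith

structure Slab (W Wt Wx Wxx : ℝ → ℝ → ℝ) (ta tb R C : ℝ) : Prop where
  supp : ∀ t ∈ Ioo ta tb, ∀ x, W t x ≠ 0 → 1 ≤ x ∧ x ≤ R
  suppx : ∀ t ∈ Ioo ta tb, ∀ x, Wx t x ≠ 0 → 1 ≤ x ∧ x ≤ R
  b0 : ∀ t ∈ Ioo ta tb, ∀ x ∈ Icc 0 (R+1), |W t x| ≤ C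
  bt : ∀ t ∈ Ioo ta tb, ∀ x ∈ Icc 0 (R+1), |Wt t x| ≤ C
  bxx : ∀ t ∈ Ioo ta tb, ∀ x ∈ Icc 0 (R+1), |Wxx t x| ≤ C
  dx : ∀ t ∈ Ioo ta tb, ∀ x, HasDerivAt (W t) (Wx t x) x
  cx : ∀ t ∈ Ioo ta tb, Continuous (Wx t)
  mt : ∀ t ∈ Ioo ta tb, Measurable (Wt t)
  mxx : ∀ t ∈ Ioo ta tb, Measurable (Wxx t)
  lip : ∀ t ∈ Ioo ta tb, ∀ t' ∈ Ioo ta tb, ∀ x ∈ Icc 0 (R+1), |W t x - W t' x| ≤ C * |t - t'|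
  cnt : ∀ t ∈ Ioo ta tb, ∃ S : Set ℝ, S.Countable ∧ ∀ x, x ∉ S → HasDerivAt (Wx t) (Wxx t x) x ∧
    HasDerivAt (fun s => W s x) (Wt t x) t ∧ ContinuousAt (fun s => Wxx s x) t ∧ ContinuousAt (fun s => Wx s x) t

section SlabSec
variable {W Wt Wx Wxx : ℝ → ℝ → ℝ} {ta tb R C : ℝ}

theorem Slab.c0 (h : Slab W Wt Wx Wxx ta tb R C) (t : ℝ) (ht : t ∈ Ioo ta tb) : Continuous (W t) :=
  continuous_iff_continuousAt.2 fun x => (h.dx t ht x).continuousAt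

theorem Slab.BMt (h : Slab W Wt Wx Wxx ta tb R C) (t : ℝ) (ht : t ∈ Ioo ta tb) : BM (R+1) (Wt t) :=
  ⟨h.mt t ht, C, h.bt t ht⟩

theorem Slab.BMxx (h : Slab W Wt Wx Wxx ta tb R C) (t : ℝ) (ht : t ∈ Ioo ta tb) : BM (R+1) (Wxx t) :=
  ⟨h.mxx t ht, C, h.bxx t ht⟩

theorem Slab.BM0 (h : Slab W Wt Wx Wxx ta tb R C) (t : ℝ) (ht : t ∈ Ioo ta tb) : BM (R+1) (W t) :=
  BM.of_cont (h.c0 t ht)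

theorem Slab.ends (h : Slab W Wt Wx Wxx ta tb R C) (t : ℝ) (ht : t ∈ Ioo ta tb) :
    W t 0 = 0 ∧ W t (R+1) = 0 ∧ Wx t 0 = 0 ∧ Wx t (R+1) = 0 := by
  refine ⟨?_, ?_, ?_, ?_⟩ <;> by_contra hc
  · have := h.supp t ht _ hc; linarith [this.1]
  · have := h.supp t ht _ hc; linarith [this.2]
  · have := h.suppx t ht _ hc; linarith [this.1]
  · have := h.suppx t ht _ hc; linarith [this.2]

theorem Slab.hasDerivAt_H (h : Slab W Wt Wx Wxx ta tb R C) (hR : 1 ≤ R) (t : ℝ) (ht : t ∈ Ioo ta tb) :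
    HasDerivAt (fun t => ∫ x in (0:ℝ)..(R+1), W t x ^ 2) (∫ x in (0:ℝ)..(R+1), 2 * W t x * Wt t x) t := by
  have hb : (0:ℝ) ≤ R + 1 := by linarith
  have hJ : Ioo ta tb ∈ 𝓝 t := Ioo_mem_nhds ht.1 ht.2
  obtain ⟨S, hS, hS'⟩ := h.cnt t ht
  have hC : 0 ≤ C := (abs_nonneg _).trans (h.b0 t ht 0 ⟨le_rfl, hb⟩)
  have hae : ∀ᵐ x : ℝ, x ∉ S := by
    have := hS.measure_zero MeasureTheory.volume
    exact (MeasureTheory.measure_eq_zero_iff_ae_notMem).1 this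
  refine (intervalIntegral.hasDerivAt_integral_of_dominated_loc_of_lip (F := fun t x => W t x ^ 2)
    (F' := fun x => 2 * W t x * Wt t x) (bound := fun _ => 2 * C * C) hJ ?_ ?_ ?_ ?_ ?_ ?_).2
  · filter_upwards [hJ] with s hs
    exact ((h.c0 s hs).pow 2).aestronglyMeasurable
  · exact ((h.BM0 t ht).sq).ii hb
  · exact (((BM.const 2).mul (h.BM0 t ht)).mul (h.BMt t ht)).1.aestronglyMeasurable
  · refine Eventually.of_forall fun x hx => ?_
    rw [uIoc_of_le hb] at hx
    have hx' : x ∈ Icc 0 (R+1) := ⟨hx.1.le, hx.2⟩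
    refine LipschitzOnWith.of_dist_le_mul fun s hs s' hs' => ?_
    rw [Real.dist_eq, Real.dist_eq, Real.coe_nnabs, abs_of_nonneg (show 0 ≤ 2 * C * C by positivity)]
    have e : W s x ^ 2 - W s' x ^ 2 = (W s x + W s' x) * (W s x - W s' x) := by ring
    rw [e, abs_mul, mul_assoc]
    refine mul_le_mul ?_ (h.lip s hs s' hs' x hx') (abs_nonneg _) (by positivity)
    have := abs_add_le (W s x) (W s' x)
    linarith [h.b0 s hs x hx', h.b0 s' hs' x hx']
  · exact (BM.const _).ii hb
  · filter_upwards [hae] with x hx _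
    exact ((hS' x hx).2.1.fun_pow 2).congr_deriv (by push_cast; ring)

theorem Slab.hasDerivAt_N (h : Slab W Wt Wx Wxx ta tb R C) (hR : 1 ≤ R) (μ : ℝ) (t : ℝ) (ht : t ∈ Ioo ta tb) :
    HasDerivAt (fun t => ∫ x in (0:ℝ)..(R+1), (Wxx t x + μ^2 * x^2 * W t x) * W t x)
      (∫ x in (0:ℝ)..(R+1), 2 * (Wxx t x + μ^2 * x^2 * W t x) * Wt t x) t := by
  have hb : (0:ℝ) ≤ R + 1 := by linarith
  have hJ : Ioo ta tb ∈ 𝓝 t := Ioo_mem_nhds ht.1 ht.2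
  obtain ⟨S, hS, hS'⟩ := h.cnt t ht
  have hC : 0 ≤ C := (abs_nonneg _).trans (h.b0 t ht 0 ⟨le_rfl, hb⟩)
  have hae : ∀ᵐ x : ℝ, x ∉ S := by
    have := hS.measure_zero MeasureTheory.volume
    exact (MeasureTheory.measure_eq_zero_iff_ae_notMem).1 this
  have bX2 : BM (R+1) (fun x => μ^2 * x^2) := BM.of_cont (by fun_prop)
  have hJ' : ∀ᶠ s in 𝓝[≠] t, s ∈ Ioo ta tb ∧ s ≠ t :=
    ((eventually_mem_set.2 hJ).filter_mono nhdsWithin_le_nhds).and self_mem_nhdsWithin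
  rw [hasDerivAt_iff_tendsto_slope]
  have key : ∀ s ∈ Ioo ta tb, BM (R+1) (fun x => (W s x - W t x) * (s - t)⁻¹ * ((Wxx s x + Wxx t x) + μ^2 * x^2 * (W s x + W t x))) :=
    fun s hs => ((((h.BM0 s hs).sub (h.BM0 t ht)).mul (BM.const _))).mul (((h.BMxx s hs).add (h.BMxx t ht)).add (bX2.mul ((h.BM0 s hs).add (h.BM0 t ht))))
  have hsl : ∀ᶠ s in 𝓝[≠] t, ∫ x in (0:ℝ)..(R+1), (W s x - W t x) * (s - t)⁻¹ * ((Wxx s x + Wxx t x) + μ^2 * x^2 * (W s x + W t x)) =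
      slope (fun t => ∫ x in (0:ℝ)..(R+1), (Wxx t x + μ^2 * x^2 * W t x) * W t x) t s := by
    filter_upwards [hJ'] with s hs
    obtain ⟨hs, hne⟩ := hs
    have hst : s - t ≠ 0 := sub_ne_zero.2 hne
    obtain ⟨S2, hS2, hS2'⟩ := h.cnt s hs
    have f1 : BM (R+1) (fun x => (Wxx s x + μ^2 * x^2 * W s x) * W s x) := ((h.BMxx s hs).add (bX2.mul (h.BM0 s hs))).mul (h.BM0 s hs)
    have f2 : BM (R+1) (fun x => (Wxx t x + μ^2 * x^2 * W t x) * W t x) := ((h.BMxx t ht).add (bX2.mul (h.BM0 t ht))).mul (h.BM0 t ht)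
    have f3 : BM (R+1) (fun x => W s x * Wxx t x - W t x * Wxx s x) := ((h.BM0 s hs).mul (h.BMxx t ht)).sub ((h.BM0 t ht).mul (h.BMxx s hs))
    have cs := h.c0 s hs
    have ct := h.c0 t ht
    have csx := h.cx s hs
    have ctx := h.cx t ht
    have i3 : ∫ x in (0:ℝ)..(R+1), (W s x * Wxx t x - W t x * Wxx s x) = 0 := by
      refine BM.integral_zero (f := fun x => W s x * Wx t x - W t x * Wx s x) hb (by fun_prop) f3 (hS.union hS2)
        (fun x hx => ?_) (by simp [(h.ends s hs).1, (h.ends t ht).1]) (by simp [(h.ends s hs).2.1, (h.ends t ht).2.1])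
      have hx1 : x ∉ S := fun h => hx (Or.inl h)
      have hx2 : x ∉ S2 := fun h => hx (Or.inr h)
      exact (((h.dx s hs x).fun_mul (hS' x hx1).1).fun_sub ((h.dx t ht x).fun_mul (hS2' x hx2).1)).congr_deriv (by ring)
    rw [slope_def_field]
    have e := BM.int4 hb f1 f2 f3 f3 ((s-t)⁻¹) (-(s-t)⁻¹) ((s-t)⁻¹) 0
    rw [i3] at e
    calc _ = ∫ x in (0:ℝ)..(R+1), ((s-t)⁻¹ * ((Wxx s x + μ^2 * x^2 * W s x) * W s x) + (-(s-t)⁻¹) * ((Wxx t x + μ^2 * x^2 * W t x) * W t x)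
          + (s-t)⁻¹ * (W s x * Wxx t x - W t x * Wxx s x) + 0 * (W s x * Wxx t x - W t x * Wxx s x)) := by
            congr 1; funext x; ring
      _ = _ := by rw [e]; ring
  refine Tendsto.congr' hsl ?_
  refine intervalIntegral.tendsto_integral_filter_of_dominated_convergence
    (fun x => C * ((C + C) + μ^2 * (R+1)^2 * (C + C))) ?_ ?_ ((BM.const _).ii hb) ?_
  · filter_upwards [hJ'] with s hs
    exact (key s hs.1).1.aestronglyMeasurable
  · filter_upwards [hJ'] with s hs
    obtain ⟨hs, hne⟩ := hs
    have hst : s - t ≠ 0 := sub_ne_zero.2 hne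
    refine Eventually.of_forall fun x hx => ?_
    rw [uIoc_of_le hb] at hx
    have hx' : x ∈ Icc 0 (R+1) := ⟨hx.1.le, hx.2⟩
    rw [Real.norm_eq_abs, abs_mul]
    refine mul_le_mul ?_ ?_ (abs_nonneg _) hC
    · rw [abs_mul, abs_inv, ← div_eq_mul_inv, div_le_iff₀ (abs_pos.2 hst)]
      exact h.lip s hs t ht x hx'
    · refine (abs_add_le _ _).trans (add_le_add ?_ ?_)
      · exact (abs_add_le _ _).trans (add_le_add (h.bxx s hs x hx') (h.bxx t ht x hx'))
      · rw [abs_mul]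
        refine mul_le_mul ?_ ((abs_add_le _ _).trans (add_le_add (h.b0 s hs x hx') (h.b0 t ht x hx'))) (abs_nonneg _) (by positivity)
        rw [abs_of_nonneg (by positivity)]
        exact mul_le_mul_of_nonneg_left (pow_le_pow_left₀ hx'.1 hx'.2 2) (sq_nonneg μ)
  · filter_upwards [hae] with x hx _
    obtain ⟨_, g2, g3, _⟩ := hS' x hx
    have l1 := hasDerivAt_iff_tendsto_slope.1 g2
    have l2 : Tendsto (fun s => Wxx s x) (𝓝[≠] t) (𝓝 (Wxx t x)) := g3.tendsto.mono_left nhdsWithin_le_nhds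
    have l3 : Tendsto (fun s => W s x) (𝓝[≠] t) (𝓝 (W t x)) := g2.continuousAt.tendsto.mono_left nhdsWithin_le_nhds
    have l4 := l1.mul ((l2.add_const (Wxx t x)).add ((l3.add_const (W t x)).const_mul (μ^2 * x^2)))
    have : Wt t x * (Wxx t x + Wxx t x + μ^2 * x^2 * (W t x + W t x)) = 2 * (Wxx t x + μ^2 * x^2 * W t x) * Wt t x := by ring
    rw [this] at l4
    refine l4.congr fun s => ?_
    rw [slope_def_field, div_eq_mul_inv]

end SlabSec

theorem Slab.weight {W Wt Wx Wxx : ℝ → ℝ → ℝ} {ta tb R C : ℝ} (h : Slab W Wt Wx Wxx ta tb R C) (hR : 1 ≤ R) (hC : 0 ≤ C)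
    (hbx : ∀ t ∈ Ioo ta tb, ∀ x ∈ Icc 0 (R+1), |Wx t x| ≤ C) (μ : ℝ) :
    ∃ C', Slab (fun t x => exp (μ * x^2 / 2) * W t x) (fun t x => exp (μ * x^2 / 2) * Wt t x)
      (fun t x => exp (μ * x^2 / 2) * (Wx t x + μ * x * W t x))
      (fun t x => exp (μ * x^2 / 2) * (Wxx t x + 2 * μ * x * Wx t x + (μ^2 * x^2 + μ) * W t x)) ta tb R C' := by
  obtain ⟨P, hP⟩ : ∃ P : ℝ → ℝ, ∀ x, P x = exp (μ * x^2 / 2) := ⟨_, fun _ => rfl⟩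
  simp only [← hP]
  have dP : ∀ x, HasDerivAt P (P x * (μ * x)) x := fun x => by
    rw [show P = fun x => exp (μ * x^2 / 2) from funext hP]
    exact (((((hasDerivAt_id x).fun_pow 2).const_mul μ).div_const 2).exp).congr_deriv (by simp; ring)
  have cP : Continuous P := continuous_iff_continuousAt.2 fun x => (dP x).continuousAt
  have Pp : ∀ x, 0 < P x := fun x => by rw [hP]; exact exp_pos _
  obtain ⟨B0, hB0⟩ := isCompact_Icc.exists_bound_of_continuousOn (s := Icc 0 (R+1)) cP.continuousOn
  obtain ⟨B, hB, hB1⟩ : ∃ B > 0, ∀ x ∈ Icc 0 (R+1), |P x| ≤ B := ⟨max B0 1, by positivity, fun x hx => (hB0 x hx).trans (le_max_left _ _)⟩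
  obtain ⟨D, hD⟩ : ∃ D, D = 1 + 2 * |μ| * (R+1) + (μ^2 * (R+1)^2 + |μ|) := ⟨_, rfl⟩
  have hD1 : 1 ≤ D := by rw [hD]; have : 0 ≤ 2 * |μ| * (R+1) + (μ^2 * (R+1)^2 + |μ|) := by positivity
                         linarith
  have hCD : C ≤ D * C := le_mul_of_one_le_left hC hD1
  refine ⟨B * (D * C), ⟨?_, ?_, ?_, ?_, ?_, ?_, ?_, ?_, ?_, ?_, ?_⟩⟩
  · intro t ht x hx; exact h.supp t ht x (right_ne_zero_of_mul hx)
  · intro t ht x hx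
    have := right_ne_zero_of_mul hx
    by_cases h1 : Wx t x = 0
    · rw [h1, zero_add] at this; exact h.supp t ht x (right_ne_zero_of_mul this)
    · exact h.suppx t ht x h1
  · intro t ht x hx; rw [abs_mul]; exact mul_le_mul (hB1 x hx) ((h.b0 t ht x hx).trans hCD) (abs_nonneg _) hB.le
  · intro t ht x hx; rw [abs_mul]; exact mul_le_mul (hB1 x hx) ((h.bt t ht x hx).trans hCD) (abs_nonneg _) hB.le
  · intro t ht x hx
    rw [abs_mul]; refine mul_le_mul (hB1 x hx) ?_ (abs_nonneg _) hB.le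
    have hx0 : |x| ≤ R + 1 := by rw [abs_of_nonneg hx.1]; exact hx.2
    have a1 : |2 * μ * x * Wx t x| ≤ 2 * |μ| * (R+1) * C := by
      rw [abs_mul, abs_mul, abs_mul, abs_two]
      exact mul_le_mul (mul_le_mul_of_nonneg_left hx0 (by positivity)) (hbx t ht x hx) (abs_nonneg _) (by positivity)
    have a2 : |(μ^2 * x^2 + μ) * W t x| ≤ (μ^2 * (R+1)^2 + |μ|) * C := by
      rw [abs_mul]
      refine mul_le_mul ((abs_add_le _ _).trans (add_le_add ?_ le_rfl)) (h.b0 t ht x hx) (abs_nonneg _) (by positivity)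
      rw [abs_of_nonneg (by positivity)]
      exact mul_le_mul_of_nonneg_left (pow_le_pow_left₀ hx.1 hx.2 2) (sq_nonneg μ)
    have a3 := abs_add_le (Wxx t x + 2 * μ * x * Wx t x) ((μ^2 * x^2 + μ) * W t x)
    have a4 := abs_add_le (Wxx t x) (2 * μ * x * Wx t x)
    have a5 := h.bxx t ht x hx
    rw [hD]; linarith
  · intro t ht x
    exact ((dP x).fun_mul (h.dx t ht x)).congr_deriv (by ring)
  · intro t ht
    have := h.c0 t ht
    have := h.cx t ht
    fun_prop
  · intro t ht; exact cP.measurable.mul (h.mt t ht)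
  · intro t ht
    have h1 := h.mxx t ht
    have h2 := (h.c0 t ht).measurable
    have h3 := (h.cx t ht).measurable
    have h4 := cP.measurable
    fun_prop
  · intro t ht t' ht' x hx
    rw [← mul_sub, abs_mul, mul_assoc]
    refine mul_le_mul (hB1 x hx) ((h.lip t ht t' ht' x hx).trans ?_) (abs_nonneg _) hB.le
    exact mul_le_mul_of_nonneg_right hCD (abs_nonneg _)
  · intro t ht
    obtain ⟨S, hS, hS'⟩ := h.cnt t ht
    refine ⟨S, hS, fun x hx => ?_⟩
    obtain ⟨g1, g2, g3, g4⟩ := hS' x hx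
    have g5 := g2.continuousAt
    refine ⟨?_, g2.const_mul _, ?_, ?_⟩
    · refine ((dP x).fun_mul (g1.fun_add (((hasDerivAt_id x).const_mul μ).fun_mul (h.dx t ht x)))).congr_deriv ?_
      simp only [id]; ring
    · exact continuousAt_const.mul ((g3.add (continuousAt_const.mul g4)).add (continuousAt_const.mul g5))
    · exact continuousAt_const.mul (g4.add (continuousAt_const.mul g5))

theorem ode_lem {H N D1 D2 : ℝ → ℝ} {ta tb A B c : ℝ}
    (hH : ∀ t ∈ Ioo ta tb, HasDerivAt H (D1 t) t) (hN : ∀ t ∈ Ioo ta tb, HasDerivAt N (D2 t) t)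
    (hp : ∀ t ∈ Ioo ta tb, 0 < H t) (h1 : ∀ t ∈ Ioo ta tb, N t ≤ A * H t)
    (h2 : ∀ t ∈ Ioo ta tb, D1 t ≤ N t + B * H t)
    (h3 : ∀ t ∈ Ioo ta tb, c * H t ^ 2 ≤ D2 t * H t - N t * D1 t) (hc : 0 ≤ c)
    {s0 sm s1 : ℝ} (ha : ta < s0) (h01 : s0 < sm) (h12 : sm < s1) (hb : s1 < tb) :
    log (H sm) ≤ log (H s0) + (A + B - c * (s1 - sm)) * (sm - s0) := by
  have dQ : ∀ t ∈ Ioo ta tb, HasDerivAt (fun t => N t / H t) ((D2 t * H t - N t * D1 t) / H t ^ 2) t :=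
    fun t ht => (hN t ht).fun_div (hH t ht) (hp t ht).ne'
  have dL : ∀ t ∈ Ioo ta tb, HasDerivAt (fun t => log (H t)) (D1 t / H t) t :=
    fun t ht => (hH t ht).log (hp t ht).ne'
  have hQ : ∀ t ∈ Icc s0 sm, N t / H t ≤ A - c * (s1 - sm) := by
    intro t ht
    have hsub : Icc t s1 ⊆ Ioo ta tb := fun s hs => ⟨by linarith [hs.1, ht.1], by linarith [hs.2]⟩
    have := (convex_Icc t s1).mul_sub_le_image_sub_of_le_deriv (f := fun t => N t / H t) (C := c)
      (fun s hs => (dQ s (hsub hs)).continuousAt.continuousWithinAt)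
      (fun s hs => (dQ s (hsub (interior_subset hs))).differentiableAt.differentiableWithinAt)
      (fun s hs => by
        have hs := hsub (interior_subset hs)
        rw [(dQ s hs).deriv, le_div_iff₀ (pow_pos (hp s hs) 2)]
        exact h3 s hs) t ⟨le_rfl, by linarith [ht.2]⟩ s1 ⟨by linarith [ht.2], le_rfl⟩ (by linarith [ht.2])
    have hs1 : s1 ∈ Ioo ta tb := ⟨by linarith, hb⟩
    have e : N s1 / H s1 ≤ A := by rw [div_le_iff₀ (hp s1 hs1)]; exact h1 s1 hs1
    have e2 : c * (s1 - sm) ≤ c * (s1 - t) := mul_le_mul_of_nonneg_left (by linarith [ht.2]) hc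
    linarith
  have hsub : Icc s0 sm ⊆ Ioo ta tb := fun s hs => ⟨by linarith [hs.1], by linarith [hs.2]⟩
  have := (convex_Icc s0 sm).image_sub_le_mul_sub_of_deriv_le (f := fun t => log (H t)) (C := A + B - c * (s1 - sm))
      (fun s hs => (dL s (hsub hs)).continuousAt.continuousWithinAt)
      (fun s hs => (dL s (hsub (interior_subset hs))).differentiableAt.differentiableWithinAt)
      (fun s hs => by
        have hs0 := interior_subset hs
        have hs := hsub hs0
        have q := hQ s hs0
        rw [(dL s hs).deriv, div_le_iff₀ (hp s hs)]
        rw [div_le_iff₀ (hp s hs)] at q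
        have := h2 s hs
        linarith) s0 ⟨le_rfl, h01.le⟩ sm ⟨h01.le, le_rfl⟩ h01.le
  linarith

theorem carleman {W Wt Wx Wxx : ℝ → ℝ → ℝ} {ta tb R C M : ℝ} (hab : ta < tb) (h : Slab W Wt Wx Wxx ta tb R C) (hR : 1 ≤ R)
    (hC : 0 ≤ C) (hM : 0 < M)
    (hbx : ∀ t ∈ Ioo ta tb, ∀ x ∈ Icc 0 (R+1), |Wx t x| ≤ C)
    (hF : ∀ t ∈ Ioo ta tb, ∀ x, |Wt t x - Wxx t x| ≤ M * (|Wx t x| + |W t x|))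
    (hI : ∀ t ∈ Ioo ta tb, 0 < ∫ x in (0:ℝ)..(R+1), W t x ^ 2) : False := by
  have hb : (0:ℝ) ≤ R + 1 := by linarith
  obtain ⟨d, hd⟩ : ∃ d, d = (tb - ta) / 4 := ⟨_, rfl⟩
  have hd0 : 0 < d := by rw [hd]; linarith
  have key : ∀ μ, 2 * M^2 + 1 ≤ μ → log (∫ x in (0:ℝ)..(R+1), W (ta + 2 * d) x ^ 2) ≤
      log (∫ x in (0:ℝ)..(R+1), W (ta + d) x ^ 2) + μ * (R+1)^2 +
       (μ^2 * R^2 + μ^2 * (R^2 + M^2 + 2 * M * R + 2 * M) - 2 * μ^3 * d) * d := by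
    intro μ hμ
    have hμ0 : 0 < μ := by nlinarith [sq_nonneg M]
    obtain ⟨C', hZ⟩ := h.weight hR hC hbx μ
    have hle : ∀ t ∈ Ioo ta tb, (∫ x in (0:ℝ)..(R+1), W t x ^ 2) ≤ ∫ x in (0:ℝ)..(R+1), (exp (μ * x^2 / 2) * W t x) ^ 2 := by
      intro t ht
      refine BM.integral_mono hb (h.BM0 t ht).sq (hZ.BM0 t ht).sq fun x _ => ?_
      rw [mul_pow]
      refine le_mul_of_one_le_left (sq_nonneg _) (one_le_pow₀ ?_)
      exact one_le_exp (by positivity)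
    have hge : ∀ t ∈ Ioo ta tb, (∫ x in (0:ℝ)..(R+1), (exp (μ * x^2 / 2) * W t x) ^ 2) ≤ exp (μ * (R+1)^2) * ∫ x in (0:ℝ)..(R+1), W t x ^ 2 := by
      intro t ht
      rw [← intervalIntegral.integral_const_mul]
      refine BM.integral_mono hb (hZ.BM0 t ht).sq ((BM.const _).mul (h.BM0 t ht).sq) fun x hx => ?_
      rw [mul_pow, ← exp_nat_mul]
      refine mul_le_mul_of_nonneg_right (exp_le_exp.2 ?_) (sq_nonneg _)
      have := mul_le_mul_of_nonneg_left (pow_le_pow_left₀ hx.1 hx.2 2) hμ0.le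
      push_cast; linarith
    have hHp := fun t ht => (hI t ht).trans_le (hle t ht)
    have hFZ : ∀ t ∈ Ioo ta tb, ∀ x, |exp (μ * x^2 / 2) * Wt t x - (exp (μ * x^2 / 2) * (Wxx t x + 2 * μ * x * Wx t x + (μ^2 * x^2 + μ) * W t x) + μ^2 * x^2 * (exp (μ * x^2 / 2) * W t x)) -
        (-2 * μ * x * (exp (μ * x^2 / 2) * (Wx t x + μ * x * W t x)) - μ * (exp (μ * x^2 / 2) * W t x))| ≤
        M * (|exp (μ * x^2 / 2) * (Wx t x + μ * x * W t x) - μ * x * (exp (μ * x^2 / 2) * W t x)| + |exp (μ * x^2 / 2) * W t x|) := by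
      intro t ht x
      obtain ⟨P, hP⟩ : ∃ P, P = exp (μ * x^2 / 2) := ⟨_, rfl⟩
      have hP0 : 0 < P := by rw [hP]; exact exp_pos _
      simp only [← hP]
      rw [show P * Wt t x - (P * (Wxx t x + 2 * μ * x * Wx t x + (μ^2 * x^2 + μ) * W t x) + μ^2 * x^2 * (P * W t x)) -
        (-2 * μ * x * (P * (Wx t x + μ * x * W t x)) - μ * (P * W t x)) = P * (Wt t x - Wxx t x) by ring,
        show P * (Wx t x + μ * x * W t x) - μ * x * (P * W t x) = P * Wx t x by ring, abs_mul, abs_mul, abs_mul, abs_of_pos hP0]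
      have := mul_le_mul_of_nonneg_left (hF t ht x) hP0.le
      linarith
    have est := fun t (ht : t ∈ Ioo ta tb) =>
      slice_est hM hμ hR (hZ.supp t ht) (hZ.ends t ht).1 (hZ.ends t ht).2.1 (hZ.ends t ht).2.2.1 (hZ.ends t ht).2.2.2
        (hZ.dx t ht) (hZ.cx t ht) (hZ.cnt t ht).choose_spec.1 (fun x hx => ((hZ.cnt t ht).choose_spec.2 x hx).1)
        (hZ.BMxx t ht) (hZ.BMt t ht) (hFZ t ht) (hHp t ht)
    have o := ode_lem (fun t ht => hZ.hasDerivAt_H hR t ht) (fun t ht => hZ.hasDerivAt_N hR μ t ht) hHp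
      (fun t ht => (est t ht).1) (fun t ht => (est t ht).2.1) (fun t ht => (est t ht).2.2) (by positivity)
      (s0 := ta + d) (sm := ta + 2 * d) (s1 := ta + 3 * d) (by linarith) (by linarith) (by linarith) (by linarith)
    have m0 : ta + d ∈ Ioo ta tb := ⟨by linarith, by linarith⟩
    have m1 : ta + 2 * d ∈ Ioo ta tb := ⟨by linarith, by linarith⟩
    have l1 := log_le_log (hI _ m1) (hle _ m1)
    have l2 := log_le_log (hHp _ m0) (hge _ m0)
    rw [log_mul (exp_pos _).ne' (hI _ m0).ne', log_exp] at l2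
    rw [show ta + 3 * d - (ta + 2 * d) = d by ring, show ta + 2 * d - (ta + d) = d by ring] at o
    linarith
  obtain ⟨L, hL⟩ : ∃ L, L = |log (∫ x in (0:ℝ)..(R+1), W (ta + d) x ^ 2) - log (∫ x in (0:ℝ)..(R+1), W (ta + 2 * d) x ^ 2)| := ⟨_, rfl⟩
  have hL0 : 0 ≤ L := by rw [hL]; exact abs_nonneg _
  have hL1 := le_abs_self (log (∫ x in (0:ℝ)..(R+1), W (ta + d) x ^ 2) - log (∫ x in (0:ℝ)..(R+1), W (ta + 2 * d) x ^ 2))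
  rw [← hL] at hL1
  obtain ⟨a, ha⟩ : ∃ a, a = (R+1)^2 := ⟨_, rfl⟩
  obtain ⟨b, hb'⟩ : ∃ b, b = (R^2 + (R^2 + M^2 + 2 * M * R + 2 * M)) * d := ⟨_, rfl⟩
  obtain ⟨c, hc⟩ : ∃ c, c = 2 * d * d := ⟨_, rfl⟩
  have ha0 : 0 ≤ a := by rw [ha]; positivity
  have hb0 : 0 ≤ b := by rw [hb']; positivity
  have hc0 : 0 < c := by rw [hc]; positivity
  obtain ⟨μ, hμ⟩ : ∃ μ, μ = 2 * M^2 + 1 + (L + a + b) / c := ⟨_, rfl⟩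
  have hq : 0 ≤ (L + a + b) / c := by positivity
  have hμ1 : 1 ≤ μ := by rw [hμ]; nlinarith [sq_nonneg M]
  have k := key μ (by rw [hμ]; linarith)
  have k2 : c + (L + a + b) ≤ μ * c := by
    rw [hμ, add_mul, div_mul_cancel₀ _ hc0.ne']
    nlinarith [mul_nonneg (sq_nonneg M) hc0.le]
  have k3 : 0 ≤ L + μ * a + μ^2 * b - μ^2 * (μ * c) := by
    rw [ha, hb', hc]; linarith
  have k4 : μ^2 * (c + (L + a + b)) ≤ μ^2 * (μ * c) := mul_le_mul_of_nonneg_left k2 (sq_nonneg _)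
  have k5 : L ≤ μ^2 * L := le_mul_of_one_le_left hL0 (one_le_pow₀ hμ1)
  have k6 : μ * a ≤ μ^2 * a := mul_le_mul_of_nonneg_right (by nlinarith) ha0
  have k7 : 0 < μ^2 * c := by positivity
  linarith

section CutSec
variable {w wt wx wxx : ℝ → ℝ → ℝ} {σ : ℝ → ℝ} {t0 t1 B : ℝ}

open Classical in
noncomputable def cut (σ : ℝ → ℝ) (f : ℝ → ℝ → ℝ) (t x : ℝ) : ℝ := if σ t < x then f t x else 0

theorem cut_pos {f : ℝ → ℝ → ℝ} {t x : ℝ} (h : σ t < x) : cut σ f t x = f t x := if_pos h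
theorem cut_neg {f : ℝ → ℝ → ℝ} {t x : ℝ} (h : ¬ σ t < x) : cut σ f t x = 0 := if_neg h
theorem cut_abs (f : ℝ → ℝ → ℝ) (t x : ℝ) : |cut σ f t x| ≤ |f t x| := by
  unfold cut; split_ifs
  · exact le_rfl
  · simp

theorem cut_cont {f : ℝ → ℝ → ℝ} {t : ℝ} (hc : Continuous (f t)) (hz : f t (σ t) = 0) : Continuous (cut σ f t) := by
  have : cut σ f t = fun x => if x ≤ σ t then 0 else f t x := by
    funext x; unfold cut
    by_cases h : σ t < x
    · rw [if_pos h, if_neg (not_le.2 h)]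
    · rw [if_neg h, if_pos (not_lt.1 h)]
  rw [this]
  refine Continuous.if_le continuous_const hc continuous_id continuous_const ?_
  intro x hx; rw [hx, hz]

theorem cut_meas {f : ℝ → ℝ → ℝ} {t : ℝ} (hc : Continuous (f t)) : Measurable (cut σ f t) :=
  Measurable.ite measurableSet_Ioi hc.measurable measurable_const

theorem cut_deriv_ne {f g : ℝ → ℝ → ℝ} {t x : ℝ} (hd : HasDerivAt (f t) (g t x) x) (hx : x ≠ σ t) :
    HasDerivAt (cut σ f t) (cut σ g t x) x := by
  rcases lt_or_gt_of_ne hx with h | h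
  · rw [cut_neg (not_lt.2 h.le)]
    refine (hasDerivAt_const x (0:ℝ)).congr_of_eventuallyEq ?_
    filter_upwards [Iio_mem_nhds h] with y hy
    exact cut_neg (not_lt.2 (le_of_lt hy))
  · rw [cut_pos h]
    refine hd.congr_of_eventuallyEq ?_
    filter_upwards [Ioi_mem_nhds h] with y hy
    exact cut_pos hy

theorem zero_deriv_of_le {f g : ℝ → ℝ} {x : ℝ} (hf : HasDerivAt f 0 x) (h0 : f x = 0) (hle : ∀ y, |g y| ≤ |f y|) :
    HasDerivAt g 0 x := by
  have hg0 : g x = 0 := by have := hle x; rw [h0, abs_zero] at this; exact abs_eq_zero.1 (le_antisymm this (abs_nonneg _))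
  rw [hasDerivAt_iff_isLittleO] at *
  simp only [h0, hg0, smul_zero, sub_zero] at *
  exact (Asymptotics.IsBigO.of_bound 1 (Eventually.of_forall fun y => by
    rw [one_mul]; exact hle y)).trans_isLittleO hf

theorem cut_deriv {f g : ℝ → ℝ → ℝ} {t x : ℝ} (hd : HasDerivAt (f t) (g t x) x) (h0 : f t (σ t) = 0) (h1 : g t (σ t) = 0) :
    HasDerivAt (cut σ f t) (cut σ g t x) x := by
  by_cases hx : x = σ t
  · rw [cut_neg (by rw [hx]; exact lt_irrefl _)]
    rw [hx, h1] at hd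
    rw [hx]
    exact zero_deriv_of_le hd h0 (cut_abs f t)
  · exact cut_deriv_ne hd hx

theorem zero_cont_of_le {f g : ℝ → ℝ} {x : ℝ} (hf : ContinuousAt f x) (h0 : f x = 0) (hle : ∀ y, |g y| ≤ |f y|) :
    ContinuousAt g x := by
  have hg0 : g x = 0 := by have := hle x; rw [h0, abs_zero] at this; exact abs_eq_zero.1 (le_antisymm this (abs_nonneg _))
  unfold ContinuousAt at *
  rw [hg0]
  rw [h0] at hf
  exact squeeze_zero_norm (a := fun y => |f y|) (fun y => hle y) (by simpa using hf.abs)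

theorem line_t {f : ℝ → ℝ → ℝ} {t x : ℝ} (h : ContinuousAt (fun p : ℝ × ℝ => f p.1 p.2) (t, x)) :
    ContinuousAt (fun s => f s x) t := by
  have : ContinuousAt (fun s : ℝ => ((s, x) : ℝ × ℝ)) t := by fun_prop
  exact ContinuousAt.comp (g := fun p : ℝ × ℝ => f p.1 p.2) (f := fun s : ℝ => ((s, x) : ℝ × ℝ)) h this

theorem line_x {f : ℝ → ℝ → ℝ} {t : ℝ} (h : ∀ x, ContinuousAt (fun p : ℝ × ℝ => f p.1 p.2) (t, x)) :
    Continuous (f t) := by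
  refine continuous_iff_continuousAt.2 fun x => ?_
  have : ContinuousAt (fun s : ℝ => ((t, s) : ℝ × ℝ)) x := by fun_prop
  exact ContinuousAt.comp (g := fun p : ℝ × ℝ => f p.1 p.2) (f := fun s : ℝ => ((t, s) : ℝ × ℝ)) (h x) this

/-- hypotheses on the cutting curve -/
structure Curve (w wx : ℝ → ℝ → ℝ) (σ : ℝ → ℝ) (t0 t1 B : ℝ) : Prop where
  s1 : ∀ t ∈ Ioo t0 t1, w t (σ t) = 0
  s2 : ∀ t ∈ Ioo t0 t1, wx t (σ t) = 0
  s3 : ∀ t ∈ Ioo t0 t1, ∀ x, σ t < x → ∀ᶠ s in 𝓝 t, σ s < x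
  s4 : ∀ t ∈ Ioo t0 t1, ∀ t' ∈ Ioo t0 t1, ∀ x, σ t < x → x ≤ σ t' → ∃ τ ∈ uIcc t t', w τ x = 0
  s5 : ∀ t ∈ Ioo t0 t1, |σ t| ≤ B

theorem cut_lip (hw : Sol w wt wx wxx) (h0 : 0 < t0) (hc : Curve w wx σ t0 t1 B) {C : ℝ}
    (hC : ∀ t ∈ Icc t0 t1, ∀ x, |wt t x| ≤ C) {t t' : ℝ} (ht : t ∈ Ioo t0 t1) (ht' : t' ∈ Ioo t0 t1) (x : ℝ) :
    |cut σ w t x - cut σ w t' x| ≤ C * |t - t'| := by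
  have base : ∀ a ∈ Ioo t0 t1, ∀ b ∈ Ioo t0 t1, |w a x - w b x| ≤ C * |a - b| := by
    intro a ha b hb
    have := (convex_Ioo t0 t1).norm_image_sub_le_of_norm_hasDerivWithin_le (f := fun s => w s x) (f' := fun s => wt s x) (C := C)
      (fun s hs => (hw.dt s (h0.trans hs.1) x).hasDerivWithinAt) (fun s hs => hC s (Ioo_subset_Icc_self hs) x) hb ha
    exact this
  have one : ∀ a ∈ Ioo t0 t1, ∀ b ∈ Ioo t0 t1, σ a < x → ¬ σ b < x → |w a x| ≤ C * |a - b| := by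
    intro a ha b hb h1 h2
    obtain ⟨τ, hτ, hz⟩ := hc.s4 a ha b hb x h1 (not_lt.1 h2)
    have hτ' : τ ∈ Ioo t0 t1 := (ordConnected_Ioo.uIcc_subset ha hb) hτ
    have b1 := base a ha τ hτ'
    rw [hz, sub_zero] at b1
    refine b1.trans (mul_le_mul_of_nonneg_left ?_ ((abs_nonneg _).trans (hC a (Ioo_subset_Icc_self ha) x)))
    have := abs_sub_left_of_mem_uIcc hτ
    rwa [abs_sub_comm a τ, abs_sub_comm a b]
  by_cases h1 : σ t < x <;> by_cases h2 : σ t' < x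
  · rw [cut_pos h1, cut_pos h2]; exact base t ht t' ht'
  · rw [cut_pos h1, cut_neg h2, sub_zero]; exact one t ht t' ht' h1 h2
  · rw [cut_neg h1, cut_pos h2, zero_sub, abs_neg, abs_sub_comm]; exact one t' ht' t ht h2 h1
  · rw [cut_neg h1, cut_neg h2, sub_zero, abs_zero]
    exact mul_nonneg ((abs_nonneg _).trans (hC t (Ioo_subset_Icc_self ht) x)) (abs_nonneg _)

theorem cut_cnt (hw : Sol w wt wx wxx) (h0 : 0 < t0) (hc : Curve w wx σ t0 t1 B) {t : ℝ} (ht : t ∈ Ioo t0 t1) :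
    ∃ S : Set ℝ, S.Countable ∧ ∀ x, x ∉ S → HasDerivAt (cut σ wx t) (cut σ wxx t x) x ∧
    HasDerivAt (fun s => cut σ w s x) (cut σ wt t x) t ∧ ContinuousAt (fun s => cut σ wxx s x) t ∧
    ContinuousAt (fun s => cut σ wx s x) t := by
  have htp : 0 < t := h0.trans ht.1
  obtain ⟨Q, hQ⟩ : ∃ Q : ℝ → Prop, ∀ x, Q x ↔ (x < σ t ∧ ∃ᶠ s in 𝓝 t, σ s < x) := ⟨_, fun _ => Iff.rfl⟩
  have hQz : ∀ x, Q x → w t x = 0 := by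
    intro x hx
    obtain ⟨hx1, hx2⟩ := (hQ x).1 hx
    by_contra hne
    have hcw := line_t (hw.c0 t htp x)
    have e1 := hcw.eventually_ne hne
    rw [Metric.eventually_nhds_iff] at e1
    obtain ⟨ε, hε, he⟩ := e1
    have e2 : ∀ᶠ s in 𝓝 t, s ∈ Ioo t0 t1 ∧ dist s t < ε :=
      (eventually_mem_set.2 (Ioo_mem_nhds ht.1 ht.2)).and (eventually_mem_set.2 (Metric.ball_mem_nhds t hε))
    obtain ⟨s, hs, hs1, hs2⟩ := (hx2.and_eventually e2).exists
    obtain ⟨τ, hτ, hz⟩ := hc.s4 s hs1 t ht x hs hx1.le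
    refine he ?_ hz
    rw [Real.dist_eq] at *
    refine lt_of_le_of_lt ?_ hs2
    have := abs_sub_right_of_mem_uIcc hτ
    rwa [abs_sub_comm τ t, abs_sub_comm s t]
  have hQup : ∀ x y, Q x → x ≤ y → y < σ t → Q y := fun x y hx hxy hy =>
    (hQ y).2 ⟨hy, ((hQ x).1 hx).2.mono fun s hs => hs.trans_le hxy⟩
  refine ⟨{σ t} ∪ {x | Q x ∧ ∀ y < x, ¬ Q y}, (countable_singleton _).union (Set.Subsingleton.countable ?_), ?_⟩
  · intro x hx y hy
    by_contra hne
    rcases lt_or_gt_of_ne hne with h | h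
    · exact hy.2 x h hx.1
    · exact hx.2 y h hy.1
  intro x hx
  have hx1 : x ≠ σ t := fun h => hx (Or.inl h)
  refine ⟨cut_deriv_ne (hw.dxx t htp x) hx1, ?_⟩
  have hcxx := line_t (hw.cxx t htp x)
  have hcx := line_t (hw.cx t htp x)
  rcases lt_or_gt_of_ne hx1 with h | h
  · have hn : ¬ σ t < x := not_lt.2 h.le
    by_cases hQx : Q x
    · obtain ⟨y, hyx, hy⟩ : ∃ y < x, Q y := by
        by_contra hcon
        push Not at hcon
        exact hx (Or.inr ⟨hQx, hcon⟩)
      have hnb : Ioo y (σ t) ∈ 𝓝 x := Ioo_mem_nhds hyx h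
      have z0 : ∀ z ∈ Ioo y (σ t), w t z = 0 := fun z hz => hQz z (hQup y z hy hz.1.le hz.2)
      have z1 : ∀ z ∈ Ioo y (σ t), wx t z = 0 := fun z hz => by
        refine (hw.dx t htp z).unique ((hasDerivAt_const z (0:ℝ)).congr_of_eventuallyEq ?_)
        filter_upwards [Ioo_mem_nhds hz.1 hz.2] with v hv using z0 v hv
      have z2 : wxx t x = 0 := by
        refine (hw.dxx t htp x).unique ((hasDerivAt_const x (0:ℝ)).congr_of_eventuallyEq ?_)
        filter_upwards [hnb] with v hv using z1 v hv
      have y0 := z0 x ⟨hyx, h⟩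
      have y1 := z1 x ⟨hyx, h⟩
      have z3 : wt t x = 0 := by
        obtain ⟨M, _, hM⟩ := hw.bd t htp
        have := hM t le_rfl x
        rw [z2, y0, y1, abs_zero, add_zero, mul_zero, sub_zero] at this
        exact abs_eq_zero.1 (le_antisymm this (abs_nonneg _))
      refine ⟨?_, zero_cont_of_le hcxx z2 fun s => cut_abs wxx s x, zero_cont_of_le hcx y1 fun s => cut_abs wx s x⟩
      rw [cut_neg hn]
      have := hw.dt t htp x
      rw [z3] at this
      exact zero_deriv_of_le this y0 fun s => cut_abs w s x
    · have hev : ∀ᶠ s in 𝓝 t, ¬ σ s < x := by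
        have : ¬ ∃ᶠ s in 𝓝 t, σ s < x := fun hf => hQx ((hQ x).2 ⟨h, hf⟩)
        exact not_frequently.1 this
      have ez : ∀ f : ℝ → ℝ → ℝ, (fun s => cut σ f s x) =ᶠ[𝓝 t] fun _ => 0 := fun f => by
        filter_upwards [hev] with s hs using cut_neg hs
      refine ⟨?_, continuousAt_const.congr (ez wxx).symm, continuousAt_const.congr (ez wx).symm⟩
      rw [cut_neg hn]
      exact (hasDerivAt_const t (0:ℝ)).congr_of_eventuallyEq (ez w)
  · have hev := hc.s3 t ht x h
    have ez : ∀ f : ℝ → ℝ → ℝ, (fun s => cut σ f s x) =ᶠ[𝓝 t] fun s => f s x := fun f => by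
      filter_upwards [hev] with s hs using cut_pos hs
    refine ⟨?_, hcxx.congr (ez wxx).symm, hcx.congr (ez wx).symm⟩
    rw [cut_pos h]
    exact (hw.dt t htp x).congr_of_eventuallyEq (ez w)

end CutSec

theorem cut_case {σ : ℝ → ℝ} {t a : ℝ} (x : ℝ) :
    (σ t < x - a ∧ x - a ≤ σ t + 2 * π ∧ ∀ f, cut σ f t (x - a) - cut σ f t (x - (a + 2 * π)) = f t (x - a)) ∨
    (∀ f : ℝ → ℝ → ℝ, (∀ y, f t (y + 2 * π) = f t y) → cut σ f t (x - a) - cut σ f t (x - (a + 2 * π)) = 0) := by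
  have hpi := pi_pos
  by_cases h1 : σ t < x - a
  · by_cases h2 : x - a ≤ σ t + 2 * π
    · refine Or.inl ⟨h1, h2, fun f => ?_⟩
      rw [cut_pos h1, cut_neg (not_lt.2 (by linarith)), sub_zero]
    · refine Or.inr fun f hf => ?_
      push Not at h2
      rw [cut_pos h1, cut_pos (by linarith), sub_eq_zero, ← hf (x - (a + 2 * π))]
      congr 1; ring
  · refine Or.inr fun f hf => ?_
    rw [cut_neg h1, cut_neg (not_lt.2 (by linarith)), sub_zero]

theorem no_curve {w wt wx wxx : ℝ → ℝ → ℝ} {σ : ℝ → ℝ} {t0 t1 B : ℝ} (hw : Sol w wt wx wxx) (h0 : 0 < t0) (h01 : t0 < t1)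
    (hdist : ∀ t > 0, ∃ x, w t x ≠ 0) (hB : 0 ≤ B) (hc : Curve w wx σ t0 t1 B) : False := by
  obtain ⟨C0, hC0, B0⟩ := Sol.bound_aux hw.c0 hw.per t0 t1 h0
  obtain ⟨C1, hC1, B1⟩ := Sol.bound_aux hw.ct hw.pert t0 t1 h0
  obtain ⟨C2, hC2, B2⟩ := Sol.bound_aux hw.cx hw.perx t0 t1 h0
  obtain ⟨C3, hC3, B3⟩ := Sol.bound_aux hw.cxx hw.perxx t0 t1 h0
  obtain ⟨M, hM, hbd⟩ := hw.bd t0 h0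
  have hpi := pi_pos
  obtain ⟨C, hC⟩ : ∃ C, C = C0 + 2 * C1 + C2 + C3 := ⟨_, rfl⟩
  obtain ⟨a, ha⟩ : ∃ a, a = B + 1 := ⟨_, rfl⟩
  obtain ⟨R, hR⟩ : ∃ R, R = 2 * B + 1 + 2 * π := ⟨_, rfl⟩
  have hsub : Ioo t0 t1 ⊆ Icc t0 t1 := Ioo_subset_Icc_self
  have hp : ∀ t ∈ Ioo t0 t1, 0 < t := fun t ht => h0.trans ht.1
  have hR1 : 1 ≤ R := by rw [hR]; linarith
  have cs : ∀ t ∈ Ioo t0 t1, ∀ x, (1 ≤ x ∧ x ≤ R ∧ ∀ f, cut σ f t (x - a) - cut σ f t (x - (a + 2 * π)) = f t (x - a)) ∨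
    (∀ f : ℝ → ℝ → ℝ, (∀ y, f t (y + 2 * π) = f t y) → cut σ f t (x - a) - cut σ f t (x - (a + 2 * π)) = 0) := by
    intro t ht x
    have := abs_le.1 (hc.s5 t ht)
    rcases cut_case (σ := σ) (t := t) (a := a) x with ⟨h1, h2, h3⟩ | h
    · exact Or.inl ⟨by linarith, by linarith, h3⟩
    · exact Or.inr h
  have bnd : ∀ f : ℝ → ℝ → ℝ, (∀ t > 0, ∀ y, f t (y + 2 * π) = f t y) → (∀ t ∈ Icc t0 t1, ∀ x, |f t x| ≤ C) →
      ∀ t ∈ Ioo t0 t1, ∀ x, |cut σ f t (x - a) - cut σ f t (x - (a + 2 * π))| ≤ C := by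
    intro f hf hb t ht x
    rcases cs t ht x with ⟨_, _, h⟩ | h
    · rw [h]; exact hb t (hsub ht) _
    · rw [h f (hf t (hp t ht)), abs_zero]; rw [hC]; positivity
  have sup : ∀ f : ℝ → ℝ → ℝ, (∀ t > 0, ∀ y, f t (y + 2 * π) = f t y) →
      ∀ t ∈ Ioo t0 t1, ∀ x, cut σ f t (x - a) - cut σ f t (x - (a + 2 * π)) ≠ 0 → 1 ≤ x ∧ x ≤ R := by
    intro f hf t ht x hx
    rcases cs t ht x with ⟨h1, h2, _⟩ | h
    · exact ⟨h1, h2⟩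
    · exact absurd (h f (hf t (hp t ht))) hx
  have slab : Slab (fun t x => cut σ w t (x - a) - cut σ w t (x - (a + 2 * π)))
      (fun t x => cut σ wt t (x - a) - cut σ wt t (x - (a + 2 * π)))
      (fun t x => cut σ wx t (x - a) - cut σ wx t (x - (a + 2 * π)))
      (fun t x => cut σ wxx t (x - a) - cut σ wxx t (x - (a + 2 * π))) t0 t1 R C := by
    refine ⟨sup w hw.per, sup wx hw.perx, ?_, ?_, ?_, ?_, ?_, ?_, ?_, ?_, ?_⟩
    · exact fun t ht x _ => bnd w hw.per (fun t ht x => (B0 t ht x).trans (by rw [hC]; linarith)) t ht x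
    · exact fun t ht x _ => bnd wt hw.pert (fun t ht x => (B1 t ht x).trans (by rw [hC]; linarith)) t ht x
    · exact fun t ht x _ => bnd wxx hw.perxx (fun t ht x => (B3 t ht x).trans (by rw [hC]; linarith)) t ht x
    · intro t ht x
      have d := fun y => cut_deriv (σ := σ) (hw.dx t (hp t ht) y) (hc.s1 t ht) (hc.s2 t ht)
      exact ((d (x - a)).comp_sub_const x a).fun_sub ((d (x - (a + 2 * π))).comp_sub_const x (a + 2 * π))
    · intro t ht
      have := cut_cont (line_x (hw.cx t (hp t ht))) (hc.s2 t ht)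
      exact (this.comp (continuous_sub_right a)).sub (this.comp (continuous_sub_right (a + 2 * π)))
    · intro t ht
      have := cut_meas (σ := σ) (line_x (hw.ct t (hp t ht)))
      exact (this.comp (measurable_id.sub_const a)).sub (this.comp (measurable_id.sub_const (a + 2 * π)))
    · intro t ht
      have := cut_meas (σ := σ) (line_x (hw.cxx t (hp t ht)))
      exact (this.comp (measurable_id.sub_const a)).sub (this.comp (measurable_id.sub_const (a + 2 * π)))
    · intro t ht t' ht' x _
      have l1 := cut_lip hw h0 hc B1 ht ht' (x - a)
      have l2 := cut_lip hw h0 hc B1 ht ht' (x - (a + 2 * π))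
      rw [sub_sub_sub_comm]
      refine (abs_sub _ _).trans ((add_le_add l1 l2).trans ?_)
      rw [← add_mul]
      exact mul_le_mul_of_nonneg_right (by rw [hC]; linarith) (abs_nonneg _)
    · intro t ht
      obtain ⟨S, hS, hS'⟩ := cut_cnt hw h0 hc ht
      refine ⟨(fun x => x + a) '' S ∪ (fun x => x + (a + 2 * π)) '' S, (hS.image _).union (hS.image _), fun x hx => ?_⟩
      have m1 : x - a ∉ S := fun h => hx (Or.inl ⟨x - a, h, by ring⟩)
      have m2 : x - (a + 2 * π) ∉ S := fun h => hx (Or.inr ⟨x - (a + 2 * π), h, by ring⟩)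
      obtain ⟨p1, p2, p3, p4⟩ := hS' _ m1
      obtain ⟨q1, q2, q3, q4⟩ := hS' _ m2
      exact ⟨(p1.comp_sub_const x a).fun_sub (q1.comp_sub_const x (a + 2 * π)), p2.fun_sub q2, p3.sub q3, p4.sub q4⟩
  refine carleman h01 slab hR1 (by rw [hC]; positivity) hM ?_ ?_ ?_
  · exact fun t ht x _ => bnd wx hw.perx (fun t ht x => (B2 t ht x).trans (by rw [hC]; linarith)) t ht x
  · intro t ht x
    rcases cs t ht x with ⟨_, _, h⟩ | h
    · simp only [h]; exact hbd t ht.1.le _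
    · simp only [h _ (hw.per t (hp t ht)), h _ (hw.perx t (hp t ht)), h _ (hw.perxx t (hp t ht)), h _ (hw.pert t (hp t ht))]
      simp
  · intro t ht
    have hcont := slab.c0 t ht
    obtain ⟨y, hy⟩ := hdist t (hp t ht)
    obtain ⟨x, hx, hx0⟩ : ∃ x, x ∈ Ioc (σ t) (σ t + 2 * π) ∧ w t x ≠ 0 := by
      have hper : Function.Periodic (w t) (2 * π) := hw.per t (hp t ht)
      obtain ⟨x, hx, hxy⟩ := hper.exists_mem_Ioc (by positivity) y (σ t)
      exact ⟨x, hx, by rwa [← hxy]⟩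
    have := abs_le.1 (hc.s5 t ht)
    refine intervalIntegral.integral_pos (by linarith) (hcont.pow 2).continuousOn (fun _ _ => sq_nonneg _) ⟨x + a, ⟨by linarith [hx.1], by linarith [hx.2]⟩, ?_⟩
    have e : cut σ w t (x + a - a) - cut σ w t (x + a - (a + 2 * π)) = w t x := by
      rw [add_sub_cancel_right, cut_pos hx.1, cut_neg (not_lt.2 (by linarith [hx.2])), sub_zero]
    simp only [e]
    positivity

theorem path_order {γ δ : ℝ → ℝ} {t0 t1 : ℝ} (hγ : Continuous γ) (hδ : Continuous δ)
    (h : ∀ s ∈ Icc t0 t1, γ s ≠ δ s) (h1 : γ t1 < δ t1) : ∀ s ∈ Icc t0 t1, γ s < δ s := by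
  intro s hs
  by_contra hc
  push Not at hc
  have hf : ContinuousOn (fun r => δ r - γ r) (Icc s t1) := (hδ.sub hγ).continuousOn
  have := intermediate_value_Icc hs.2 hf
  obtain ⟨r, hr, hr0⟩ := this (show (0:ℝ) ∈ Icc (δ s - γ s) (δ t1 - γ t1) from ⟨by linarith, by linarith⟩)
  exact h r ⟨hs.1.trans hr.1, hr.2⟩ (by simp only at hr0; linarith)

theorem sgn_cases (j : ℕ) : ((-1:ℝ)^j = 1 ∧ (-1:ℝ)^(j+1) = -1) ∨ ((-1:ℝ)^j = -1 ∧ (-1:ℝ)^(j+1) = 1) := by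
  rcases neg_one_pow_eq_or ℝ j with h | h
  · exact Or.inl ⟨h, by rw [pow_succ, h]; norm_num⟩
  · exact Or.inr ⟨h, by rw [pow_succ, h]; norm_num⟩

theorem path_sgn {w wt wx wxx : ℝ → ℝ → ℝ} (hw : Sol w wt wx wxx) {t0 t1 : ℝ} (h0 : 0 < t0) (h01 : t0 ≤ t1) {p : ℝ} (j : ℕ)
    (hp : 0 < (-1)^j * w t1 p) : ∃ γ : ℝ → ℝ, Continuous γ ∧ γ t1 = p ∧ ∀ s ∈ Icc t0 t1, 0 < (-1)^j * w s (γ s) := by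
  rcases neg_one_pow_eq_or ℝ j with h | h
  · rw [h, one_mul] at hp
    obtain ⟨γ, a, b, c⟩ := path_pos hw h0 h01 hp
    exact ⟨γ, a, b, fun s hs => by rw [h, one_mul]; exact c s hs⟩
  · rw [h, neg_one_mul, neg_pos] at hp
    obtain ⟨γ, a, b, c⟩ := path_neg hw h0 h01 hp
    exact ⟨γ, a, b, fun s hs => by rw [h, neg_one_mul, neg_pos]; exact c s hs⟩

theorem no_accum {w wt wx wxx : ℝ → ℝ → ℝ} {t1 xs : ℝ} (hw : Sol w wt wx wxx) (h1 : 0 < t1)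
    (hdist : ∀ t > 0, ∃ x, w t x ≠ 0) (hpos : ∀ y > xs, ∃ x ∈ Ioo xs y, 0 < w t1 x) (hneg : ∀ y > xs, ∃ x ∈ Ioo xs y, w t1 x < 0) :
    False := by
  have hpi := pi_pos
  have hF : ∀ (j : ℕ) (y : ℝ), ∃ x, xs < y → x ∈ Ioo xs y ∧ 0 < (-1)^j * w t1 x := by
    intro j y
    by_cases hy : xs < y
    · rcases neg_one_pow_eq_or ℝ j with h | h <;> rw [h]
      · obtain ⟨x, a, b⟩ := hpos y hy
        exact ⟨x, fun _ => ⟨a, by linarith⟩⟩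
      · obtain ⟨x, a, b⟩ := hneg y hy
        exact ⟨x, fun _ => ⟨a, by linarith⟩⟩
    · exact ⟨0, fun h => absurd h hy⟩
  choose F hF using hF
  obtain ⟨p, p0, ps⟩ : ∃ p : ℕ → ℝ, p 0 = F 0 (xs + 2 * π) ∧ ∀ n, p (n+1) = F (n+1) (p n) :=
    ⟨fun n => Nat.rec (F 0 (xs + 2 * π)) (fun n y => F (n+1) y) n, rfl, fun _ => rfl⟩
  have hp1 : ∀ n, xs < p n ∧ 0 < (-1)^n * w t1 (p n) := by
    intro n
    induction n with
    | zero => rw [p0]; have := hF 0 (xs + 2 * π) (by linarith); exact ⟨this.1.1, this.2⟩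
    | succ n ih => rw [ps]; have := hF (n+1) (p n) ih.1; exact ⟨this.1.1, this.2⟩
  have hp2 : ∀ n, p (n+1) < p n := fun n => by rw [ps]; exact (hF (n+1) (p n) (hp1 n).1).1.2
  have hp3 : p 0 < xs + 2 * π := by rw [p0]; exact (hF 0 (xs + 2 * π) (by linarith)).1.2
  obtain ⟨t0, ht0⟩ : ∃ t0, t0 = t1 / 2 := ⟨_, rfl⟩
  have h0 : 0 < t0 := by rw [ht0]; linarith
  have h01 : t0 < t1 := by rw [ht0]; linarith
  choose γ hγc hγ1 hγ using fun n => path_sgn hw h0 h01.le n (hp1 n).2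
  have ord : ∀ n, ∀ s ∈ Icc t0 t1, γ (n+1) s < γ n s := by
    intro n
    refine path_order (hγc _) (hγc _) (fun s hs e => ?_) (by rw [hγ1, hγ1]; exact hp2 n)
    have a := hγ n s hs
    have b := hγ (n+1) s hs
    rw [e, pow_succ] at b; linarith
  have hodd : ∀ m, ∀ s ∈ Icc t0 t1, γ 0 s - 2 * π < γ (2*m+1) s := by
    intro m
    refine path_order ((hγc _).sub continuous_const) (hγc _) (fun s hs e => ?_) (by rw [hγ1, hγ1]; linarith [(hp1 (2*m+1)).1])
    have a := hγ 0 s hs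
    have b := hγ (2*m+1) s hs
    have hper := hw.per s (h0.trans_le hs.1) (γ 0 s - 2 * π)
    rw [sub_add_cancel] at hper
    rw [← e, ← hper, pow_succ, pow_mul] at b
    norm_num at a b
    linarith
  have anti : ∀ s ∈ Icc t0 t1, StrictAnti (fun n => γ n s) := fun s hs => strictAnti_nat_of_succ_lt fun n => ord n s hs
  have low : ∀ n, ∀ s ∈ Icc t0 t1, γ 0 s - 2 * π < γ n s := fun n s hs =>
    (hodd n s hs).trans_le ((anti s hs).antitone (by omega))
  have bb : ∀ s ∈ Icc t0 t1, BddBelow (range fun n => γ n s) := fun s hs =>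
    ⟨γ 0 s - 2 * π, by rintro _ ⟨n, rfl⟩; exact (low n s hs).le⟩
  obtain ⟨σ, hσ⟩ : ∃ σ : ℝ → ℝ, ∀ s, σ s = ⨅ n, γ n s := ⟨_, fun _ => rfl⟩
  have slt : ∀ s ∈ Icc t0 t1, ∀ n, σ s < γ n s := fun s hs n => by
    rw [hσ]; exact (ciInf_le (bb s hs) (n+1)).trans_lt (ord n s hs)
  have sge : ∀ s ∈ Icc t0 t1, γ 0 s - 2 * π ≤ σ s := fun s hs => by
    rw [hσ]; exact le_ciInf fun n => (low n s hs).le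
  have stend : ∀ s ∈ Icc t0 t1, Tendsto (fun n => γ n s) atTop (𝓝 (σ s)) := fun s hs => by
    rw [hσ]; exact tendsto_atTop_ciInf (anti s hs).antitone (bb s hs)
  have sex : ∀ s x, σ s < x → ∃ n, γ n s < x := fun s x h => by
    rw [hσ] at h; exact exists_lt_of_ciInf_lt h
  have alt0 : ∀ (u : ℕ → ℝ) (l : ℝ), Tendsto u atTop (𝓝 l) → (∀ n, 0 < (-1)^n * u n) → l = 0 := by
    intro u l hu hs
    have e : Tendsto (fun n : ℕ => 2 * n) atTop atTop := tendsto_id.const_mul_atTop' (by norm_num)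
    have a := ge_of_tendsto' (hu.comp e) (b := 0) fun n => by
      have := hs (2*n); rw [pow_mul] at this; norm_num at this; exact this.le
    have b := le_of_tendsto' (hu.comp (tendsto_add_atTop_nat 1 |>.comp e)) (b := 0) fun n => by
      have := hs (2*n+1); rw [pow_succ, pow_mul] at this; norm_num at this; exact this.le
    exact le_antisymm b a
  have s1 : ∀ t ∈ Icc t0 t1, w t (σ t) = 0 := fun t ht =>
    alt0 _ _ (((hw.cont_x t (h0.trans_le ht.1)).tendsto (σ t)).comp (stend t ht)) fun n => hγ n t ht
  obtain ⟨B1, hB1⟩ := isCompact_Icc.exists_bound_of_continuousOn (s := Icc t0 t1) (hγc 0).continuousOn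
  have hB0 : 0 ≤ B1 := (norm_nonneg _).trans (hB1 t0 ⟨le_rfl, h01.le⟩)
  have hcurve : Curve w wx σ t0 t1 (B1 + 2 * π) := by
    refine ⟨fun t ht => s1 t (Ioo_subset_Icc_self ht), fun t ht => ?_, fun t ht x hx => ?_, fun t ht t' ht' x hx hx' => ?_, fun t ht => ?_⟩
    · have ht' := Ioo_subset_Icc_self ht
      have hd := hasDerivAt_iff_tendsto_slope.1 (hw.dx t (h0.trans ht.1) (σ t))
      have ht2 : Tendsto (fun n => γ n t) atTop (𝓝[≠] (σ t)) :=
        tendsto_nhdsWithin_iff.2 ⟨stend t ht', Eventually.of_forall fun n => (slt t ht' n).ne'⟩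
      refine alt0 _ _ (hd.comp ht2) fun n => ?_
      simp only [Function.comp]
      rw [slope_def_field, s1 t ht', sub_zero, ← mul_div_assoc]
      exact div_pos (hγ n t ht') (by linarith [slt t ht' n])
    · obtain ⟨n, hn⟩ := sex t x hx
      filter_upwards [Ioo_mem_nhds ht.1 ht.2, (hγc n).continuousAt.eventually_lt_const hn] with s hs hs2
      exact (slt s (Ioo_subset_Icc_self hs) n).trans hs2
    · obtain ⟨n, hn⟩ := sex t x hx
      have hsub : uIcc t t' ⊆ Icc t0 t1 := (ordConnected_Icc.uIcc_subset (Ioo_subset_Icc_self ht) (Ioo_subset_Icc_self ht'))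
      have hn1 : γ (n+1) t < x := (ord n t (Ioo_subset_Icc_self ht)).trans hn
      have ivt : ∀ m, γ m t < x → ∃ τ ∈ uIcc t t', γ m τ = x := by
        intro m hm
        have hx2 : x ≤ γ m t' := hx'.trans (slt t' (Ioo_subset_Icc_self ht') m).le
        exact intermediate_value_uIcc (hγc m).continuousOn (by rw [uIcc_of_le (hm.le.trans hx2)]; exact ⟨hm.le, hx2⟩)
      obtain ⟨τ1, m1, e1⟩ := ivt n hn
      obtain ⟨τ2, m2, e2⟩ := ivt (n+1) hn1
      have g1 := hγ n τ1 (hsub m1)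
      have g2 := hγ (n+1) τ2 (hsub m2)
      rw [e1] at g1
      rw [e2] at g2
      have hss : uIcc τ1 τ2 ⊆ uIcc t t' := uIcc_subset_uIcc m1 m2
      have cw : ContinuousOn (fun s => (-1)^n * w s x) (uIcc τ1 τ2) := fun s hs =>
        (continuousAt_const.mul (line_t (hw.c0 s (h0.trans_le (hsub (hss hs)).1) x))).continuousWithinAt
      have hz : (0:ℝ) ∈ uIcc ((-1)^n * w τ1 x) ((-1)^n * w τ2 x) := by
        rw [pow_succ] at g2
        rw [uIcc_of_ge (by linarith)]
        exact ⟨by linarith, by linarith⟩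
      obtain ⟨τ, hτ, hz⟩ := intermediate_value_uIcc cw hz
      refine ⟨τ, hss hτ, ?_⟩
      rcases mul_eq_zero.1 hz with h | h
      · exact absurd h (pow_ne_zero _ (by norm_num))
      · exact h
    · have ht' := Ioo_subset_Icc_self ht
      have := abs_le.1 (hB1 t ht')
      rw [abs_le]
      exact ⟨by linarith [sge t ht', this.1], by linarith [slt t ht' 0, this.2]⟩
  exact no_curve hw h0 h01 hdist (by positivity) hcurve

theorem no_accum_left {w wt wx wxx : ℝ → ℝ → ℝ} {t1 xs : ℝ} (hw : Sol w wt wx wxx) (h1 : 0 < t1)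
    (hdist : ∀ t > 0, ∃ x, w t x ≠ 0) (hpos : ∀ y < xs, ∃ x ∈ Ioo y xs, 0 < w t1 x) (hneg : ∀ y < xs, ∃ x ∈ Ioo y xs, w t1 x < 0) :
    False := by
  refine no_accum (xs := -xs) hw.refl h1 (fun t ht => ?_) (fun y hy => ?_) (fun y hy => ?_)
  · obtain ⟨x, hx⟩ := hdist t ht
    exact ⟨-x, by simpa using hx⟩
  · obtain ⟨x, hx, h⟩ := hpos (-y) (by linarith)
    exact ⟨-x, ⟨by linarith [hx.2], by linarith [hx.1]⟩, by simpa using h⟩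
  · obtain ⟨x, hx, h⟩ := hneg (-y) (by linarith)
    exact ⟨-x, ⟨by linarith [hx.2], by linarith [hx.1]⟩, by simpa using h⟩

def Alt (f : ℝ → ℝ) (k : ℕ) (p : ℕ → ℝ) : Prop :=
  (∀ j < 2 * k, p j < p (j+1)) ∧ p (2 * k) = p 0 + 2 * π ∧ ∀ j ≤ 2 * k, 0 < (-1)^j * f (p j)

theorem alt_mono {p : ℕ → ℝ} {n : ℕ} (h : ∀ j < n, p j < p (j+1)) : ∀ i j, i < j → j ≤ n → p i < p j := by
  intro i j hij
  induction j with
  | zero => omega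
  | succ j ih =>
    intro hj
    rcases Nat.lt_succ_iff_lt_or_eq.1 hij with h1 | h1
    · exact (ih h1 (by omega)).trans (h j (by omega))
    · rw [h1]; exact h j (by omega)

theorem alt_one {f : ℝ → ℝ} {q : ℕ → ℝ} {N : ℕ} {s : Set ℝ} (hs : s.OrdConnected)
    (hsgn : (∀ z ∈ s, 0 ≤ f z) ∨ (∀ z ∈ s, f z ≤ 0))
    (hq : ∀ i j, i < j → j < N → q i < q j) (ha : ∀ j < N, 0 < (-1)^j * f (q j)) (i j : ℕ) (hi : i < N) (hj : j < N)
    (h1 : q i ∈ s) (h2 : q j ∈ s) : i = j := by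
  wlog hij : i < j generalizing i j
  · rcases Nat.lt_trichotomy i j with h | h | h
    · exact this i j hi hj h1 h2 h
    · exact h
    · exact (this j i hj hi h2 h1 h).symm
  exfalso
  have h3 : q (i+1) ∈ s := by
    rcases Nat.lt_or_ge (i+1) j with h | h
    · exact hs.out h1 h2 ⟨(hq i (i+1) (by omega) (by omega)).le, (hq (i+1) j h hj).le⟩
    · rwa [show i + 1 = j by omega]
  have a := ha i hi
  have b := ha (i+1) (by omega)
  rcases sgn_cases i with ⟨e1, e2⟩ | ⟨e1, e2⟩ <;> rw [e1] at a <;> rw [e2] at b <;>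
    rcases hsgn with h | h <;> linarith [h _ h1, h _ h3]

theorem cnt_fin (q : ℕ → ℝ) (N : ℕ) (s : Set ℝ) : {j | j < N ∧ q j ∈ s}.Finite :=
  (Set.finite_lt_nat N).subset fun _ h => h.1

theorem count_bdd {f : ℝ → ℝ}
    (hr : ∀ x, ∃ y > x, (∀ z ∈ Ioo x y, 0 ≤ f z) ∨ (∀ z ∈ Ioo x y, f z ≤ 0))
    (hl : ∀ x, ∃ y < x, (∀ z ∈ Ioo y x, 0 ≤ f z) ∨ (∀ z ∈ Ioo y x, f z ≤ 0)) {s : Set ℝ} (hs : IsCompact s) :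
    ∃ n : ℕ, ∀ (N : ℕ) (q : ℕ → ℝ), (∀ i j, i < j → j < N → q i < q j) → (∀ j < N, 0 < (-1)^j * f (q j)) →
      {j | j < N ∧ q j ∈ s}.ncard ≤ n := by
  refine hs.induction_on (p := fun s => ∃ n : ℕ, ∀ (N : ℕ) (q : ℕ → ℝ), (∀ i j, i < j → j < N → q i < q j) → (∀ j < N, 0 < (-1)^j * f (q j)) →
      {j | j < N ∧ q j ∈ s}.ncard ≤ n) ?_ ?_ ?_ ?_
  · exact ⟨0, fun N q _ _ => by simp⟩
  · rintro s t hst ⟨n, hn⟩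
    refine ⟨n, fun N q h1 h2 => (Set.ncard_le_ncard ?_ (cnt_fin q N t)).trans (hn N q h1 h2)⟩
    exact fun j hj => ⟨hj.1, hst hj.2⟩
  · rintro s t ⟨n, hn⟩ ⟨m, hm⟩
    refine ⟨n + m, fun N q h1 h2 => ?_⟩
    have : {j | j < N ∧ q j ∈ s ∪ t} = {j | j < N ∧ q j ∈ s} ∪ {j | j < N ∧ q j ∈ t} := by
      ext j; simp only [mem_union, mem_ofPred_eq]; tauto
    rw [this]
    exact (Set.ncard_union_le _ _).trans (add_le_add (hn N q h1 h2) (hm N q h1 h2))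
  · intro x _
    obtain ⟨y, hy, hy'⟩ := hr x
    obtain ⟨z, hz, hz'⟩ := hl x
    refine ⟨Ioo z y, mem_nhdsWithin_of_mem_nhds (Ioo_mem_nhds hz hy), 3, fun N q h1 h2 => ?_⟩
    have sub : {j | j < N ∧ q j ∈ Ioo z y} ⊆ {j | j < N ∧ q j ∈ Ioo z x} ∪
        ({j | j < N ∧ q j ∈ Icc x x} ∪ {j | j < N ∧ q j ∈ Ioo x y}) := by
      rintro j ⟨hN, h3, h4⟩
      rcases lt_trichotomy (q j) x with h | h | h
      · exact Or.inl ⟨hN, h3, h⟩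
      · exact Or.inr (Or.inl ⟨hN, h.ge, h.le⟩)
      · exact Or.inr (Or.inr ⟨hN, h, h4⟩)
    have c1 : ∀ s : Set ℝ, s.OrdConnected → ((∀ z ∈ s, 0 ≤ f z) ∨ (∀ z ∈ s, f z ≤ 0)) → {j | j < N ∧ q j ∈ s}.ncard ≤ 1 := by
      intro s hs hsg
      refine (Set.ncard_le_one (cnt_fin q N s)).2 fun i hi j hj => ?_
      exact alt_one hs hsg h1 h2 i j hi.1 hj.1 hi.2 hj.2
    have e1 := c1 _ ordConnected_Ioo hz'
    have e2 := c1 (Icc x x) ordConnected_Icc (by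
      rcases le_total 0 (f x) with h | h
      · exact Or.inl fun v hv => by rw [Icc_self] at hv; rwa [hv]
      · exact Or.inr fun v hv => by rw [Icc_self] at hv; rwa [hv])
    have e3 := c1 _ ordConnected_Ioo hy'
    have u1 := Set.ncard_union_le {j | j < N ∧ q j ∈ Icc x x} {j | j < N ∧ q j ∈ Ioo x y}
    have u2 := Set.ncard_union_le {j | j < N ∧ q j ∈ Ioo z x} ({j | j < N ∧ q j ∈ Icc x x} ∪ {j | j < N ∧ q j ∈ Ioo x y})
    have u3 := Set.ncard_le_ncard sub ((cnt_fin q N _).union ((cnt_fin q N _).union (cnt_fin q N _)))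
    omega

theorem alt_bdd {w wt wx wxx : ℝ → ℝ → ℝ} {t1 : ℝ} (hw : Sol w wt wx wxx) (h1 : 0 < t1)
    (hdist : ∀ t > 0, ∃ x, w t x ≠ 0) : ∃ K, ∀ k p, Alt (w t1) k p → k ≤ K := by
  obtain ⟨n, hn⟩ := count_bdd (f := w t1) (fun x => by
      by_contra hc
      push Not at hc
      exact no_accum (xs := x) hw h1 hdist (fun y hy => (hc y hy).2) (fun y hy => (hc y hy).1))
    (fun x => by
      by_contra hc
      push Not at hc
      exact no_accum_left (xs := x) hw h1 hdist (fun y hy => (hc y hy).2) (fun y hy => (hc y hy).1)) (isCompact_Icc (a := 0) (b := 4 * π))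
  refine ⟨n, fun k p ⟨hp1, hp2, hp3⟩ => ?_⟩
  have hpi := pi_pos
  have h2pi : 0 < 2 * π := by positivity
  obtain ⟨m, hm⟩ : ∃ m : ℤ, p 0 + m * (2 * π) ∈ Ico 0 (2 * π) := by
    have := existsUnique_add_zsmul_mem_Ico h2pi (p 0) 0
    obtain ⟨m, hm, _⟩ := this
    exact ⟨m, by simpa using hm⟩
  have mono := alt_mono hp1
  have := hn (2 * k) (fun j => p j + m * (2 * π)) (fun i j hij hj => by linarith [mono i j hij hj.le])
    (fun j hj => by rw [hw.per_int t1 h1]; exact hp3 j hj.le)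
  have e : {j | j < 2 * k ∧ p j + m * (2 * π) ∈ Icc 0 (4 * π)} = ((Finset.range (2 * k) : Finset ℕ) : Set ℕ) := by
    ext j
    simp only [mem_ofPred_eq, Finset.coe_range, mem_Iio]
    refine ⟨fun h => h.1, fun hj => ⟨hj, ?_⟩⟩
    have a := mono j (2*k) hj le_rfl
    have b : p 0 ≤ p j := by
      rcases Nat.eq_zero_or_pos j with h | h
      · rw [h]
      · exact (mono 0 j h hj.le).le
    exact ⟨by linarith [hm.1], by linarith [hm.2]⟩
  rw [e, Set.ncard_coe_finset, Finset.card_range] at this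
  omega

theorem alt_back {w wt wx wxx : ℝ → ℝ → ℝ} {s t : ℝ} (hw : Sol w wt wx wxx) (hs : 0 < s) (hst : s ≤ t) {k : ℕ} {p : ℕ → ℝ}
    (h : Alt (w t) k p) : ∃ q, Alt (w s) k q := by
  obtain ⟨hp1, hp2, hp3⟩ := h
  have hex : ∀ j, ∃ γ : ℝ → ℝ, j ≤ 2 * k → Continuous γ ∧ γ t = p j ∧ ∀ r ∈ Icc s t, 0 < (-1)^j * w r (γ r) := by
    intro j
    by_cases hj : j ≤ 2 * k
    · obtain ⟨γ, h⟩ := path_sgn hw hs hst j (hp3 j hj)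
      exact ⟨γ, fun _ => h⟩
    · exact ⟨0, fun h => absurd h hj⟩
  choose γ hγ using hex
  obtain ⟨δ, hδ⟩ : ∃ δ : ℕ → ℝ → ℝ, ∀ j, δ j = if j = 2 * k then fun r => γ 0 r + 2 * π else γ j := ⟨_, fun _ => rfl⟩
  have hk : 0 < k := by
    rcases Nat.eq_zero_or_pos k with h | h
    · rw [h] at hp2; simp only [mul_zero] at hp2; linarith [pi_pos]
    · exact h
  have hd : ∀ j ≤ 2 * k, Continuous (δ j) ∧ δ j t = p j ∧ ∀ r ∈ Icc s t, 0 < (-1)^j * w r (δ j r) := by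
    intro j hj
    rw [hδ]
    split_ifs with h
    · obtain ⟨a, b, c⟩ := hγ 0 (by omega)
      refine ⟨a.add continuous_const, by rw [h, hp2, ← b], fun r hr => ?_⟩
      rw [hw.per r (hs.trans_le hr.1), h, pow_mul]
      simpa using c r hr
    · exact hγ j hj
  refine ⟨fun j => δ j s, fun j hj => ?_, ?_, fun j hj => (hd j hj).2.2 s ⟨le_rfl, hst⟩⟩
  · obtain ⟨a1, b1, c1⟩ := hd j hj.le
    obtain ⟨a2, b2, c2⟩ := hd (j+1) hj
    refine path_order (t0 := s) (t1 := t) a1 a2 (fun r hr e => ?_) (by rw [b1, b2]; exact hp1 j hj) s ⟨le_rfl, hst⟩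
    have x1 := c1 r hr
    have x2 := c2 r hr
    rw [← e, pow_succ] at x2; linarith
  · show δ (2*k) s = δ 0 s + 2 * π
    rw [hδ, hδ, if_pos rfl, if_neg (by omega)]

theorem alt_insert {f : ℝ → ℝ} {k : ℕ} {p : ℕ → ℝ} (h : Alt f k p) {j : ℕ} (hj : j < 2 * k) {x y : ℝ} (h1 : p j ≤ x) (hxy : x < y)
    (h2 : y ≤ p (j+1)) (hx : (-1)^j * f x < 0) (hy : 0 < (-1)^j * f y) : ∃ q, Alt f (k+1) q := by
  obtain ⟨hp1, hp2, hp3⟩ := h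
  have a := hp3 j hj.le
  have b := hp3 (j+1) hj
  have h1' : p j < x := lt_of_le_of_ne h1 (fun e => by rw [e] at a; linarith)
  have h2' : y < p (j+1) := lt_of_le_of_ne h2 (fun e => by rw [← e, pow_succ] at b; linarith)
  obtain ⟨q, hq⟩ : ∃ q : ℕ → ℝ, ∀ i, q i = if i ≤ j then p i else if i = j+1 then x else if i = j+2 then y else p (i-2) := ⟨_, fun _ => rfl⟩
  have q1 : ∀ i ≤ j, q i = p i := fun i hi => by rw [hq, if_pos hi]
  have q2 : q (j+1) = x := by rw [hq, if_neg (by omega), if_pos rfl]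
  have q3 : q (j+2) = y := by rw [hq, if_neg (by omega), if_neg (by omega), if_pos rfl]
  have q4 : ∀ i, j + 1 ≤ i → q (i+2) = p i := fun i hi => by
    rw [hq, if_neg (by omega), if_neg (by omega), if_neg (by omega)]; rfl
  refine ⟨q, fun i hi => ?_, ?_, fun i hi => ?_⟩
  · rcases Nat.lt_trichotomy i j with h | h | h
    · rw [q1 i h.le, q1 (i+1) h]; exact hp1 i (by omega)
    · rw [h, q1 j le_rfl, q2]; exact h1'
    · rcases Nat.lt_trichotomy i (j+2) with h' | h' | h'
      · rw [show i = j + 1 by omega, q2, q3]; exact hxy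
      · rw [h', q3, q4 (j+1) le_rfl]; exact h2'
      · obtain ⟨m, rfl⟩ : ∃ m, i = m + 2 := ⟨i - 2, by omega⟩
        rw [q4 m (by omega), show m + 2 + 1 = (m + 1) + 2 by ring, q4 (m+1) (by omega)]
        exact hp1 m (by omega)
  · rw [show 2 * (k+1) = 2 * k + 2 by ring, q4 _ (by omega), q1 0 (by omega)]; exact hp2
  · rcases Nat.lt_or_ge j i with h | h
    · rcases Nat.lt_trichotomy i (j+2) with h' | h' | h'
      · rw [show i = j + 1 by omega, q2, pow_succ]; linarith
      · rw [h', q3, pow_add]; linarith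
      · obtain ⟨m, rfl⟩ : ∃ m, i = m + 2 := ⟨i - 2, by omega⟩
        rw [q4 m (by omega), pow_add]
        have := hp3 m (by omega)
        linarith
    · rw [q1 i h]; exact hp3 i (by omega)

theorem neg_right {f : ℝ → ℝ} {d a c : ℝ} (h : HasDerivAt f d a) (hd : d < 0) (h0 : f a = 0) (hc : a < c) :
    ∃ y ∈ Ioo a c, f y < 0 := by
  have h1 := (hasDerivAt_iff_tendsto_slope.1 h).eventually_lt_const hd
  have h2 : ∀ᶠ y in 𝓝[>] a, slope f a y < 0 := h1.filter_mono (nhdsWithin_mono a fun y hy => ne_of_gt hy)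
  obtain ⟨y, hy1, hy2⟩ := (h2.and (eventually_mem_set.2 (Ioo_mem_nhdsGT hc))).exists
  refine ⟨y, hy2, ?_⟩
  rw [slope_def_field, h0, sub_zero, div_lt_iff₀ (by linarith [hy2.1]), zero_mul] at hy1
  exact hy1

theorem pos_left {f : ℝ → ℝ} {d a c : ℝ} (h : HasDerivAt f d a) (hd : d < 0) (h0 : f a = 0) (hc : c < a) :
    ∃ y ∈ Ioo c a, 0 < f y := by
  have h1 := (hasDerivAt_iff_tendsto_slope.1 h).eventually_lt_const hd
  have h2 : ∀ᶠ y in 𝓝[<] a, slope f a y < 0 := h1.filter_mono (nhdsWithin_mono a fun y hy => ne_of_lt hy)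
  obtain ⟨y, hy1, hy2⟩ := (h2.and (eventually_mem_set.2 (Ioo_mem_nhdsLT hc))).exists
  refine ⟨y, hy2, ?_⟩
  rw [slope_def_field, h0, sub_zero, div_lt_iff_of_neg (by linarith [hy2.2]), zero_mul] at hy1
  exact hy1

theorem locate {p : ℕ → ℝ} {y : ℝ} (h0 : p 0 ≤ y) : ∀ n, y < p n → ∃ j < n, p j ≤ y ∧ y < p (j+1) := by
  intro n
  induction n with
  | zero => intro h; linarith
  | succ n ih =>
    intro h
    rcases lt_or_ge y (p n) with h1 | h1
    · obtain ⟨j, hj, h2⟩ := ih h1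
      exact ⟨j, by omega, h2⟩
    · exact ⟨n, by omega, h1, h⟩

theorem alt_one_of {f : ℝ → ℝ} (hper : Function.Periodic f (2 * π)) {x y : ℝ} (hx : 0 < f x) (hy : f y < 0) : ∃ p, Alt f 1 p := by
  have h2pi : 0 < 2 * π := by positivity
  obtain ⟨z, hz, hzy⟩ := hper.exists_mem_Ioc h2pi y x
  rw [hzy] at hy
  have hz2 : z ≠ x + 2 * π := fun e => by rw [e, hper] at hy; linarith
  refine ⟨fun j => if j = 0 then x else if j = 1 then z else x + 2 * π, fun j hj => ?_, by simp, fun j hj => ?_⟩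
  · have : j = 0 ∨ j = 1 := by omega
    rcases this with rfl | rfl
    · simpa using hz.1
    · simpa using lt_of_le_of_ne hz.2 hz2
  · have : j = 0 ∨ j = 1 ∨ j = 2 := by omega
    rcases this with rfl | rfl | rfl
    · simpa using hx
    · simpa using hy
    · simpa [hper x] using hx

theorem zero_count {w wt wx wxx : ℝ → ℝ → ℝ} (hw : Sol w wt wx wxx) {T0 t : ℝ} {n : ℕ} (hT0 : 0 < T0) (ht : T0 < t)
    (hno : ∀ s ≥ T0, ∀ q, ¬ Alt (w s) (n+1) q) {p : ℕ → ℝ} (hp : Alt (w t) n p) :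
    (∀ x, w t x = 0 → wx t x ≠ 0) ∧ {x ∈ Set.Ico (0 : ℝ) (2 * π) | w t x = 0}.encard = ((2 * n : ℕ) : ℕ∞) := by
  have h2pi : 0 < 2 * π := by positivity
  have htp : 0 < t := hT0.trans ht
  have hper : Function.Periodic (w t) (2 * π) := hw.per t htp
  obtain ⟨hp1, hp2, hp3⟩ := hp
  have hev : ∀ᶠ s in 𝓝 t, ∀ j ∈ Finset.range (2 * n + 1), 0 < (-1)^j * w s (p j) := by
    rw [Filter.eventually_all_finset]
    intro j hj
    exact (continuousAt_const.mul (line_t (hw.c0 t htp (p j)))).eventually_const_lt (hp3 j (by have := Finset.mem_range.1 hj; omega))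
  obtain ⟨ε, hε, he⟩ := Metric.eventually_nhds_iff.1 hev
  obtain ⟨ts, hts⟩ : ∃ ts, ts = max (t - ε / 2) ((T0 + t) / 2) := ⟨_, rfl⟩
  have hts1 : T0 < ts := by rw [hts]; exact lt_max_of_lt_right (by linarith)
  have hts2 : ts < t := by rw [hts]; exact max_lt (by linarith) (by linarith)
  have hts3 : t - ε / 2 ≤ ts := by rw [hts]; exact le_max_left _ _
  have hsg : ∀ s ∈ Icc ts t, ∀ j ≤ 2 * n, 0 < (-1)^j * w s (p j) := by
    intro s hs j hj
    refine he ?_ j (Finset.mem_range.2 (by omega))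
    rw [Real.dist_eq, abs_lt]
    exact ⟨by linarith [hs.1], by linarith [hs.2]⟩
  have hpair : ∀ s ∈ Icc ts t, ∀ j < 2 * n, ∀ x y, p j ≤ x → x < y → y ≤ p (j+1) → ¬ ((-1)^j * w s x < 0 ∧ 0 < (-1)^j * w s y) := by
    rintro s hs j hj x y h1 h2 h3 ⟨h4, h5⟩
    obtain ⟨q, hq⟩ := alt_insert (f := w s) ⟨hp1, hp2, hsg s hs⟩ hj h1 h2 h3 h4 h5
    exact hno s (hts1.le.trans hs.1) q hq
  have hts0 : 0 < ts := hT0.trans hts1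
  have hsimple : ∀ j < 2 * n, ∀ x ∈ Ioo (p j) (p (j+1)), w t x = 0 → (-1)^j * wx t x < 0 := by
    intro j hj x hx hz
    have hpj := hpair ts ⟨le_rfl, hts2.le⟩ j hj
    have a := fun s hs => hsg s hs j hj.le
    have b := fun s hs => hsg s hs (j+1) hj
    rcases sgn_cases j with ⟨e1, e2⟩ | ⟨e1, e2⟩ <;> simp only [e1, e2] at hpj a b ⊢
    · have := simple_zero hw hts0 hts2 (hp1 j hj) (fun s hs => by linarith [a s hs]) (fun s hs => by linarith [b s hs])
        (fun x y h1 h2 h3 h4 => hpj x y h1 h2 h3 ⟨by linarith [h4.1], by linarith [h4.2]⟩) x hx.1 hx.2 hz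
      linarith
    · have := simple_zero hw.neg hts0 hts2 (hp1 j hj) (fun s hs => by linarith [a s hs]) (fun s hs => by linarith [b s hs])
        (fun x y h1 h2 h3 h4 => hpj x y h1 h2 h3 ⟨by linarith [h4.1], by linarith [h4.2]⟩) x hx.1 hx.2 (by rw [hz, neg_zero])
      linarith
  have huniq : ∀ j < 2 * n, ∀ x ∈ Ioo (p j) (p (j+1)), ∀ y ∈ Ioo (p j) (p (j+1)), w t x = 0 → w t y = 0 → ¬ x < y := by
    intro j hj x hx y hy hzx hzy hxy
    have d := fun z => ((hw.dx t htp z).const_mul ((-1:ℝ)^j))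
    obtain ⟨x', hx', h1⟩ := neg_right (d x) (hsimple j hj x hx hzx) (by simp [hzx]) (show x < (x+y)/2 by linarith)
    obtain ⟨y', hy', h2⟩ := pos_left (d y) (hsimple j hj y hy hzy) (by simp [hzy]) (show (x+y)/2 < y by linarith)
    exact hpair t ⟨hts2.le, le_rfl⟩ j hj x' y' (by linarith [hx.1, hx'.1]) (by linarith [hx'.2, hy'.1]) (by linarith [hy.2, hy'.2]) ⟨h1, h2⟩
  have hexz : ∀ j, ∃ z, j < 2 * n → z ∈ Ioo (p j) (p (j+1)) ∧ w t z = 0 := by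
    intro j
    by_cases hj : j < 2 * n
    · have a := hp3 j hj.le
      have b := hp3 (j+1) hj
      have hc : ContinuousOn (fun z => (-1)^j * w t z) (Icc (p j) (p (j+1))) := (continuous_const.mul (hw.cont_x t htp)).continuousOn
      rw [pow_succ] at b
      obtain ⟨z, hz, hz0⟩ := intermediate_value_Ioo' (hp1 j hj).le hc (show (0:ℝ) ∈ Ioo ((-1)^j * w t (p (j+1))) ((-1)^j * w t (p j)) from ⟨by linarith, a⟩)
      exact ⟨z, fun _ => ⟨hz, (mul_eq_zero.1 hz0).resolve_left (pow_ne_zero _ (by norm_num))⟩⟩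
    · exact ⟨0, fun h => absurd h hj⟩
  choose z hz using hexz
  have mono := alt_mono hp1
  have zmono : ∀ i j, i < j → j < 2 * n → z i < z j := by
    intro i j hij hj
    have a := (hz i (by omega)).1.2
    have b := (hz j hj).1.1
    rcases Nat.lt_or_ge (i+1) j with h | h
    · linarith [mono (i+1) j h hj.le]
    · rw [show i + 1 = j by omega] at a; linarith
  have zran : ∀ j < 2 * n, z j ∈ Ico (p 0) (p 0 + 2 * π) := by
    intro j hj
    have a := (hz j hj).1
    have b : p 0 ≤ p j := by
      rcases Nat.eq_zero_or_pos j with h | h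
      · rw [h]
      · exact (mono 0 j h hj.le).le
    have c : p (j+1) ≤ p (2*n) := by
      rcases Nat.lt_or_ge (j+1) (2*n) with h | h
      · exact (mono _ _ h le_rfl).le
      · rw [show j + 1 = 2 * n by omega]
    exact ⟨by linarith [a.1], by linarith [a.2]⟩
  have hmod : ∀ a x, ∃ m : ℤ, toIcoMod h2pi a x = x + m * (2 * π) := by
    intro a x
    refine ⟨-(toIcoDiv h2pi a x), ?_⟩
    rw [toIcoMod, zsmul_eq_mul]; push_cast; ring
  have hloc : ∀ x, w t x = 0 → ∃ j < 2 * n, toIcoMod h2pi (p 0) x = z j ∧ w t (toIcoMod h2pi (p 0) x) = 0 := by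
    intro x hx
    obtain ⟨m, hm⟩ := hmod (p 0) x
    have hm0 : w t (toIcoMod h2pi (p 0) x) = 0 := by rw [hm, hw.per_int t htp, hx]
    have hmem := toIcoMod_mem_Ico h2pi (p 0) x
    obtain ⟨y, hy⟩ : ∃ y, y = toIcoMod h2pi (p 0) x := ⟨_, rfl⟩
    rw [← hy] at hm0 hmem ⊢
    obtain ⟨j, hj, h1, h2⟩ := locate hmem.1 (2 * n) (by rw [hp2]; exact hmem.2)
    refine ⟨j, hj, ?_, hm0⟩
    have h1' : p j < y := lt_of_le_of_ne h1 fun e => by have := hp3 j hj.le; rw [e, hm0, mul_zero] at this; exact lt_irrefl _ this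
    have u1 := huniq j hj y ⟨h1', h2⟩ (z j) (hz j hj).1 hm0 (hz j hj).2
    have u2 := huniq j hj (z j) (hz j hj).1 y ⟨h1', h2⟩ (hz j hj).2 hm0
    linarith
  constructor
  · intro x hx hwx
    obtain ⟨j, hj, h1, h2⟩ := hloc x hx
    obtain ⟨m, hm⟩ := hmod (p 0) x
    have hpx : Function.Periodic (wx t) (2 * π) := hw.perx t htp
    have e : wx t (z j) = 0 := by rw [← h1, hm, hpx.int_mul m x, hwx]
    have := hsimple j hj (z j) (hz j hj).1 (hz j hj).2
    rw [e, mul_zero] at this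
    exact lt_irrefl _ this
  · have himg : {x ∈ Set.Ico (0 : ℝ) (2 * π) | w t x = 0} = (fun j => toIcoMod h2pi 0 (z j)) '' (Iio (2 * n)) := by
      ext x
      constructor
      · rintro ⟨hx1, hx2⟩
        obtain ⟨j, hj, h1, _⟩ := hloc x hx2
        refine ⟨j, hj, ?_⟩
        show toIcoMod h2pi 0 (z j) = x
        rw [← h1, toIcoMod_toIcoMod]
        exact (toIcoMod_eq_self h2pi).2 (by simpa using hx1)
      · rintro ⟨j, hj, rfl⟩
        obtain ⟨m, hm⟩ := hmod 0 (z j)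
        refine ⟨by simpa using toIcoMod_mem_Ico h2pi 0 (z j), ?_⟩
        show w t (toIcoMod h2pi 0 (z j)) = 0
        rw [hm, hw.per_int t htp]; exact (hz j hj).2
    have hinj : InjOn (fun j => toIcoMod h2pi 0 (z j)) (Iio (2 * n)) := by
      intro i hi j hj e
      have e2 : toIcoMod h2pi (p 0) (toIcoMod h2pi 0 (z i)) = toIcoMod h2pi (p 0) (toIcoMod h2pi 0 (z j)) := congrArg _ e
      rw [toIcoMod_toIcoMod, toIcoMod_toIcoMod, (toIcoMod_eq_self h2pi).2 (zran i hi), (toIcoMod_eq_self h2pi).2 (zran j hj)] at e2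
      rcases Nat.lt_trichotomy i j with h | h | h
      · exact absurd e2 (zmono i j h hj).ne
      · exact h
      · exact absurd e2 (zmono j i h hi).ne'
    rw [himg, hinj.encard_image]
    have : (Iio (2*n) : Set ℕ) = ((Finset.range (2*n) : Finset ℕ) : Set ℕ) := by ext; simp
    rw [this, Set.encard_coe_eq_coe_finsetCard, Finset.card_range]

theorem no_zero {w wt wx wxx : ℝ → ℝ → ℝ} (hw : Sol w wt wx wxx) {T0 t x1 : ℝ} (hT0 : 0 < T0) (ht : T0 < t)
    (hno : ∀ q, ¬ Alt (w T0) 1 q) (hx1 : 0 < w T0 x1) (x : ℝ) : w t x ≠ 0 := by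
  refine (strong_pos hw hT0 ht (fun s hs y => ?_) hx1 x).ne'
  by_contra hc
  push Not at hc
  obtain ⟨γ, _, _, h⟩ := path_neg hw hT0 hs.1 hc
  obtain ⟨q, hq⟩ := alt_one_of (hw.per T0 hT0) hx1 (h T0 ⟨le_rfl, hs.1⟩)
  exact hno q hq

theorem sol_final {w wt wx wxx : ℝ → ℝ → ℝ} (hw : Sol w wt wx wxx) (hdist : ∀ t > 0, ∃ x, w t x ≠ 0) :
    ∃ T > (0:ℝ), ∃ N : ℕ, ∀ t ≥ T, (∀ x, w t x = 0 → wx t x ≠ 0) ∧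
      {x ∈ Set.Ico (0 : ℝ) (2 * π) | w t x = 0}.encard = (N : ℕ∞) := by
  classical
  obtain ⟨K, hK⟩ := alt_bdd hw one_pos hdist
  have hex : ∃ n : ℕ, ∃ t ≥ (1:ℝ), ∀ k p, Alt (w t) k p → k ≤ n := ⟨K, 1, le_rfl, hK⟩
  obtain ⟨T0, hT0, hb⟩ := Nat.find_spec hex
  have hmin := fun m (hm : m < Nat.find hex) => Nat.find_min hex hm
  obtain ⟨n, hn⟩ : ∃ n, n = Nat.find hex := ⟨_, rfl⟩
  rw [← hn] at hb
  simp only [← hn] at hmin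
  have hT0p : 0 < T0 := by linarith
  have hle : ∀ s ≥ T0, ∀ k p, Alt (w s) k p → k ≤ n := fun s hs k p h => by
    obtain ⟨q, hq⟩ := alt_back hw hT0p hs h
    exact hb k q hq
  have hno : ∀ s ≥ T0, ∀ q, ¬ Alt (w s) (n+1) q := fun s hs q h => by have := hle s hs _ q h; omega
  refine ⟨T0 + 1, by linarith, 2 * n, fun t ht => ?_⟩
  have htT : T0 < t := by linarith
  rcases Nat.eq_zero_or_pos n with h0 | h0
  · have hnz : ∀ x, w t x ≠ 0 := by
      obtain ⟨x1, hx1⟩ := hdist T0 hT0p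
      have hno1 := hno T0 le_rfl
      rw [h0] at hno1
      rcases lt_or_gt_of_ne hx1 with h | h
      · intro x hx
        refine no_zero hw.neg hT0p htT (x1 := x1) (fun q hq => ?_) (by simpa using h) x (by simpa using hx)
        have q0 := hq.2.2 0 (by omega)
        have q1 := hq.2.2 1 (by omega)
        obtain ⟨q', hq'⟩ := alt_one_of (hw.per T0 hT0p) (x := q 1) (y := q 0) (by simpa using q1) (by simpa using q0)
        exact hno1 q' hq'
      · exact no_zero hw hT0p htT hno1 h
    refine ⟨fun x hx => absurd hx (hnz x), ?_⟩
    rw [h0]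
    simp [hnz]
  · have : ∃ p, Alt (w t) n p := by
      by_contra hc
      push Not at hc
      refine hmin (n-1) (by omega) ⟨t, by linarith, fun k p hk => ?_⟩
      have := hle t htT.le k p hk
      have hne : k ≠ n := fun e => hc p (e ▸ hk)
      omega
    obtain ⟨p, hp⟩ := this
    exact zero_count hw hT0p htT hno hp

theorem stmt6
    (g gu gp guu gup gpu gpp : ℝ → ℝ → ℝ → ℝ)
    (hg_cont : Continuous (fun p : ℝ × ℝ × ℝ => g p.1 p.2.1 p.2.2))
    (hgC2 : ∀ t : ℝ, ContDiff ℝ 2 (fun q : ℝ × ℝ => g t q.1 q.2))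
    (hgu : ∀ t u p : ℝ, HasDerivAt (fun v => g t v p) (gu t u p) u)
    (hgp : ∀ t u p : ℝ, HasDerivAt (fun q => g t u q) (gp t u p) p)
    (hguu : ∀ t u p : ℝ, HasDerivAt (fun v => gu t v p) (guu t u p) u)
    (hgup : ∀ t u p : ℝ, HasDerivAt (fun q => gu t u q) (gup t u p) p)
    (hgpu : ∀ t u p : ℝ, HasDerivAt (fun v => gp t v p) (gpu t u p) u)
    (hgpp : ∀ t u p : ℝ, HasDerivAt (fun q => gp t u q) (gpp t u p) p)
    (hadm : Admissible g ∧ Admissible gu ∧ Admissible gp ∧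
      Admissible guu ∧ Admissible gup ∧ Admissible gpu ∧ Admissible gpp)
    (u₁ u₂ u₁t u₁x u₁xx u₂t u₂x u₂xx : ℝ → ℝ → ℝ)
    (hu₁_cont : ContinuousOn (fun p : ℝ × ℝ => u₁ p.1 p.2) (Set.Ici 0 ×ˢ Set.univ))
    (hu₂_cont : ContinuousOn (fun p : ℝ × ℝ => u₂ p.1 p.2) (Set.Ici 0 ×ˢ Set.univ))
    (hu₁t_cont : ContinuousOn (fun p : ℝ × ℝ => u₁t p.1 p.2) (Set.Ioi 0 ×ˢ Set.univ))
    (hu₁x_cont : ContinuousOn (fun p : ℝ × ℝ => u₁x p.1 p.2) (Set.Ioi 0 ×ˢ Set.univ))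
    (hu₁xx_cont : ContinuousOn (fun p : ℝ × ℝ => u₁xx p.1 p.2) (Set.Ioi 0 ×ˢ Set.univ))
    (hu₂t_cont : ContinuousOn (fun p : ℝ × ℝ => u₂t p.1 p.2) (Set.Ioi 0 ×ˢ Set.univ))
    (hu₂x_cont : ContinuousOn (fun p : ℝ × ℝ => u₂x p.1 p.2) (Set.Ioi 0 ×ˢ Set.univ))
    (hu₂xx_cont : ContinuousOn (fun p : ℝ × ℝ => u₂xx p.1 p.2) (Set.Ioi 0 ×ˢ Set.univ))
    (hu₁per : ∀ t ≥ (0:ℝ), ∀ x : ℝ, u₁ t (x + 2 * Real.pi) = u₁ t x)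
    (hu₂per : ∀ t ≥ (0:ℝ), ∀ x : ℝ, u₂ t (x + 2 * Real.pi) = u₂ t x)
    (hu₁_dt : ∀ t > (0:ℝ), ∀ x : ℝ, HasDerivAt (fun s => u₁ s x) (u₁t t x) t)
    (hu₁_dx : ∀ t > (0:ℝ), ∀ x : ℝ, HasDerivAt (fun y => u₁ t y) (u₁x t x) x)
    (hu₁_dxx : ∀ t > (0:ℝ), ∀ x : ℝ, HasDerivAt (fun y => u₁x t y) (u₁xx t x) x)
    (hu₂_dt : ∀ t > (0:ℝ), ∀ x : ℝ, HasDerivAt (fun s => u₂ s x) (u₂t t x) t)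
    (hu₂_dx : ∀ t > (0:ℝ), ∀ x : ℝ, HasDerivAt (fun y => u₂ t y) (u₂x t x) x)
    (hu₂_dxx : ∀ t > (0:ℝ), ∀ x : ℝ, HasDerivAt (fun y => u₂x t y) (u₂xx t x) x)
    (heq₁ : ∀ t > (0:ℝ), ∀ x : ℝ, u₁t t x = u₁xx t x + g t (u₁ t x) (u₁x t x))
    (heq₂ : ∀ t > (0:ℝ), ∀ x : ℝ, u₂t t x = u₂xx t x + g t (u₂ t x) (u₂x t x))
    (hbdd : ∀ η > (0:ℝ), ∃ M : ℝ, ∀ t ≥ η, ∀ x : ℝ,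
      |u₁ t x| ≤ M ∧ |u₁x t x| ≤ M ∧ |u₂ t x| ≤ M ∧ |u₂x t x| ≤ M)
    (hdist : ∀ t ≥ (0:ℝ), ∃ x : ℝ, u₁ t x ≠ u₂ t x) :
    ∃ T > (0:ℝ), ∃ N : ℕ, ∀ t ≥ T,
      (∀ x ∈ Set.Ico (0:ℝ) (2 * Real.pi),
        u₁ t x - u₂ t x = 0 → u₁x t x - u₂x t x ≠ 0) ∧
      zeroNum (fun x => u₁ t x - u₂ t x) = (N : ℕ∞) := by
  have hb : ∀ h : ℝ → ℝ → ℝ → ℝ, Admissible h →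
      ∀ R : ℝ, ∃ M : ℝ, ∀ t u p : ℝ, |u| ≤ R → |p| ≤ R → |h t u p| ≤ M := by
    intro h hh R
    obtain ⟨M, hM⟩ := (hh (Set.Icc (-R) R ×ˢ Set.Icc (-R) R) (isCompact_Icc.prod isCompact_Icc)).1
    exact ⟨M, fun t u p hu hp => hM t (u, p) ⟨abs_le.1 hu, abs_le.1 hp⟩⟩
  obtain ⟨T, hT, N, h⟩ := sol_final
    (mk_sol g gu gp hgu hgp (hb gu hadm.2.1) (hb gp hadm.2.2.1) u₁ u₂ u₁t u₁x u₁xx u₂t u₂x u₂xx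
      hu₁_cont hu₂_cont hu₁t_cont hu₁x_cont hu₁xx_cont hu₂t_cont hu₂x_cont hu₂xx_cont
      hu₁per hu₂per hu₁_dt hu₁_dx hu₁_dxx hu₂_dt hu₂_dx hu₂_dxx heq₁ heq₂ hbdd)
    (fun t ht => by
      obtain ⟨x, hx⟩ := hdist t (le_of_lt ht)
      exact ⟨x, sub_ne_zero.2 hx⟩)
  exact ⟨T, hT, N, fun t ht => ⟨fun x _ hx => (h t ht).1 x hx, (h t ht).2⟩⟩
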